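/- Let 1 ≤ m ≤ n be natural numbers. For any continuous map f : [0,1]^n → ℝ^m there exists t ∈ ℝ^m such that #(f^{-1}(t), ‖·‖_∞, r) ≥ (1/8^n)·(1/r)^{n−m} for all 0 < r < 1/2, where for a compact subset A ⊂ ℝ^n, #(A, ‖·‖_∞, r) denotes the minimal number N of open sets U_1, …, U_N covering A with ℓ^∞-diameter diam(U_i, ‖·‖_∞) < r (set to 0 when A is empty). -/

import Mathlib

open Filter Topology
open scoped ENNReal NNReal

noncomputable section

/-- Diameter (in `ℝ≥0∞`) of a set with respect to a distance function `ρ`. -/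
def setEDiam {X : Type*} (ρ : X → X → ℝ) (E : Set X) : ℝ≥0∞ :=
  ⨆ x ∈ E, ⨆ y ∈ E, ENNReal.ofReal (ρ x y)

/-- Openness with respect to a distance function `ρ`. -/
def ROpen {X : Type*} (ρ : X → X → ℝ) (U : Set X) : Prop :=
  ∀ x ∈ U, ∃ δ > 0, ∀ y, ρ x y < δ → y ∈ U

/-- `#(E, ρ, ε)`: the minimal number `n` of `ρ`-open sets of `ρ`-diameter `< ε` covering `E`
(`0` when `E = ∅`, since the empty family covers it). -/
def covNum {X : Type*} (ρ : X → X → ℝ) (ε : ℝ) (E : Set X) : ℕ :=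
  sInf {n : ℕ | ∃ U : Fin n → Set X, (∀ i, ROpen ρ (U i)) ∧
    (∀ i, setEDiam ρ (U i) < ENNReal.ofReal ε) ∧ E ⊆ ⋃ i, U i}

/-- The dynamical metric `d_N(x,y) = max_{0 ≤ n < N} d(Tⁿx, Tⁿy)`. -/
def dynDist {X : Type*} (T : X → X) (d : X → X → ℝ) (N : ℕ) (x y : X) : ℝ :=
  sSup {r : ℝ | ∃ n, n < N ∧ r = d (T^[n] x) (T^[n] y)}

/-- `sup_{y ∈ Y} log #(π⁻¹(y), ρ, ε)`. -/
def supLogCov {X Y : Type*} (π : X → Y) (ρ : X → X → ℝ) (ε : ℝ) : ℝ :=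
  ⨆ y : Y, Real.log (covNum ρ ε (π ⁻¹' {y}) : ℝ)

/-- `sup_{y ∈ Y} log #(π⁻¹(B_δ(y, ρY)), ρX, ε)` where `B_δ` is the closed `δ`-ball. -/
def supLogCovBall {X Y : Type*} (π : X → Y) (ρX : X → X → ℝ) (ρY : Y → Y → ℝ)
    (ε δ : ℝ) : ℝ :=
  ⨆ y : Y, Real.log (covNum ρX ε (π ⁻¹' {x | ρY x y ≤ δ}) : ℝ)

/-- Topological conditional entropy
`h_top(π, T) = lim_{ε→0} lim_{N→∞} (sup_y log #(π⁻¹(y), d_N, ε))/N`, as an extended real. -/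
def condEntropy {X Y : Type*} (π : X → Y) (T : X → X) (d : X → X → ℝ) : EReal :=
  Filter.limsup (fun ε : ℝ => Filter.liminf
      (fun N : ℕ => ((supLogCov π (dynDist T d N) ε / N : ℝ) : EReal)) Filter.atTop)
    (𝓝[>] (0 : ℝ))

/-- `lim_{N→∞} (sup_y log #(π⁻¹(y), d_N, ε))/(N log(1/ε))` (the limit exists by
subadditivity; it is realized here as a liminf). -/
def condMdimRate {X Y : Type*} (π : X → Y) (T : X → X) (d : X → X → ℝ) (ε : ℝ) : EReal :=
  Filter.liminf (fun N : ℕ =>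
    ((supLogCov π (dynDist T d N) ε / (N * Real.log (1 / ε)) : ℝ) : EReal)) Filter.atTop

/-- Lower conditional metric mean dimension of `π : (X,T,d) → Y`. -/
def lowerCondMdimM {X Y : Type*} (π : X → Y) (T : X → X) (d : X → X → ℝ) : EReal :=
  Filter.liminf (fun ε : ℝ => condMdimRate π T d ε) (𝓝[>] (0 : ℝ))

/-- Upper conditional metric mean dimension of `π : (X,T,d) → Y`. -/
def upperCondMdimM {X Y : Type*} (π : X → Y) (T : X → X) (d : X → X → ℝ) : EReal :=
  Filter.limsup (fun ε : ℝ => condMdimRate π T d ε) (𝓝[>] (0 : ℝ))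

/-- `lim_{N→∞} log #(X, d_N, ε)/(N log(1/ε))`. -/
def mdimMRate {X : Type*} (T : X → X) (d : X → X → ℝ) (ε : ℝ) : EReal :=
  Filter.liminf (fun N : ℕ =>
    ((Real.log (covNum (dynDist T d N) ε (Set.univ : Set X) : ℝ) /
      (N * Real.log (1 / ε)) : ℝ) : EReal)) Filter.atTop

/-- Lower metric mean dimension of `(X, T, d)`. -/
def lowerMdimM {X : Type*} (T : X → X) (d : X → X → ℝ) : EReal :=
  Filter.liminf (fun ε : ℝ => mdimMRate T d ε) (𝓝[>] (0 : ℝ))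

/-- Upper metric mean dimension of `(X, T, d)`. -/
def upperMdimM {X : Type*} (T : X → X) (d : X → X → ℝ) : EReal :=
  Filter.limsup (fun ε : ℝ => mdimMRate T d ε) (𝓝[>] (0 : ℝ))

/-- `widim_ε(X, ρ)`: the minimal `k` such that there are a finite simplicial complex of
dimension `≤ k` (realized in some `ℝ^m`) and a continuous `ε`-embedding `f : X → P`
(all fibers of `f` have `ρ`-diameter `< ε`). -/
def widim (X : Type*) [TopologicalSpace X] (ρ : X → X → ℝ) (ε : ℝ) : ℕ :=
  sInf {k : ℕ | ∃ (m : ℕ) (K : Geometry.SimplicialComplex ℝ (Fin m → ℝ)),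
    K.faces.Finite ∧ (∀ s ∈ K.faces, s.card ≤ k + 1) ∧
    ∃ f : X → K.space, Continuous f ∧
      ∀ p : K.space, setEDiam ρ (f ⁻¹' {p}) < ENNReal.ofReal ε}

/-- Mean dimension `mdim(X, T) = lim_{ε→0} lim_{N→∞} widim_ε(X, d_N)/N`. -/
def mdim (X : Type*) [TopologicalSpace X] (T : X → X) (d : X → X → ℝ) : EReal :=
  Filter.limsup (fun ε : ℝ => Filter.liminf
      (fun N : ℕ => (((widim X (dynDist T d N) ε : ℝ) / N : ℝ) : EReal)) Filter.atTop)
    (𝓝[>] (0 : ℝ))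

/-- The cube `[0,1]^a`. -/
abbrev Cube (a : ℕ) := Fin a → unitInterval

/-- The full shift space `([0,1]^a)^ℤ`. -/
abbrev FullShift (a : ℕ) := ℤ → Cube a

/-- The shift map `σ((x_n)_n) = (x_{n+1})_n`. -/
def shift {α : Type*} (x : ℤ → α) : ℤ → α := fun n => x (n + 1)

/-- The `ℓ^∞`-distance on the cube `[0,1]^a`. -/
def cubeDist {a : ℕ} (x y : Cube a) : ℝ :=
  ‖(fun i => (x i : ℝ)) - fun i => (y i : ℝ)‖

/-- The metric `D((x_n), (y_n)) = Σ_{n∈ℤ} 2^{-|n|} ‖x_n − y_n‖_∞` on the full shift. -/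
def shiftDist {a : ℕ} (x y : FullShift a) : ℝ :=
  ∑' n : ℤ, (2 : ℝ) ^ (-|n|) * cubeDist (x n) (y n)

end

/-- The origin is a nonnegative nontrivial combination of the vectors with index in `J`. -/
def ZeroOn {ι W : Type*} [Fintype ι] [AddCommGroup W] [Module ℝ W] (v : ι → W) (J : Set ι) : Prop :=
  ∃ c : ι → ℝ, (∀ i, 0 ≤ c i) ∧ c ≠ 0 ∧ (∀ i, i ∉ J → c i = 0) ∧ ∑ i, c i • v i = 0

section parity
variable {ι W : Type*} [Fintype ι] [AddCommGroup W] [Module ℝ W]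

theorem zeroOn_mono {v : ι → W} {J J' : Set ι} (h : J ⊆ J') (hz : ZeroOn v J) : ZeroOn v J' := by
  obtain ⟨c, h0, h1, h2, h3⟩ := hz
  exact ⟨c, h0, h1, fun i hi => h2 i (fun hi' => hi (h hi')), h3⟩

theorem even_card_zeroOn_compl [DecidableEq ι] [FiniteDimensional ℝ W] (v : ι → W)
    (hcard : Fintype.card ι = Module.finrank ℝ W + 2)
    (hnd : ∀ i j, i ≠ j → ¬ ZeroOn v ({i, j}ᶜ : Set ι)) :
    Even (Set.ncard {i | ZeroOn v ({i}ᶜ : Set ι)}) := by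
  classical
  by_cases hne : ∃ i, ZeroOn v ({i}ᶜ : Set ι)
  swap
  · have : {i | ZeroOn v ({i}ᶜ : Set ι)} = ∅ := by
      ext i; simp; exact fun h => hne ⟨i, h⟩
    simp [this]
  obtain ⟨a, l, hl0, hl1, hl2, hl3⟩ := hne
  have key : ∀ c : ι → ℝ, (∀ i, 0 ≤ c i) → ∑ i, c i • v i = 0 → ∀ i j, i ≠ j → c i = 0 → c j = 0 →
      c = 0 := by
    intro c h0 h1 i j hij hi hj
    by_contra hc
    refine hnd i j hij ⟨c, h0, hc, ?_, h1⟩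
    intro k hk
    simp at hk
    by_cases h : k = i
    · rw [h, hi]
    · rw [hk h, hj]
  have hla : l a = 0 := hl2 a (by simp)
  have hlpos : ∀ j, j ≠ a → 0 < l j := fun j hj =>
    lt_of_le_of_ne (hl0 j) (fun h => hl1 (key l hl0 hl3 a j hj.symm hla h.symm))
  have hnt : ∃ b, b ≠ a := by
    have : 1 < Fintype.card ι := by omega
    have := Fintype.one_lt_card_iff_nontrivial.1 this
    exact exists_ne a
  have hF : (Finset.univ.erase a).Nonempty := by
    obtain ⟨b, hb⟩ := hnt
    exact ⟨b, by simp [hb]⟩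
  have hmin : ∀ κ : ι → ℝ, ∃ b, b ≠ a ∧ ∀ j, j ≠ a → κ b / l b ≤ κ j / l j := by
    intro κ
    obtain ⟨b, hb, hb'⟩ := Finset.exists_min_image (Finset.univ.erase a) (fun j => κ j / l j) hF
    exact ⟨b, by simpa using hb, fun j hj => hb' j (by simp [hj])⟩
  have hcomb : ∀ (κ : ι → ℝ) (t : ℝ), ∑ i, κ i • v i = 0 → ∑ i, (κ i - t * l i) • v i = 0 := by
    intro κ t h
    simp only [sub_smul, Finset.sum_sub_distrib, h, mul_smul, ← Finset.smul_sum, hl3, smul_zero, sub_self]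
  have hmult : ∀ κ : ι → ℝ, ∑ i, κ i • v i = 0 → κ a = 0 → ∃ t : ℝ, ∀ i, κ i = t * l i := by
    intro κ hκ ha
    obtain ⟨b, hb, hb'⟩ := hmin κ
    refine ⟨κ b / l b, fun i => ?_⟩
    have := key (fun i => κ i - κ b / l b * l i) ?_ (hcomb κ _ hκ) a b hb.symm ?_ ?_
    · have := congrFun this i
      simp at this; linarith
    · intro i
      by_cases hi : i = a
      · subst hi; simp [ha, hla]
      · have := hb' i hi
        rw [le_div_iff₀ (hlpos i hi)] at this
        linarith
    · simp [ha, hla]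
    · have := (hlpos b hb).ne'
      field_simp; simp
  obtain ⟨μ, hμ, hμa⟩ : ∃ μ : ι → ℝ, ∑ i, μ i • v i = 0 ∧ μ a = 1 := by
    by_contra hcon
    push Not at hcon
    let f : (ι → ℝ) →ₗ[ℝ] W := Fintype.linearCombination ℝ v
    have hf : ∀ c, f c = ∑ i, c i • v i := fun c => by simp [f, Fintype.linearCombination_apply]
    have h1 := LinearMap.finrank_range_add_finrank_ker f
    have h2 := Submodule.finrank_le (LinearMap.range f)
    have h3 : LinearMap.ker f ≤ Submodule.span ℝ {l} := by
      intro κ hκ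
      rw [LinearMap.mem_ker, hf] at hκ
      have ha : κ a = 0 := by
        by_contra ha
        refine hcon (fun i => (κ a)⁻¹ * κ i) ?_ (by field_simp)
        simp only [mul_smul, ← Finset.smul_sum, hκ, smul_zero]
      obtain ⟨t, ht⟩ := hmult κ hκ ha
      rw [Submodule.mem_span_singleton]
      exact ⟨t, by ext i; simp [ht i]⟩
    have h4 := Submodule.finrank_mono h3
    have h5 := finrank_span_le_card (R := ℝ) ({l} : Set (ι → ℝ))
    simp at h5 h1
    omega
  obtain ⟨b, hb, hb'⟩ := hmin μ
  set q : ι → ℝ := fun i => μ i - μ b / l b * l i with hq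
  have hq0 : ∀ i, 0 ≤ q i := by
    intro i
    by_cases hi : i = a
    · subst hi; simp [hq, hμa, hla]
    · have := hb' i hi
      rw [le_div_iff₀ (hlpos i hi)] at this
      simp only [hq]; linarith
  have hqa : q a = 1 := by simp [hq, hμa, hla]
  have hqb : q b = 0 := by
    have := (hlpos b hb).ne'
    simp only [hq]; field_simp; simp
  have hqs : ∑ i, q i • v i = 0 := hcomb μ _ hμ
  have : {i | ZeroOn v ({i}ᶜ : Set ι)} = {a, b} := by
    ext i
    simp only [Set.mem_ofPred_eq, Set.mem_insert_iff, Set.mem_singleton_iff]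
    constructor
    · rintro ⟨c, hc0, hc1, hc2, hc3⟩
      by_contra! hi
      have hci : c i = 0 := hc2 i (by simp)
      have hca : 0 < c a := lt_of_le_of_ne (hc0 a)
        (fun h => hc1 (key c hc0 hc3 a i hi.1.symm h.symm hci))
      obtain ⟨t, ht⟩ := hmult (fun j => (c a)⁻¹ * c j - q j) (by
        simp only [sub_smul, mul_smul, Finset.sum_sub_distrib, ← Finset.smul_sum, hc3, hqs]
        simp) (by simp [hqa, hca.ne'])
      have h1 := ht i
      have h2 := ht b
      simp only [hci, hqb] at h1 h2
      have hqi : 0 < q i := lt_of_le_of_ne (hq0 i) (fun h => by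
        have := key q hq0 hqs i b hi.2 h.symm hqb
        rw [this] at hqa; simp at hqa)
      have h3 : 0 ≤ (c a)⁻¹ * c b := mul_nonneg (by positivity) (hc0 b)
      have h4 := hlpos i hi.1
      have h5 := hlpos b hb
      have : 0 ≤ t := by
        by_contra h; push Not at h
        nlinarith
      nlinarith
    · rintro (rfl | rfl)
      · exact ⟨l, hl0, hl1, hl2, hl3⟩
      · exact ⟨q, hq0, fun h => by rw [h] at hqa; simp at hqa, fun j hj => by
          simp at hj; rw [hj, hqb], hqs⟩
  rw [this, Set.ncard_pair hb.symm]
  exact even_two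

end parity

section parity
variable {ι κ W : Type*} [Fintype ι] [Fintype κ] [AddCommGroup W] [Module ℝ W]

theorem zeroOn_congr {v v' : ι → W} {J : Set ι} (h : ∀ i ∈ J, v i = v' i) :
    ZeroOn v J ↔ ZeroOn v' J := by
  have : ∀ {v v' : ι → W}, (∀ i ∈ J, v i = v' i) → ZeroOn v J → ZeroOn v' J := by
    rintro v v' h ⟨c, h0, h1, h2, h3⟩
    refine ⟨c, h0, h1, h2, ?_⟩
    rw [← h3]
    refine Finset.sum_congr rfl fun i _ => ?_
    by_cases hi : i ∈ J
    · rw [h i hi]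
    · simp [h2 i hi]
  exact ⟨this h, this (fun i hi => (h i hi).symm)⟩

theorem zeroOn_image {f : κ → ι} (hf : Function.Injective f) (v : ι → W) (J : Set κ) :
    ZeroOn v (f '' J) ↔ ZeroOn (fun k => v (f k)) J := by
  classical
  have hsum : ∀ (c : ι → ℝ), (∀ i, i ∉ Set.range f → c i = 0) →
      ∑ i, c i • v i = ∑ k, c (f k) • v (f k) := by
    intro c hc
    symm
    refine Finset.sum_of_injOn f hf.injOn (by simp) ?_ (by simp)
    intro i _ hi
    rw [hc i (by simpa using hi), zero_smul]
  constructor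
  · rintro ⟨c, h0, h1, h2, h3⟩
    have hr : ∀ i, i ∉ Set.range f → c i = 0 := fun i hi =>
      h2 i (fun ⟨k, _, hk⟩ => hi ⟨k, hk⟩)
    refine ⟨fun k => c (f k), fun k => h0 _, ?_, ?_, by rw [← hsum c hr, h3]⟩
    · intro h
      apply h1
      ext i
      by_cases hi : i ∈ Set.range f
      · obtain ⟨k, rfl⟩ := hi
        exact congrFun h k
      · exact hr i hi
    · intro k hk
      exact h2 _ (fun ⟨k', hk', h⟩ => hk (hf h ▸ hk'))
  · rintro ⟨c, h0, h1, h2, h3⟩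
    have he : ∀ k, Function.extend f c 0 (f k) = c k := fun k => hf.extend_apply c 0 k
    have hr : ∀ i, i ∉ Set.range f → Function.extend f c 0 i = 0 := fun i hi =>
      Function.extend_apply' _ _ _ hi
    refine ⟨Function.extend f c 0, ?_, ?_, ?_, ?_⟩
    · intro i
      by_cases hi : i ∈ Set.range f
      · obtain ⟨k, rfl⟩ := hi
        rw [he]; exact h0 k
      · rw [hr i hi]
    · intro h
      apply h1
      ext k
      rw [← he k, h]; rfl
    · intro i hi
      by_cases hi' : i ∈ Set.range f
      · obtain ⟨k, rfl⟩ := hi'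
        rw [he]
        exact h2 k (fun hk => hi ⟨k, hk, rfl⟩)
      · exact hr i hi'
    · rw [hsum _ hr, ← h3]
      simp [he]

theorem zeroOn_map {V : Type*} [AddCommGroup V] [Module ℝ V] (L : W →ₗ[ℝ] V)
    (v : ι → W) {J : Set ι} (h : ZeroOn v J) : ZeroOn (fun i => L (v i)) J := by
  obtain ⟨c, h0, h1, h2, h3⟩ := h
  refine ⟨c, h0, h1, h2, ?_⟩
  have := congrArg L h3
  simpa using this

/-- If `v a` is not in the span of the other vectors of `J`, it is irrelevant. -/
theorem zeroOn_diff_of_notMem_span {v : ι → W} {J : Set ι} {a : ι}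
    (ha : v a ∉ Submodule.span ℝ (v '' (J \ {a}))) (h : ZeroOn v J) : ZeroOn v (J \ {a}) := by
  classical
  obtain ⟨c, h0, h1, h2, h3⟩ := h
  by_cases hc : c a = 0
  · refine ⟨c, h0, h1, ?_, h3⟩
    intro i hi
    by_cases hia : i = a
    · rw [hia, hc]
    · exact h2 i (fun h => hi ⟨h, hia⟩)
  · exfalso
    apply ha
    rw [← Finset.add_sum_erase _ _ (Finset.mem_univ a)] at h3
    have : v a = (c a)⁻¹ • (-∑ i ∈ Finset.univ.erase a, c i • v i) := by
      rw [← eq_neg_of_add_eq_zero_left h3, smul_smul, inv_mul_cancel₀ hc, one_smul]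
    rw [this]
    refine Submodule.smul_mem _ _ (Submodule.neg_mem _ (Submodule.sum_mem _ fun i hi => ?_))
    by_cases hi' : i ∈ J
    · exact Submodule.smul_mem _ _ (Submodule.subset_span ⟨i, ⟨hi', by simpa using hi⟩, rfl⟩)
    · simp [h2 i hi']

open Classical in
theorem sum_zeroOn_compl [FiniteDimensional ℝ W] (v : ι → W)
    (hcard : Fintype.card ι = Module.finrank ℝ W + 2)
    (hnd : ∀ i j, i ≠ j → ¬ ZeroOn v ({i, j}ᶜ : Set ι)) :
    ∑ i, (if ZeroOn v ({i}ᶜ : Set ι) then (1 : ZMod 2) else 0) = 0 := by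
  have := even_card_zeroOn_compl v hcard hnd
  rw [Finset.sum_boole]
  rw [Set.ncard_eq_toFinset_card'] at this
  rw [ZMod.natCast_eq_zero_iff_even]
  convert this
  ext; simp

open Classical in
theorem parity_fiber {T : Type*} {d : ℕ} [FiniteDimensional ℝ W] (hd : Module.finrank ℝ W = d)
    (C : Finset (Fin (d + 1) → T)) (r : Fin (d + 1)) (t : T)
    (flip : Fin (d + 1) → (Fin (d + 1) → T) → (Fin (d + 1) → T))
    (hmem : ∀ j, ∀ s ∈ C, flip j s ∈ C) (hff : ∀ j, ∀ s ∈ C, flip j (flip j s) = s)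
    (hne : ∀ j, ∀ s ∈ C, flip j s ≠ s)
    (heq : ∀ j, ∀ s ∈ C, ∀ i, i ≠ j → flip j s i = s i)
    (F : T → W) (y : W)
    (hF : ∀ s ∈ C, ∀ j, ¬ ZeroOn (fun i => F (s i)) {j}ᶜ)
    (hy : ∀ s ∈ C, ∀ j j', j ≠ j' → y ∉ Submodule.span ℝ ((fun i => F (s i)) '' {j, j'}ᶜ)) :
    ((C.filter fun s => s r = t ∧ ZeroOn (fun i => F (s i)) Set.univ).card : ZMod 2) =
      (C.filter fun s => s r = t ∧
        ZeroOn (Function.update (fun i => F (s i)) r y) Set.univ).card := by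
  set u : (Fin (d + 1) → T) → Option (Fin (d + 1)) → W :=
    fun s o => o.elim y (fun i => F (s i)) with hu
  have hsome : Function.Injective (some : Fin (d + 1) → Option (Fin (d + 1))) :=
    Option.some_injective _
  have h1 : ∀ s, ZeroOn (u s) {none}ᶜ ↔ ZeroOn (fun i => F (s i)) Set.univ := by
    intro s
    have := zeroOn_image hsome (u s) Set.univ
    rw [← show _ ↔ ZeroOn (fun i => F (s i)) Set.univ from this]
    congr! 1
    ext o; cases o <;> simp
  have h2 : ∀ s, ZeroOn (u s) {some r}ᶜ ↔
      ZeroOn (Function.update (fun i => F (s i)) r y) Set.univ := by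
    intro s
    have hinj : Function.Injective (Function.update (some : Fin (d + 1) → _) r none) := by
      intro a b hab
      by_cases ha : a = r <;> by_cases hb : b = r <;> simp_all
    have := zeroOn_image hinj (u s) Set.univ
    convert this using 2
    · ext o
      cases o with
      | none => simp; exact ⟨r, by simp⟩
      | some i =>
        simp only [Set.mem_compl_iff, Set.mem_singleton_iff, Option.some.injEq, Set.image_univ,
          Set.mem_range]
        constructor
        · intro h; exact ⟨i, by simp [h]⟩
        · rintro ⟨k, hk⟩
          by_cases h : k = r
          · simp [h] at hk
          · simp [h] at hk; rwa [← hk]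
    · ext i
      by_cases hi : i = r
      · subst hi; simp [hu]
      · simp [hi, hu]
  have hnd : ∀ s ∈ C, ∀ o o', o ≠ o' → ¬ ZeroOn (u s) ({o, o'}ᶜ : Set (Option (Fin (d + 1)))) := by
    intro s hs
    have hone : ∀ j, ¬ ZeroOn (u s) ({none, some j}ᶜ : Set (Option (Fin (d + 1)))) := by
      intro j hz
      have := zeroOn_image hsome (u s) {j}ᶜ
      apply hF s hs j
      rw [← show _ ↔ ZeroOn (fun i => F (s i)) {j}ᶜ from this]
      convert hz using 1
      ext o; cases o <;> simp
    intro o o' hoo hz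
    cases o with
    | none => cases o' with
      | none => exact hoo rfl
      | some j => exact hone j hz
    | some i => cases o' with
      | none => rw [Set.pair_comm] at hz; exact hone i hz
      | some j =>
        have := zeroOn_diff_of_notMem_span (a := none) ?_ hz
        · exact hone i (zeroOn_mono (by intro o; simp; tauto) this)
        · have h3 := hy s hs i j (by simpa using hoo)
          intro h4
          apply h3
          change y ∈ _ at h4
          convert h4 using 3
          ext w
          symm
          constructor
          · rintro ⟨o, ho, rfl⟩
            cases o with
            | none => simp at ho
            | some k => exact ⟨k, by simpa using ho, rfl⟩
          · rintro ⟨k, hk, rfl⟩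
            exact ⟨some k, by simpa using hk, rfl⟩
  have h0 : ∀ s ∈ C, ∑ o, (if ZeroOn (u s) ({o}ᶜ : Set _) then (1 : ZMod 2) else 0) = 0 := by
    intro s hs
    exact sum_zeroOn_compl (u s) (by simp [hd]) (hnd s hs)
  have hsum : ∑ s ∈ C.filter (fun s => s r = t),
      ∑ o, (if ZeroOn (u s) ({o}ᶜ : Set _) then (1 : ZMod 2) else 0) = 0 :=
    Finset.sum_eq_zero fun s hs => h0 s (Finset.mem_filter.1 hs).1
  simp only [Fintype.sum_option] at hsum
  rw [Finset.sum_add_distrib, Finset.sum_comm] at hsum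
  rw [← Finset.add_sum_erase _ _ (Finset.mem_univ r)] at hsum
  have hE : ∀ j ∈ Finset.univ.erase r, ∑ s ∈ C.filter (fun s => s r = t),
      (if ZeroOn (u s) ({some j}ᶜ : Set _) then (1 : ZMod 2) else 0) = 0 := by
    intro j hj
    have hjr : r ≠ j := by simpa [eq_comm] using hj
    refine Finset.sum_involution (fun s _ => flip j s) ?_ ?_ ?_ ?_
    · intro s hs
      have hs' := (Finset.mem_filter.1 hs).1
      have : ZeroOn (u (flip j s)) {some j}ᶜ ↔ ZeroOn (u s) {some j}ᶜ := by
        apply zeroOn_congr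
        intro o ho
        cases o with
        | none => rfl
        | some i =>
          simp only [hu, Option.elim]
          rw [heq j s hs' i (by simpa using ho)]
      rw [if_congr this rfl rfl]
      split_ifs <;> decide
    · intro s hs _
      exact hne j s (Finset.mem_filter.1 hs).1
    · intro s hs
      rw [Finset.mem_filter] at hs ⊢
      exact ⟨hmem j s hs.1, by rw [heq j s hs.1 r hjr, hs.2]⟩
    · intro s hs
      exact hff j s (Finset.mem_filter.1 hs).1
  rw [Finset.sum_eq_zero hE, add_zero] at hsum
  simp only [h1, h2, Finset.sum_boole, Finset.filter_filter] at hsum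
  have h2' : ∀ a b : ZMod 2, a + b = 0 → a = b := by decide
  exact h2' _ _ hsum

end parity

theorem exists_mem_open_notMem_submodule {W I : Type*} [NormedAddCommGroup W] [NormedSpace ℝ W]
    [FiniteDimensional ℝ W] [Finite I] (p : I → Submodule ℝ W) (hp : ∀ i, p i ≠ ⊤)
    {U : Set W} (hU : IsOpen U) (hne : U.Nonempty) : ∃ y ∈ U, ∀ i, y ∉ p i := by
  have : CompleteSpace W := FiniteDimensional.complete ℝ W
  have h : Dense (⋂ i, ((p i : Set W)ᶜ)) := by
    apply dense_iInter_of_isOpen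
    · intro i
      exact (Submodule.closed_of_finiteDimensional (p i)).isOpen_compl
    · intro i
      rw [← interior_eq_empty_iff_dense_compl]
      by_contra h
      exact hp i ((p i).eq_top_of_nonempty_interior' (Set.nonempty_iff_ne_empty.2 h))
  obtain ⟨y, hy, hy'⟩ := h.inter_open_nonempty U hU hne
  exact ⟨y, hy, by simpa using hy'⟩

/-- Combinatorial model of a free action on a closed pseudomanifold of dimension `d` with graded
vertices: its top simplices are the members of `C`. -/
structure ChainSystem (G T : Type*) [Group G] [MulAction G T] (d : ℕ) where
  C : Finset (Fin (d + 1) → T)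
  rk : T → ℕ
  flip : Fin (d + 1) → (Fin (d + 1) → T) → (Fin (d + 1) → T)
  free : ∀ (g : G) (t : T), g • t = t → g = 1
  rk_smul : ∀ (g : G) (t : T), rk (g • t) = rk t
  rk_apply : ∀ s ∈ C, ∀ i, rk (s i) = i
  smul_mem : ∀ (g : G), ∀ s ∈ C, (fun i => g • s i) ∈ C
  flip_mem : ∀ j, ∀ s ∈ C, flip j s ∈ C
  flip_flip : ∀ j, ∀ s ∈ C, flip j (flip j s) = s
  flip_ne : ∀ j, ∀ s ∈ C, flip j s ≠ s
  flip_apply : ∀ j, ∀ s ∈ C, ∀ i, i ≠ j → flip j s i = s i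

namespace ChainSystem

variable {G T W : Type*} [Group G] [Fintype G] [MulAction G T] {d : ℕ} (S : ChainSystem G T d)
  [NormedAddCommGroup W] [NormedSpace ℝ W] [FiniteDimensional ℝ W] (ρ : Representation ℝ G W)

open Classical in
/-- The number of top simplices whose label simplex contains the origin. -/
noncomputable def zeros (F : T → W) : ℕ :=
  (S.C.filter fun s => ZeroOn (fun i => F (s i)) Set.univ).card

/-- No proper face of a label simplex contains the origin. -/
def Nondeg (F : T → W) : Prop :=
  ∀ s ∈ S.C, ∀ j, ¬ ZeroOn (fun i => F (s i)) ({j}ᶜ : Set (Fin (d + 1)))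

open Classical in
theorem card_orbit (P : (Fin (d + 1) → T) → Prop)
    (hP : ∀ g : G, ∀ s ∈ S.C, P s → P (fun i => g • s i)) (r : Fin (d + 1)) (v : T) :
    (S.C.filter fun s => (∃ g : G, s r = g • v) ∧ P s).card =
      Fintype.card G * (S.C.filter fun s => s r = v ∧ P s).card := by
  rw [← Finset.card_univ, ← Finset.card_product]
  symm
  refine Finset.card_bij (fun x _ => fun i => x.1 • x.2 i) ?_ ?_ ?_
  · rintro ⟨g, s⟩ h
    simp only [Finset.mem_product, Finset.mem_univ, true_and, Finset.mem_filter] at h ⊢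
    exact ⟨S.smul_mem g s h.1, ⟨g, by rw [h.2.1]⟩, hP g s h.1 h.2.2⟩
  · rintro ⟨g, s⟩ h ⟨g', s'⟩ h' he
    simp only [Finset.mem_product, Finset.mem_univ, true_and, Finset.mem_filter] at h h' he
    have h1 := congrFun he r
    simp only [h.2.1, h'.2.1] at h1
    have hg : g = g' := by
      have : (g'⁻¹ * g) • v = v := by rw [mul_smul, h1, inv_smul_smul]
      have := S.free _ _ this
      rw [inv_mul_eq_one] at this
      exact this.symm
    subst hg
    have : s = s' := by
      ext i
      exact MulAction.injective g (congrFun he i)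
    rw [this]
  · intro s h
    simp only [Finset.mem_filter] at h
    obtain ⟨hs, ⟨g, hg⟩, hp⟩ := h
    refine ⟨(g, fun i => g⁻¹ • s i), ?_, ?_⟩
    · simp only [Finset.mem_product, Finset.mem_univ, true_and, Finset.mem_filter]
      exact ⟨S.smul_mem _ s hs, by rw [hg, inv_smul_smul], hP _ s hs hp⟩
    · simp

/-- Equivariance of a labelling. -/
def Equivariant (ρ : Representation ℝ G W) (F : T → W) : Prop := ∀ g t, F (g • t) = ρ g (F t)

theorem Equivariant.zeroOn_smul {ρ : Representation ℝ G W} {F : T → W} (hF : Equivariant ρ F) (g : G)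
    {s : Fin (d + 1) → T} {J : Set (Fin (d + 1))} (h : ZeroOn (fun i => F (s i)) J) :
    ZeroOn (fun i => F (g • s i)) J := by
  simp only [hF g]
  exact zeroOn_map (ρ g) _ h

theorem exists_step (hd : Module.finrank ℝ W = d) {F F₁ : T → W} (hF : Equivariant ρ F)
    (hF₁ : Equivariant ρ F₁) (hnd : S.Nondeg F) {ε : ℝ} (hε : 0 < ε) (v : T) :
    ∃ F' : T → W, Equivariant ρ F' ∧ S.Nondeg F' ∧
      S.zeros F' ≡ S.zeros F [MOD 2 * Fintype.card G] ∧
      ∀ t, ((∃ g : G, t = g • v) → ‖F' t - F₁ t‖ < ε) ∧ ((¬ ∃ g : G, t = g • v) → F' t = F t) := by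
  classical
  set U : Set W := {y | ∀ g : G, ‖ρ g y - F₁ (g • v)‖ < ε} with hU
  have hUo : IsOpen U := by
    have : U = ⋂ g : G, {y | ‖ρ g y - F₁ (g • v)‖ < ε} := by ext; simp [hU]
    rw [this]
    refine isOpen_iInter_of_finite fun g => isOpen_lt ?_ continuous_const
    have := (ρ g).continuous_of_finiteDimensional
    fun_prop
  have hUn : U.Nonempty := ⟨F₁ v, fun g => by rw [hF₁ g]; simpa using hε⟩
  obtain ⟨y, hyU, hy⟩ := exists_mem_open_notMem_submodule
    (I := {x : S.C × Fin (d + 1) × Fin (d + 1) // x.2.1 ≠ x.2.2})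
    (fun x => Submodule.span ℝ ((fun i => F (x.1.1.1 i)) '' {x.1.2.1, x.1.2.2}ᶜ)) (by
      rintro ⟨⟨s, j, j'⟩, hj⟩ htop
      have h1 : Module.finrank ℝ (⊤ : Submodule ℝ W) ≤ _ := htop ▸ finrank_span_le_card (R := ℝ) _
      rw [finrank_top, hd, Set.toFinset_image] at h1
      have h2 := h1.trans Finset.card_image_le
      rw [Set.toFinset_card, Fintype.card_compl_set] at h2
      simp only at hj
      rw [Set.card_insert _ (by simpa using hj)] at h2
      simp at h2
      have : d ≠ 0 := by
        rintro rfl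
        exact hj (Fin.ext (by omega))
      omega) hUo hUn
  have hspan : ∀ s ∈ S.C, ∀ j j', j ≠ j' →
      y ∉ Submodule.span ℝ ((fun i => F (s i)) '' {j, j'}ᶜ) :=
    fun s hs j j' hj => hy ⟨⟨⟨s, hs⟩, j, j'⟩, hj⟩
  set F' : T → W := fun t => if h : ∃ g : G, t = g • v then ρ h.choose y else F t with hF'def
  have hF'v : ∀ g : G, F' (g • v) = ρ g y := by
    intro g
    have h : ∃ g' : G, g • v = g' • v := ⟨g, rfl⟩
    have h1 : F' (g • v) = ρ h.choose y := by simp only [hF'def]; rw [dif_pos h]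
    rw [h1]
    have h2 := h.choose_spec
    have h3 : h.choose = g := by
      have : (g⁻¹ * h.choose) • v = v := by rw [mul_smul, ← h2, inv_smul_smul]
      have := S.free _ _ this
      rw [inv_mul_eq_one] at this
      exact this.symm
    rw [h3]
  have hF'n : ∀ t, (¬ ∃ g : G, t = g • v) → F' t = F t := by
    intro t ht
    simp only [hF'def]; rw [dif_neg ht]
  have hF'1 : F' v = y := by simpa using hF'v 1
  have hF'e : Equivariant ρ F' := by
    intro g t
    by_cases ht : ∃ g' : G, t = g' • v
    · obtain ⟨g', rfl⟩ := ht
      rw [← mul_smul, hF'v, hF'v, map_mul]; rfl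
    · rw [hF'n t ht, hF'n, hF g]
      rintro ⟨g', hg'⟩
      exact ht ⟨g⁻¹ * g', by rw [mul_smul, ← hg', inv_smul_smul]⟩
  have hidx : ∀ s ∈ S.C, ∀ i r : Fin (d + 1), ∀ g : G, ∀ g' : G, s i = g • v → s r = g' • v →
      i = r := by
    intro s hs i r g g' h1 h2
    have h3 := S.rk_apply s hs i
    have h4 := S.rk_apply s hs r
    rw [h1, S.rk_smul] at h3
    rw [h2, S.rk_smul] at h4
    exact Fin.ext (h3.symm.trans h4)
  have hupd : ∀ s ∈ S.C, ∀ r, s r = v →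
      (fun i => F' (s i)) = Function.update (fun i => F (s i)) r y := by
    intro s hs r hr
    ext i
    by_cases hi : i = r
    · subst hi; simp [hr, hF'1]
    · simp only [Function.update_of_ne hi]
      apply hF'n
      rintro ⟨g, hg⟩
      exact hi (hidx s hs i r g 1 hg (by simp [hr]))
  have hsame : ∀ s ∈ S.C, (¬ ∃ i, ∃ g : G, s i = g • v) → (fun i => F' (s i)) = fun i => F (s i) := by
    intro s hs h
    ext i
    exact hF'n _ (fun ⟨g, hg⟩ => h ⟨i, g, hg⟩)
  have hnd1 : ∀ s ∈ S.C, ∀ r, s r = v → ∀ j, ¬ ZeroOn (fun i => F' (s i)) {j}ᶜ := by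
    intro s hs r hr j hz
    rw [hupd s hs r hr] at hz
    by_cases hj : j = r
    · subst hj
      apply hnd s hs j
      rwa [zeroOn_congr (v' := fun i => F (s i))] at hz
      intro i hi
      rw [Function.update_of_ne (by simpa using hi)]
    · have h1 : ∀ i ∈ ({j}ᶜ \ {r} : Set (Fin (d + 1))),
          Function.update (fun i => F (s i)) r y i = F (s i) := by
        intro i hi
        rw [Function.update_of_ne (by simpa using hi.2)]
      have h2 := zeroOn_diff_of_notMem_span (a := r) (by
        rw [Set.image_congr h1]
        simp only [Function.update_self]
        convert hspan s hs j r hj using 4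
        ext; simp) hz
      rw [zeroOn_congr h1] at h2
      exact hnd s hs j (zeroOn_mono Set.sdiff_subset h2)
  have hF'nd : S.Nondeg F' := by
    intro s hs j hz
    by_cases h : ∃ i, ∃ g : G, s i = g • v
    · obtain ⟨r, g, hg⟩ := h
      exact hnd1 _ (S.smul_mem g⁻¹ s hs) r (by rw [hg, inv_smul_smul]) j
        (hF'e.zeroOn_smul g⁻¹ hz)
    · rw [hsame s hs h] at hz
      exact hnd s hs j hz
  refine ⟨F', hF'e, hF'nd, ?_, ?_⟩
  · by_cases hrk : S.rk v < d + 1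
    swap
    · have : S.zeros F' = S.zeros F := by
        unfold zeros
        congr 1
        apply Finset.filter_congr
        intro s hs
        rw [hsame s hs]
        rintro ⟨i, g, hg⟩
        have h3 := S.rk_apply s hs i
        rw [hg, S.rk_smul] at h3
        have := i.2
        omega
      rw [this]
    · set r : Fin (d + 1) := ⟨S.rk v, hrk⟩ with hr
      have hri : ∀ s ∈ S.C, ∀ i, ∀ g : G, s i = g • v → i = r := by
        intro s hs i g hg
        have h3 := S.rk_apply s hs i
        rw [hg, S.rk_smul] at h3
        exact Fin.ext h3.symm
      have hsplit : ∀ F₂ : T → W, Equivariant ρ F₂ → S.zeros F₂ =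
          Fintype.card G * (S.C.filter fun s => s r = v ∧
            ZeroOn (fun i => F₂ (s i)) Set.univ).card +
          (S.C.filter fun s => (¬ ∃ g : G, s r = g • v) ∧
            ZeroOn (fun i => F₂ (s i)) Set.univ).card := by
        intro F₂ hF₂
        rw [← S.card_orbit (fun s => ZeroOn (fun i => F₂ (s i)) Set.univ)
          (fun g s _ h => hF₂.zeroOn_smul g h) r v]
        unfold zeros
        rw [← Finset.card_filter_add_card_filter_not (fun s => ∃ g : G, s r = g • v)]
        simp only [Finset.filter_filter, and_comm]
      rw [hsplit F hF, hsplit F' hF'e]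
      have e1 : (S.C.filter fun s => (¬ ∃ g : G, s r = g • v) ∧
            ZeroOn (fun i => F' (s i)) Set.univ) = (S.C.filter fun s => (¬ ∃ g : G, s r = g • v) ∧
            ZeroOn (fun i => F (s i)) Set.univ) := by
        apply Finset.filter_congr
        intro s hs
        apply and_congr_right
        intro h
        rw [hsame s hs]
        rintro ⟨i, g, hg⟩
        have := hri s hs i g hg
        subst this
        exact h ⟨g, hg⟩
      rw [e1]
      apply Nat.ModEq.add_right
      have hpar := parity_fiber hd S.C r v S.flip S.flip_mem S.flip_flip S.flip_ne S.flip_apply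
        F y hnd hspan
      have e2 : (S.C.filter fun s => s r = v ∧ ZeroOn (fun i => F' (s i)) Set.univ) =
          (S.C.filter fun s => s r = v ∧
            ZeroOn (Function.update (fun i => F (s i)) r y) Set.univ) := by
        apply Finset.filter_congr
        intro s hs
        apply and_congr_right
        intro h
        rw [hupd s hs r h]
      rw [← e2, ZMod.natCast_eq_natCast_iff] at hpar
      rw [mul_comm 2]
      exact (hpar.symm).mul_left' _
  · intro t
    refine ⟨?_, hF'n t⟩
    rintro ⟨g, rfl⟩
    rw [hF'v]
    exact hyU g

/-- If some nondegenerate equivariant labelling has exactly `|G|` zeros, then every equivariant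
labelling has an approximate zero on a top simplex. -/
theorem exists_approx_zero [Finite T] (hd : Module.finrank ℝ W = d) {F F₁ : T → W}
    (hF : Equivariant ρ F) (hF₁ : Equivariant ρ F₁) (hnd : S.Nondeg F)
    (hz : S.zeros F = Fintype.card G) {ε : ℝ} (hε : 0 < ε) :
    ∃ s ∈ S.C, ∃ c : Fin (d + 1) → ℝ, (∀ i, 0 ≤ c i) ∧ ∑ i, c i = 1 ∧
      ‖∑ i, c i • F₁ (s i)‖ ≤ ε := by
  classical
  have := Fintype.ofFinite T
  have key : ∀ A : Finset T, ∃ F' : T → W, Equivariant ρ F' ∧ S.Nondeg F' ∧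
      S.zeros F' ≡ S.zeros F [MOD 2 * Fintype.card G] ∧ ∀ t ∈ A, ‖F' t - F₁ t‖ < ε := by
    intro A
    induction A using Finset.induction_on with
    | empty => exact ⟨F, hF, hnd, rfl, by simp⟩
    | insert v A _ ih =>
      obtain ⟨F', h1, h2, h3, h4⟩ := ih
      obtain ⟨F'', k1, k2, k3, k4⟩ := S.exists_step ρ hd h1 hF₁ h2 hε v
      refine ⟨F'', k1, k2, k3.trans h3, ?_⟩
      intro t ht
      by_cases h : ∃ g : G, t = g • v
      · exact (k4 t).1 h
      · rw [(k4 t).2 h]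
        rcases Finset.mem_insert.1 ht with rfl | ht
        · exact absurd ⟨1, by simp⟩ h
        · exact h4 t ht
  obtain ⟨F', h1, h2, h3, h4⟩ := key Finset.univ
  rw [hz] at h3
  have hne : S.zeros F' ≠ 0 := by
    intro h0
    rw [h0] at h3
    have h5 := (Nat.modEq_zero_iff_dvd.1 h3.symm)
    have h6 := Nat.le_of_dvd Fintype.card_pos h5
    have : 0 < Fintype.card G := Fintype.card_pos
    omega
  obtain ⟨s, hs⟩ := Finset.card_ne_zero.1 hne
  rw [Finset.mem_filter] at hs
  obtain ⟨hs, c, c0, c1, -, c3⟩ := hs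
  have hpos : 0 < ∑ i, c i := by
    obtain ⟨i, hi⟩ := Function.ne_iff.1 c1
    exact Finset.sum_pos' (fun i _ => c0 i) ⟨i, Finset.mem_univ _, lt_of_le_of_ne (c0 i) (Ne.symm hi)⟩
  set Λ := ∑ i, c i with hΛ
  refine ⟨s, hs, fun i => Λ⁻¹ * c i, fun i => mul_nonneg (by positivity) (c0 i), ?_, ?_⟩
  · rw [← Finset.mul_sum, ← hΛ, inv_mul_cancel₀ hpos.ne']
  · have : ∑ i, (Λ⁻¹ * c i) • F₁ (s i) = ∑ i, (Λ⁻¹ * c i) • (F₁ (s i) - F' (s i)) := by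
      simp only [smul_sub, Finset.sum_sub_distrib, mul_smul, ← Finset.smul_sum, c3]
      simp
    rw [this]
    calc _ ≤ ∑ i, ‖(Λ⁻¹ * c i) • (F₁ (s i) - F' (s i))‖ := norm_sum_le _ _
      _ ≤ ∑ i, (Λ⁻¹ * c i) * ε := by
        refine Finset.sum_le_sum fun i _ => ?_
        have hc : 0 ≤ Λ⁻¹ * c i := mul_nonneg (by positivity) (c0 i)
        rw [norm_smul, Real.norm_of_nonneg hc, norm_sub_rev]
        exact mul_le_mul_of_nonneg_left (h4 _ (Finset.mem_univ _)).le hc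
      _ = ε := by
        rw [← Finset.sum_mul, ← Finset.mul_sum, ← hΛ, inv_mul_cancel₀ hpos.ne', one_mul]

end ChainSystem

section Blocks

/-- `a` is a face of `b` in the cell poset of the integer line (even integers are vertices, odd
integers are edges). -/
def IntFace (a b : ℤ) : Prop := a = b ∨ (Odd b ∧ |b - a| = 1)

theorem IntFace.trans {a b c : ℤ} (h : IntFace a b) (h' : IntFace b c) : IntFace a c := by
  rcases h with rfl | ⟨h1, h2⟩
  · exact h'
  · rcases h' with rfl | ⟨h3, h4⟩
    · exact Or.inr ⟨h1, h2⟩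
    · exfalso
      rcases h1 with ⟨p, rfl⟩
      rcases h3 with ⟨q, rfl⟩
      rcases abs_eq (zero_le_one' ℤ) |>.1 h4 with h | h <;> omega

theorem IntFace.eq_of_even {a b : ℤ} (h : IntFace a b) (hb : Even b) : a = b := by
  rcases h with h | ⟨h, -⟩
  · exact h
  · exact absurd hb (Int.not_even_iff_odd.2 h)

theorem IntFace.neg {a b : ℤ} (h : IntFace a b) : IntFace (-a) (-b) := by
  rcases h with rfl | ⟨h1, h2⟩
  · exact Or.inl rfl
  · refine Or.inr ⟨h1.neg, ?_⟩
    rw [← h2, ← abs_neg]; congr 1; ring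

theorem IntFace.even_left {a b : ℤ} (h : IntFace a b) (hab : a ≠ b) : Even a ∧ Odd b := by
  rcases h with h | ⟨h1, h2⟩
  · exact absurd h hab
  · refine ⟨?_, h1⟩
    rcases h1 with ⟨p, rfl⟩
    rcases abs_eq (zero_le_one' ℤ) |>.1 h2 with h | h
    · exact ⟨p, by omega⟩
    · exact ⟨p + 1, by omega⟩

theorem IntFace.mid {a x b : ℤ} (h : IntFace a x) (h' : IntFace x b) :
    (a + b - x = a ∧ x = b) ∨ (a + b - x = b ∧ x = a) := by
  by_cases hb : x = b
  · left; omega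
  · have h1 := (h'.even_left hb).1
    have := h.eq_of_even h1
    right; omega

theorem IntFace.reflect {x b : ℤ} (hx : Even x) (h : IntFace x b) :
    IntFace (2 * b - x) b ∧ Even (2 * b - x) := by
  refine ⟨?_, ?_⟩
  · rcases h with rfl | ⟨h1, h2⟩
    · left; ring
    · right
      refine ⟨h1, ?_⟩
      rw [← h2, ← abs_neg]; congr 1; ring
  · exact (even_two_mul b).sub hx

variable {m : ℕ}

/-- A cell of the boundary of the cube `[-M, M]^(m+1)`. -/
def IsCell (M : ℤ) (b : Fin (m + 1) → ℤ) : Prop := (∀ c, |b c| ≤ M) ∧ ∃ c, |b c| = M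

theorem IsCell.neg {M : ℤ} {b : Fin (m + 1) → ℤ} (h : IsCell M b) : IsCell M (-b) := by
  simpa [IsCell] using h

/-- The face relation of cells. -/
def Face (a b : Fin (m + 1) → ℤ) : Prop := ∀ c, IntFace (a c) (b c)

/-- The dimension of a cell. -/
def oddCount (b : Fin (m + 1) → ℤ) : ℕ := (Finset.univ.filter fun c => Odd (b c)).card

theorem oddCount_neg (b : Fin (m + 1) → ℤ) : oddCount (-b) = oddCount b := by
  simp [oddCount]

theorem oddCount_eq_of {b : Fin (m + 1) → ℤ} {c₁ : Fin (m + 1)} (h1 : Even (b c₁))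
    (h2 : ∀ c, c ≠ c₁ → Odd (b c)) : oddCount b = m := by
  unfold oddCount
  have : (Finset.univ.filter fun c => Odd (b c)) = Finset.univ.erase c₁ := by
    ext c
    simp only [Finset.mem_filter, Finset.mem_univ, true_and, Finset.mem_erase, and_true]
    constructor
    · rintro h rfl
      exact Int.not_even_iff_odd.2 h h1
    · exact h2 c
  rw [this, Finset.card_erase_of_mem (Finset.mem_univ _)]; simp

theorem oddCount_le {M : ℤ} (hM : Even M) {b : Fin (m + 1) → ℤ} (h : IsCell M b) :
    oddCount b ≤ m := by
  obtain ⟨c, hc⟩ := h.2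
  have h1 : Even (b c) := by
    rw [← even_abs, hc]; exact hM
  unfold oddCount
  have : (Finset.univ.filter fun c => Odd (b c)) ⊆ Finset.univ.erase c := by
    intro c'
    simp only [Finset.mem_filter, Finset.mem_univ, true_and, Finset.mem_erase, and_true]
    rintro h rfl
    exact Int.not_even_iff_odd.2 h h1
  have := Finset.card_le_card this
  rwa [Finset.card_erase_of_mem (Finset.mem_univ _), Finset.card_univ, Fintype.card_fin] at this

/-- The other top cell containing the cell `a` of codimension one. -/
noncomputable def topFlip (M : ℤ) (a x : Fin (m + 1) → ℤ) : Fin (m + 1) → ℤ :=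
  open Classical in
  if ∃ c, x c ≠ a c ∧ |a c| = M then
    fun c => if x c ≠ a c then a c else if Even (a c) then a c - (a c).sign else a c
  else fun c => 2 * a c - x c

theorem topFlip_neg (M : ℤ) (a x : Fin (m + 1) → ℤ) :
    topFlip M (-a) (-x) = -topFlip M a x := by
  classical
  unfold topFlip
  simp only [Pi.neg_apply, ne_eq, neg_inj, abs_neg, even_neg, Int.sign_neg]
  split_ifs
  · ext c
    simp only [Pi.neg_apply]
    split_ifs <;> ring
  · ext c
    simp only [Pi.neg_apply]; ring

theorem topFlip_self (M : ℤ) (a : Fin (m + 1) → ℤ) : topFlip M a a = a := by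
  classical
  unfold topFlip
  rw [if_neg (by simp)]
  ext c; ring

theorem exists_top_structure {M : ℤ} (hM : Even M) {a x : Fin (m + 1) → ℤ}
    (hx : IsCell M x) (hax : Face a x)
    (hoa : m ≤ oddCount a + 1) (hne : a ≠ x) :
    ∃ c₀ c₁, c₀ ≠ c₁ ∧ Even (a c₀) ∧ |x c₀ - a c₀| = 1 ∧ |a c₁| = M ∧
      (∀ c, c ≠ c₀ → x c = a c) ∧ ∀ c, c ≠ c₀ → c ≠ c₁ → Odd (a c) := by
  obtain ⟨c₀, h0⟩ := Function.ne_iff.1 hne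
  obtain ⟨c₁, h1⟩ := hx.2
  have he0 := (hax c₀).even_left h0
  have hx1 : Even (x c₁) := by rw [← even_abs, h1]; exact hM
  have h01 : c₀ ≠ c₁ := by
    rintro rfl
    exact Int.not_even_iff_odd.2 he0.2 hx1
  have ha1 : a c₁ = x c₁ := (hax c₁).eq_of_even hx1
  have hodd : ∀ c, c ≠ c₀ → c ≠ c₁ → Odd (a c) := by
    intro c hc0 hc1
    by_contra hc
    rw [Int.not_odd_iff_even] at hc
    have hsub : (Finset.univ.filter fun c => Odd (a c)) ⊆
        ((Finset.univ.erase c₀).erase c₁).erase c := by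
      intro c'
      simp only [Finset.mem_filter, Finset.mem_univ, true_and, Finset.mem_erase, and_true]
      intro h
      refine ⟨?_, ?_, ?_⟩
      · rintro rfl; exact Int.not_even_iff_odd.2 h hc
      · rintro rfl; rw [ha1] at h; exact Int.not_even_iff_odd.2 h hx1
      · rintro rfl; exact Int.not_even_iff_odd.2 h he0.1
    have h2 := Finset.card_le_card hsub
    rw [Finset.card_erase_of_mem (by simp [hc0, hc1]), Finset.card_erase_of_mem (by simp [h01.symm]),
      Finset.card_erase_of_mem (by simp)] at h2
    simp at h2
    have h3 : 2 < (Finset.univ : Finset (Fin (m + 1))).card :=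
      Finset.two_lt_card.2 ⟨c, by simp, c₀, by simp, c₁, by simp, hc0, hc1, h01⟩
    simp at h3
    unfold oddCount at hoa
    omega
  refine ⟨c₀, c₁, h01, he0.1, ?_, by rw [ha1, h1], ?_, hodd⟩
  · rcases hax c₀ with h | h
    · exact absurd h h0
    · exact h.2
  · intro c hc
    by_cases hc1 : c = c₁
    · rw [hc1, ha1]
    · by_contra hcc
      exact Int.not_even_iff_odd.2 (hodd c hc hc1) ((hax c).even_left (Ne.symm hcc)).1

theorem topFlip_spec {M : ℤ} (hM : Even M) (hM0 : 0 < M) {a x : Fin (m + 1) → ℤ}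
    (ha : IsCell M a)
    (hx : IsCell M x) (hax : Face a x) (hox : oddCount x = m) (hoa : m ≤ oddCount a + 1) :
    Face a (topFlip M a x) ∧ IsCell M (topFlip M a x) ∧ oddCount (topFlip M a x) = m ∧
      topFlip M a (topFlip M a x) = x ∧ (a ≠ x → topFlip M a x ≠ x) := by
  classical
  by_cases hne : a = x
  · subst hne
    simp only [topFlip_self]
    exact ⟨hax, hx, hox, trivial, fun h => absurd rfl h⟩
  obtain ⟨c₀, c₁, h01, he0, hx0, ha1, hxa, hodd⟩ := exists_top_structure hM hx hax hoa hne
  have hx0' : x c₀ ≠ a c₀ := by intro h; rw [h] at hx0; simp at hx0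
  have hiff : (∃ c, x c ≠ a c ∧ |a c| = M) ↔ |a c₀| = M := by
    constructor
    · rintro ⟨c, h1, h2⟩
      by_cases hc : c = c₀
      · rwa [hc] at h2
      · exact absurd (hxa c hc) h1
    · exact fun h => ⟨c₀, hx0', h⟩
  have he1 : Even (a c₁) := by rw [← even_abs, ha1]; exact hM
  have hxo : Odd (x c₀) := ((hax c₀).even_left hx0'.symm).2
  by_cases hcase : |a c₀| = M
  · have hz : ∀ c, topFlip M a x c = if c = c₁ then a c₁ - (a c₁).sign else a c := by
      intro c
      unfold topFlip
      rw [if_pos (hiff.2 hcase)]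
      by_cases hc0 : c = c₀
      · subst hc0; simp [hx0', h01]
      · by_cases hc1 : c = c₁
        · subst hc1; simp [hxa c hc0, he1]
        · simp [hxa c hc0, hc1, hodd c hc0 hc1]
    have hs : (a c₁).sign = 1 ∧ a c₁ = M ∨ (a c₁).sign = -1 ∧ a c₁ = -M := by
      rcases abs_eq hM0.le |>.1 ha1 with h | h
      · left; exact ⟨by rw [h]; exact Int.sign_eq_one_of_pos hM0, h⟩
      · right; exact ⟨by rw [h]; exact Int.sign_eq_neg_one_of_neg (by omega), h⟩
    have hod1 : Odd (a c₁ - (a c₁).sign) := by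
      rcases hs with ⟨h, -⟩ | ⟨h, -⟩ <;> rw [h]
      · exact he1.sub_odd odd_one
      · exact he1.sub_odd (by decide)
    refine ⟨?_, ⟨?_, ⟨c₀, ?_⟩⟩, ?_, ?_, ?_⟩
    · intro c
      rw [hz]
      split_ifs with hc
      · subst hc
        refine Or.inr ⟨hod1, ?_⟩
        rcases hs with ⟨h, -⟩ | ⟨h, -⟩ <;> rw [h] <;> simp
      · exact Or.inl rfl
    · intro c
      rw [hz]
      split_ifs with hc
      · rw [abs_le]
        rcases hs with ⟨h, h'⟩ | ⟨h, h'⟩ <;> rw [h, h'] <;> constructor <;> linarith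
      · exact ha.1 c
    · rw [hz, if_neg h01]; exact hcase
    · apply oddCount_eq_of (c₁ := c₀)
      · rw [hz, if_neg h01]; exact he0
      · intro c hc
        rw [hz]
        split_ifs with hc1
        · exact hod1
        · exact hodd c hc hc1
    · have hz1 : topFlip M a x c₁ ≠ a c₁ := by
        rw [hz, if_pos rfl]
        rcases hs with ⟨h, -⟩ | ⟨h, -⟩ <;> rw [h] <;> omega
      ext c
      rw [topFlip, if_pos ⟨c₁, hz1, ha1⟩]
      by_cases hc1 : c = c₁
      · subst hc1; simp [hz1, hxa c (Ne.symm h01)]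
      · have : topFlip M a x c = a c := by rw [hz, if_neg hc1]
        simp only [this, ne_eq, not_true_eq_false, if_false]
        by_cases hc0 : c = c₀
        · subst hc0
          rw [if_pos he0]
          have h5 := hx.1 c
          rw [abs_le] at h5
          rcases abs_eq hM0.le |>.1 hcase with h | h
          · rw [Int.sign_eq_one_of_pos (by omega)]
            rcases abs_eq (zero_le_one' ℤ) |>.1 hx0 with h' | h' <;> omega
          · rw [Int.sign_eq_neg_one_of_neg (by omega)]
            rcases abs_eq (zero_le_one' ℤ) |>.1 hx0 with h' | h' <;> omega
        · rw [if_neg (Int.not_even_iff_odd.2 (hodd c hc0 hc1)), hxa c hc0]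
    · intro _ h
      have := congrFun h c₀
      rw [hz, if_neg h01] at this
      exact hx0' this.symm
  · have hz : ∀ c, topFlip M a x c = 2 * a c - x c := by
      intro c
      unfold topFlip
      rw [if_neg (by rw [hiff]; exact hcase)]
    have hlt : |a c₀| < M := lt_of_le_of_ne (ha.1 c₀) hcase
    refine ⟨?_, ⟨?_, ⟨c₁, ?_⟩⟩, ?_, ?_, ?_⟩
    · intro c
      rw [hz]
      by_cases hc : c = c₀
      · subst hc
        refine Or.inr ⟨(even_two_mul _).sub_odd hxo, ?_⟩
        rw [← hx0, ← abs_neg]; congr 1; ring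
      · left; rw [hxa c hc]; ring
    · intro c
      rw [hz]
      by_cases hc : c = c₀
      · subst hc
        rw [abs_lt] at hlt
        rw [abs_le]
        rcases abs_eq (zero_le_one' ℤ) |>.1 hx0 with h' | h' <;> constructor <;> omega
      · rw [hxa c hc]; convert ha.1 c using 2; ring
    · rw [hz, hxa c₁ h01.symm, ← ha1]; congr 1; ring
    · apply oddCount_eq_of (c₁ := c₁)
      · rw [hz]; exact (even_two_mul _).sub (by rw [hxa c₁ h01.symm]; exact he1)
      · intro c hc
        rw [hz]
        refine (even_two_mul _).sub_odd ?_
        by_cases hc0 : c = c₀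
        · rwa [hc0]
        · rw [hxa c hc0]; exact hodd c hc0 hc
    · have : ¬ ∃ c, topFlip M a x c ≠ a c ∧ |a c| = M := by
        rintro ⟨c, h1, h2⟩
        rw [hz] at h1
        apply hcase
        rw [← hiff]
        exact ⟨c, fun h => h1 (by rw [h]; ring), h2⟩
      ext c
      rw [topFlip, if_neg this, hz]; ring
    · intro _ h
      have := congrFun h c₀
      rw [hz] at this
      apply hx0'
      omega

end Blocks

section Tree

variable {k : ℕ}

/-- Two branches of the binary tree of depth `k` agree before level `j`. -/
def Agree (j : ℕ) (w w' : Fin k → Bool) : Prop := ∀ i : Fin k, i.1 < j → w i = w' i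

theorem Agree.symm {j : ℕ} {w w' : Fin k → Bool} (h : Agree j w w') : Agree j w' w :=
  fun i hi => (h i hi).symm

theorem Agree.trans {j : ℕ} {w w' w'' : Fin k → Bool} (h : Agree j w w') (h' : Agree j w' w'') :
    Agree j w w'' := fun i hi => (h i hi).trans (h' i hi)

theorem Agree.mono {i j : ℕ} (hij : i ≤ j) {w w' : Fin k → Bool} (h : Agree j w w') :
    Agree i w w' := fun l hl => h l (hl.trans_le hij)

theorem agree_succ_iff {j : Fin k} {w w' : Fin k → Bool} :
    Agree (j.1 + 1) w w' ↔ Agree j w w' ∧ w j = w' j := by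
  constructor
  · exact fun h => ⟨h.mono (Nat.le_succ _), h j (Nat.lt_succ_self _)⟩
  · rintro ⟨h1, h2⟩ i hi
    rcases Nat.lt_succ_iff_lt_or_eq.1 hi with h | h
    · exact h1 i h
    · rw [Fin.ext h]; exact h2

/-- A vector at every node of every branch, depending only on the node, up to the sign attached to
the side of the node on which the branch lies. -/
def Compat {M : Type*} [Neg M] (x : (Fin k → Bool) → Fin k → M) : Prop :=
  ∀ (j : Fin k) (w w' : Fin k → Bool), Agree j w w' →
    x w' j = if w j = w' j then x w j else -x w j

/-- Branches with a level, up to agreement before that level: the inner nodes of the tree. -/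
instance nodeSetoid (k : ℕ) : Setoid ((Fin k → Bool) × Fin k) where
  r p q := p.2 = q.2 ∧ Agree p.2 p.1 q.1
  iseqv := ⟨fun p => ⟨rfl, fun _ _ => rfl⟩, fun {p q} h => ⟨h.1.symm, h.1 ▸ h.2.symm⟩,
    fun {p q r} h h' => ⟨h.1.trans h'.1, h.2.trans (by rw [h.1]; exact h'.2)⟩⟩

/-- The inner nodes of the binary tree of depth `k`. -/
abbrev Node (k : ℕ) := Quotient (nodeSetoid k)

noncomputable instance (k : ℕ) : Fintype (Node k) := Fintype.ofFinite _

theorem node_out (w : Fin k → Bool) (j : Fin k) :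
    (⟦(w, j)⟧ : Node k).out.2 = j ∧ Agree j w (⟦(w, j)⟧ : Node k).out.1 := by
  have h : (⟦(w, j)⟧ : Node k).out ≈ (w, j) := Quotient.mk_out _
  exact ⟨h.1, by have := h.2; rw [h.1] at this; exact this.symm⟩

/-- The automorphism group of the tree. -/
def treeGroup (k : ℕ) : Subgroup (Equiv.Perm (Fin k → Bool)) where
  carrier := {φ | ∀ (j : ℕ) w w', Agree j (φ w) (φ w') ↔ Agree j w w'}
  mul_mem' := fun {a b} ha hb j w w' => (ha j (b w) (b w')).trans (hb j w w')
  one_mem' := fun _ _ _ => Iff.rfl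
  inv_mem' := fun {a} ha j w w' => by
    have := ha j (a⁻¹ w) (a⁻¹ w')
    simpa using this.symm

noncomputable instance (k : ℕ) : Fintype (treeGroup k) := Fintype.ofFinite _

theorem treeGroup_inv_agree (g : treeGroup k) (j : ℕ) (w w' : Fin k → Bool) :
    Agree j (g⁻¹.1 w) (g⁻¹.1 w') ↔ Agree j w w' := (g⁻¹).2 j w w'

theorem Compat.smul {M : Type*} [Neg M] {x : (Fin k → Bool) → Fin k → M} (hx : Compat x)
    (g : treeGroup k) : Compat (fun w => x (g⁻¹.1 w)) := by
  intro j w w' h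
  have h1 := (treeGroup_inv_agree g j w w').2 h
  beta_reduce
  rw [hx j _ _ h1]
  have h2 := treeGroup_inv_agree g (j.1 + 1) w w'
  rw [agree_succ_iff, agree_succ_iff] at h2
  have h3 : (g⁻¹.1 w) j = (g⁻¹.1 w') j ↔ w j = w' j := by
    constructor
    · exact fun h4 => (h2.1 ⟨h1, h4⟩).2
    · exact fun h4 => (h2.2 ⟨h, h4⟩).2
  simp only [h3]

/-- Unfolding of node data. -/
noncomputable def unfoldNode {M : Type*} [Neg M] (y : Node k → M) : (Fin k → Bool) → Fin k → M :=
  fun w j => if (⟦(w, j)⟧ : Node k).out.1 j = w j then y ⟦(w, j)⟧ else -y ⟦(w, j)⟧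

theorem unfoldNode_compat {M : Type*} [AddGroup M] (y : Node k → M) : Compat (unfoldNode y) := by
  intro j w w' h
  have h1 : (⟦(w, j)⟧ : Node k) = ⟦(w', j)⟧ := Quotient.sound ⟨rfl, h⟩
  unfold unfoldNode
  rw [← h1]
  cases (⟦(w, j)⟧ : Node k).out.1 j <;> cases w j <;> cases w' j <;> simp

theorem Compat.eq_unfoldNode {M : Type*} [Neg M] {x : (Fin k → Bool) → Fin k → M} (hx : Compat x) :
    x = unfoldNode (fun n => x n.out.1 n.out.2) := by
  ext w j
  have h := node_out w j
  unfold unfoldNode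
  beta_reduce
  rw [h.1, hx j _ w h.2.symm]

theorem unfoldNode_out {M : Type*} [Neg M] (y : Node k → M) (n : Node k) :
    unfoldNode y n.out.1 n.out.2 = y n := by
  unfold unfoldNode
  have : (⟦(n.out.1, n.out.2)⟧ : Node k) = n := Quotient.out_eq n
  rw [this]; simp

theorem sum_node_smul {N : Type*} [AddCommMonoid N] (h : (Fin k → Bool) → Fin k → N)
    (hh : ∀ j w w', Agree j.1 w w' → h w j = h w' j) (g : treeGroup k) :
    ∑ n : Node k, h (g⁻¹.1 n.out.1) n.out.2 = ∑ n : Node k, h n.out.1 n.out.2 := by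
  set P : Node k → Node k := fun n => ⟦(g⁻¹.1 n.out.1, n.out.2)⟧ with hP
  have hPi : Function.Injective P := by
    intro n n' hn
    have h1 : ((g⁻¹.1 n.out.1, n.out.2) : _ × _) ≈ (g⁻¹.1 n'.out.1, n'.out.2) := Quotient.exact hn
    have h2 : n.out ≈ n'.out := ⟨h1.1, (treeGroup_inv_agree g _ _ _).1 h1.2⟩
    have := Quotient.sound h2
    simpa using this
  rw [← (Function.Injective.bijective_of_finite hPi).sum_comp
    (fun n : Node k => h n.out.1 n.out.2)]
  refine Finset.sum_congr rfl fun n _ => ?_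
  have h1 := node_out (g⁻¹.1 n.out.1) n.out.2
  simp only [hP]
  rw [h1.1]
  exact hh _ _ _ h1.2

/-- The target of the labellings. -/
def labelSpace (k m : ℕ) : Submodule ℝ ((Fin k → Bool) → Fin k → Fin m → ℝ) where
  carrier := {x | Compat x}
  add_mem' := fun {a b} ha hb j w w' h => by
    simp only [Pi.add_apply, ha j w w' h, hb j w w' h]
    split_ifs
    · rfl
    · abel
  zero_mem' := fun j w w' h => by simp
  smul_mem' := fun c a ha j w w' h => by
    simp only [Pi.smul_apply, ha j w w' h]
    split_ifs
    · rfl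
    · simp

/-- Labels are determined by their values on the nodes. -/
noncomputable def labelEquiv (k m : ℕ) : labelSpace k m ≃ₗ[ℝ] (Node k → Fin m → ℝ) where
  toFun x := fun n => x.1 n.out.1 n.out.2
  invFun y := ⟨unfoldNode y, unfoldNode_compat y⟩
  left_inv x := Subtype.ext (Compat.eq_unfoldNode x.2).symm
  right_inv y := funext fun n => unfoldNode_out y n
  map_add' _ _ := rfl
  map_smul' _ _ := rfl

theorem finrank_labelSpace (k m : ℕ) :
    Module.finrank ℝ (labelSpace k m) = Fintype.card (Node k) * m := by
  rw [(labelEquiv k m).finrank_eq]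
  simp [Module.finrank_pi_fintype]

/-- The action on the labels. -/
noncomputable def labelRep (k m : ℕ) : Representation ℝ (treeGroup k) (labelSpace k m) where
  toFun g :=
    { toFun := fun x => ⟨fun w => x.1 (g⁻¹.1 w), x.2.smul g⟩
      map_add' := fun _ _ => rfl
      map_smul' := fun _ _ => rfl }
  map_one' := by ext; simp
  map_mul' g h := by ext; simp

/-- The cells of the product over the nodes of the spheres `∂[-M, M]^(m+1)`. -/
abbrev TreeCell (k m : ℕ) (M : ℤ) :=
  {x : (Fin k → Bool) → Fin k → Fin (m + 1) → ℤ // Compat x ∧ ∀ w j, IsCell M (x w j)}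

instance (k m : ℕ) (M : ℤ) : Finite (TreeCell k m M) := by
  have : Finite (Set.Icc (fun _ _ _ => -M : (Fin k → Bool) → Fin k → Fin (m + 1) → ℤ)
    (fun _ _ _ => M)) := Set.finite_Icc _ _
  refine Finite.of_injective (β := Set.Icc
    (fun _ _ _ => -M : (Fin k → Bool) → Fin k → Fin (m + 1) → ℤ) (fun _ _ _ => M))
    (fun x => ⟨x.1, ?_, ?_⟩) ?_
  · intro w j c
    exact (abs_le.1 ((x.2.2 w j).1 c)).1
  · intro w j c
    exact (abs_le.1 ((x.2.2 w j).1 c)).2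
  · intro x y h
    exact Subtype.ext (congrArg (fun z => z.1) h)

instance (k m : ℕ) (M : ℤ) : MulAction (treeGroup k) (TreeCell k m M) where
  smul g x := ⟨fun w => x.1 (g⁻¹.1 w), x.2.1.smul g, fun w j => x.2.2 _ j⟩
  one_smul x := Subtype.ext (by ext w; rfl)
  mul_smul g h x := Subtype.ext (by ext w; simp [HSMul.hSMul])

theorem treeCell_smul_val {m : ℕ} {M : ℤ} (g : treeGroup k) (x : TreeCell k m M)
    (w : Fin k → Bool) : (g • x).1 w = x.1 (g⁻¹.1 w) := rfl

theorem treeCell_free {m : ℕ} {M : ℤ} (hM : 0 < M) (g : treeGroup k) (x : TreeCell k m M)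
    (h : g • x = x) : g = 1 := by
  by_contra hg
  have : ∃ w, g⁻¹.1 w ≠ w := by
    by_contra! hw
    apply hg
    rw [← inv_eq_one]
    exact Subtype.ext (Equiv.ext hw)
  obtain ⟨w, hw⟩ := this
  have hex : ∃ i : ℕ, ∃ hi : i < k, w ⟨i, hi⟩ ≠ g⁻¹.1 w ⟨i, hi⟩ := by
    obtain ⟨i, hi⟩ := Function.ne_iff.1 hw
    exact ⟨i.1, i.2, hi.symm⟩
  classical
  obtain ⟨hi, hne⟩ := Nat.find_spec hex
  set i : Fin k := ⟨Nat.find hex, hi⟩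
  have hag : Agree i w (g⁻¹.1 w) := by
    intro l hl
    have := Nat.find_min hex hl
    push Not at this
    exact this l.2
  have h1 := x.2.1 i w _ hag
  rw [if_neg hne] at h1
  rw [← treeCell_smul_val, h] at h1
  obtain ⟨c, hc⟩ := (x.2.2 w i).2
  have h2 := congrFun h1 c
  simp only [Pi.neg_apply] at h2
  have : x.1 w i c = 0 := by omega
  rw [this] at hc
  simp at hc
  omega

end Tree

section TreeFlags

variable {k m : ℕ} {M : ℤ}

/-- The dimension of a cell of the product complex. -/
noncomputable def cellRank (x : (Fin k → Bool) → Fin k → Fin (m + 1) → ℤ) : ℕ :=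
  ∑ n : Node k, oddCount (x n.out.1 n.out.2)

/-- The face relation of the product complex. -/
def TreeFace (x y : (Fin k → Bool) → Fin k → Fin (m + 1) → ℤ) : Prop :=
  ∀ w j, Face (x w j) (y w j)

theorem TreeFace.trans {x y z : (Fin k → Bool) → Fin k → Fin (m + 1) → ℤ} (h : TreeFace x y)
    (h' : TreeFace y z) : TreeFace x z := fun w j c => (h w j c).trans (h' w j c)

theorem TreeFace.rfl' (x : (Fin k → Bool) → Fin k → Fin (m + 1) → ℤ) : TreeFace x x :=
  fun _ _ _ => Or.inl rfl

theorem Compat.oddCount_congr {x : (Fin k → Bool) → Fin k → Fin (m + 1) → ℤ} (hx : Compat x)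
    (j : Fin k) (w w' : Fin k → Bool) (h : Agree j.1 w w') :
    oddCount (x w j) = oddCount (x w' j) := by
  rw [hx j w w' h]
  split_ifs
  · rfl
  · rw [oddCount_neg]

theorem Compat.oddCount_node {x : (Fin k → Bool) → Fin k → Fin (m + 1) → ℤ} (hx : Compat x)
    (w : Fin k → Bool) (j : Fin k) :
    oddCount (x (⟦(w, j)⟧ : Node k).out.1 (⟦(w, j)⟧ : Node k).out.2) = oddCount (x w j) := by
  have h := node_out w j
  rw [h.1]
  exact hx.oddCount_congr j _ _ h.2.symm

/-- A complete flag of cells. -/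
def IsFlag {D : ℕ} (s : Fin (D + 1) → TreeCell k m M) : Prop :=
  (∀ i, cellRank (s i).1 = i) ∧ ∀ i i', i ≤ i' → TreeFace (s i).1 (s i').1

/-- The other cell completing a flag with the cell at position `j` left out. -/
noncomputable def rawFlip {D : ℕ} (j : Fin (D + 1))
    (s : Fin (D + 1) → TreeCell k m M) :
    (Fin k → Bool) → Fin k → Fin (m + 1) → ℤ := fun w l =>
  if j.1 = 0 then fun c => 2 * (s (Fin.ofNat _ 1)).1 w l c - (s j).1 w l c
  else if j.1 = D then
    topFlip M ((s (Fin.ofNat _ (j.1 - 1))).1 w l) ((s j).1 w l)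
  else fun c => (s (Fin.ofNat _ (j.1 - 1))).1 w l c + (s (Fin.ofNat _ (j.1 + 1))).1 w l c -
    (s j).1 w l c

theorem ofNat_val {D i : ℕ} (h : i ≤ D) : (Fin.ofNat (D + 1) i).1 = i := by
  simp [Fin.ofNat, Nat.mod_eq_of_lt (Nat.lt_succ_of_le h)]

theorem rawFlip_compat {D : ℕ} (j : Fin (D + 1))
    (s : Fin (D + 1) → TreeCell k m M) : Compat (rawFlip j s) := by
  intro l w w' h
  have hs : ∀ i, (s i).1 w' l = if w l = w' l then (s i).1 w l else -(s i).1 w l :=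
    fun i => (s i).2.1 l w w' h
  unfold rawFlip
  by_cases hw : w l = w' l
  · simp only [hw, if_true] at hs ⊢
    simp only [hs]
  · simp only [hw, if_false] at hs ⊢
    simp only [hs, topFlip_neg]
    split_ifs
    · ext c; simp only [Pi.neg_apply]; ring
    · rfl
    · ext c; simp only [Pi.neg_apply]; ring

theorem oddCount_eq_sum (b : Fin (m + 1) → ℤ) : oddCount b = ∑ c, if Odd (b c) then 1 else 0 := by
  simp [oddCount]

theorem rawFlip_spec {D : ℕ} (hD : D = Fintype.card (Node k) * m) (hM : Even M) (hM0 : 0 < M) (hd : 0 < D)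
    {s : Fin (D + 1) → TreeCell k m M} (hs : IsFlag s)
    (j : Fin (D + 1)) :
    (∀ w l, IsCell M (rawFlip j s w l)) ∧ cellRank (rawFlip j s) = j ∧
    (∀ i, i < j → TreeFace (s i).1 (rawFlip j s)) ∧ (∀ i, j < i → TreeFace (rawFlip j s) (s i).1) ∧
    rawFlip j s ≠ (s j).1 ∧
    ∀ s', (∀ i, i ≠ j → s' i = s i) → (s' j).1 = rawFlip j s → rawFlip j s' = (s j).1 := by
  by_cases hj0 : j.1 = 0
  · have hr : ∀ s : Fin (D + 1) → TreeCell k m M, rawFlip j s =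
        fun w l c => 2 * (s (Fin.ofNat _ 1)).1 w l c - (s j).1 w l c := by
      intro s; unfold rawFlip; ext w l c; rw [if_pos hj0]
    set b : Fin (D + 1) := Fin.ofNat _ 1 with hb
    have hb1 : b.1 = 1 := ofNat_val hd
    have hjb : j ≤ b := by rw [Fin.le_def]; omega
    have hev : ∀ w l c, Even ((s j).1 w l c) := by
      intro w l c
      have h1 := hs.1 j
      rw [hj0] at h1
      have h2 := (Finset.sum_eq_zero_iff.1 h1) ⟦(w, l)⟧ (Finset.mem_univ _)
      rw [(s j).2.1.oddCount_node, oddCount, Finset.card_eq_zero] at h2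
      rw [← Int.not_odd_iff_even]
      intro h
      have : c ∈ (∅ : Finset (Fin (m + 1))) := h2 ▸ (by simp [h])
      simp at this
    have hrefl : ∀ w l c, IntFace (rawFlip j s w l c) ((s b).1 w l c) ∧
        Even (rawFlip j s w l c) := by
      intro w l c
      rw [hr]
      exact IntFace.reflect (hev w l c) (hs.2 j b hjb w l c)
    refine ⟨?_, ?_, ?_, ?_, ?_, ?_⟩
    · intro w l
      constructor
      · intro c
        have h1 := (hrefl w l c).1
        have h2 := ((s b).2.2 w l).1 c
        rcases h1 with h1 | ⟨h1, h3⟩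
        · rw [h1]; exact h2
        · have h4 : |(s b).1 w l c| ≠ M := by
            intro h
            rw [← h, even_abs] at hM
            exact Int.not_even_iff_odd.2 h1 hM
          have h5 := lt_of_le_of_ne h2 h4
          rw [abs_lt] at h5
          rw [abs_le]
          rcases abs_eq (zero_le_one' ℤ) |>.1 h3 with h | h <;> constructor <;> omega
      · obtain ⟨c, hc⟩ := ((s b).2.2 w l).2
        refine ⟨c, ?_⟩
        rw [(hrefl w l c).1.eq_of_even (by rw [← even_abs, hc]; exact hM), hc]
    · rw [hj0]
      refine Finset.sum_eq_zero fun n _ => ?_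
      rw [oddCount, Finset.card_eq_zero, Finset.filter_eq_empty_iff]
      intro c _
      rw [Int.not_odd_iff_even]
      exact (hrefl _ _ c).2
    · intro i hi
      rw [Fin.lt_def] at hi
      omega
    · intro i hi
      refine TreeFace.trans (fun w l c => (hrefl w l c).1) (hs.2 b i ?_)
      rw [Fin.le_def]; rw [Fin.lt_def] at hi; omega
    · intro h
      have h1 : (s b).1 = (s j).1 := by
        ext w l c
        have := congrFun (congrFun (congrFun h w) l) c
        rw [hr] at this
        simp only at this
        omega
      have h2 := hs.1 b
      rw [h1, hs.1 j] at h2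
      omega
    · intro s' h1 h2
      have hbj : b ≠ j := by intro h; rw [h] at hb1; omega
      rw [hr, h2, h1 b hbj, hr]
      ext w l c
      ring
  by_cases hjd : j.1 = D
  · have hr : ∀ s : Fin (D + 1) → TreeCell k m M, rawFlip j s =
        fun w l => topFlip M ((s (Fin.ofNat _ (j.1 - 1))).1 w l) ((s j).1 w l) := by
      intro s; unfold rawFlip; ext w l c; rw [if_neg hj0, if_pos hjd]
    set a : Fin (D + 1) := Fin.ofNat _ (j.1 - 1) with ha
    have ha1 : a.1 = j.1 - 1 := ofNat_val (by omega)
    have haj : a ≤ j := by rw [Fin.le_def]; omega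
    have hle : ∀ (x : TreeCell k m M) (n : Node k), oddCount (x.1 n.out.1 n.out.2) ≤ m :=
      fun x n => oddCount_le hM (x.2.2 _ _)
    have hsum : ∀ x : TreeCell k m M,
        ∑ n : Node k, (m - oddCount (x.1 n.out.1 n.out.2)) + cellRank x.1 = D := by
      intro x
      unfold cellRank
      rw [← Finset.sum_add_distrib, Finset.sum_congr rfl (fun n _ => Nat.sub_add_cancel (hle x n))]
      simp [hD]
    have hox : ∀ w l, oddCount ((s j).1 w l) = m := by
      intro w l
      have h1 := hsum (s j)
      rw [hs.1 j, hjd] at h1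
      have h2 : ∑ n : Node k, (m - oddCount ((s j).1 n.out.1 n.out.2)) = 0 := by omega
      have h3 := (Finset.sum_eq_zero_iff.1 h2) ⟦(w, l)⟧ (Finset.mem_univ _)
      rw [(s j).2.1.oddCount_node] at h3
      have h4 := oddCount_le hM ((s j).2.2 w l)
      omega
    have hoa : ∀ w l, m ≤ oddCount ((s a).1 w l) + 1 := by
      intro w l
      have h1 := hsum (s a)
      rw [hs.1 a, ha1, hjd] at h1
      have h2 : ∑ n : Node k, (m - oddCount ((s a).1 n.out.1 n.out.2)) = 1 := by omega
      have h3 := Finset.single_le_sum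
        (f := fun n : Node k => (m - oddCount ((s a).1 n.out.1 n.out.2)))
        (fun _ _ => Nat.zero_le _) (Finset.mem_univ ⟦(w, l)⟧)
      simp only [(s a).2.1.oddCount_node] at h3
      omega
    have hspec := fun w l => topFlip_spec hM hM0 ((s a).2.2 w l) ((s j).2.2 w l)
      (hs.2 a j haj w l) (hox w l) (hoa w l)
    refine ⟨?_, ?_, ?_, ?_, ?_, ?_⟩
    · intro w l; rw [hr]; exact (hspec w l).2.1
    · rw [hr]
      unfold cellRank
      rw [Finset.sum_congr rfl (fun n _ => (hspec _ _).2.2.1)]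
      simp [hjd, hD]
    · intro i hi
      refine TreeFace.trans (hs.2 i a ?_) ?_
      · rw [Fin.le_def]; rw [Fin.lt_def] at hi; omega
      · rw [hr]; exact fun w l => (hspec w l).1
    · intro i hi
      rw [Fin.lt_def] at hi
      have := i.2
      omega
    · intro h
      have h1 : (s a).1 ≠ (s j).1 := by
        intro h1
        have h2 := hs.1 a
        rw [h1, hs.1 j] at h2
        omega
      obtain ⟨w, hw⟩ := Function.ne_iff.1 h1
      obtain ⟨l, hl⟩ := Function.ne_iff.1 hw
      apply (hspec w l).2.2.2.2 hl
      have := congrFun (congrFun h w) l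
      rwa [hr] at this
    · intro s' h1 h2
      have hbj : a ≠ j := by intro h; rw [h] at ha1; omega
      rw [hr, h2, h1 a hbj, hr]
      ext w l c
      rw [(hspec w l).2.2.2.1]
  · have hr : ∀ s : Fin (D + 1) → TreeCell k m M, rawFlip j s =
        fun w l c => (s (Fin.ofNat _ (j.1 - 1))).1 w l c + (s (Fin.ofNat _ (j.1 + 1))).1 w l c -
    (s j).1 w l c := by
      intro s; unfold rawFlip; ext w l c; rw [if_neg hj0, if_neg hjd]
    have hj2 := j.2
    set a : Fin (D + 1) := Fin.ofNat _ (j.1 - 1) with ha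
    have ha1 : a.1 = j.1 - 1 := ofNat_val (by omega)
    set b : Fin (D + 1) := Fin.ofNat _ (j.1 + 1) with hb
    have hb1 : b.1 = j.1 + 1 := ofNat_val (by omega)
    have haj : a ≤ j := by rw [Fin.le_def]; omega
    have hjb : j ≤ b := by rw [Fin.le_def]; omega
    have hmid : ∀ w l c, (rawFlip j s w l c = (s a).1 w l c ∧ (s j).1 w l c = (s b).1 w l c) ∨
        (rawFlip j s w l c = (s b).1 w l c ∧ (s j).1 w l c = (s a).1 w l c) := by
      intro w l c
      rw [hr]
      exact IntFace.mid (hs.2 a j haj w l c) (hs.2 j b hjb w l c)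
    have hab := hs.2 a b (haj.trans hjb)
    refine ⟨?_, ?_, ?_, ?_, ?_, ?_⟩
    · intro w l
      constructor
      · intro c
        rcases hmid w l c with ⟨h, -⟩ | ⟨h, -⟩ <;> rw [h]
        · exact ((s a).2.2 w l).1 c
        · exact ((s b).2.2 w l).1 c
      · obtain ⟨c, hc⟩ := ((s b).2.2 w l).2
        refine ⟨c, ?_⟩
        rcases hmid w l c with ⟨h, -⟩ | ⟨h, -⟩ <;> rw [h]
        · rw [(hab w l c).eq_of_even (by rw [← even_abs, hc]; exact hM), hc]
        · exact hc
    · have h1 : cellRank (rawFlip j s) + cellRank (s j).1 = cellRank (s a).1 + cellRank (s b).1 := by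
        unfold cellRank
        rw [← Finset.sum_add_distrib, ← Finset.sum_add_distrib]
        refine Finset.sum_congr rfl fun n _ => ?_
        simp only [oddCount_eq_sum]
        rw [← Finset.sum_add_distrib, ← Finset.sum_add_distrib]
        refine Finset.sum_congr rfl fun c _ => ?_
        rcases hmid n.out.1 n.out.2 c with ⟨h, h'⟩ | ⟨h, h'⟩ <;> rw [h, h']
        rw [add_comm]
      rw [hs.1, hs.1, hs.1] at h1
      omega
    · intro i hi
      refine TreeFace.trans (hs.2 i a ?_) ?_
      · rw [Fin.le_def]; rw [Fin.lt_def] at hi; omega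
      · intro w l c
        rcases hmid w l c with ⟨h, -⟩ | ⟨h, -⟩ <;> rw [h]
        · exact Or.inl rfl
        · exact hab w l c
    · intro i hi
      refine TreeFace.trans ?_ (hs.2 b i ?_)
      · intro w l c
        rcases hmid w l c with ⟨h, -⟩ | ⟨h, -⟩ <;> rw [h]
        · exact hab w l c
        · exact Or.inl rfl
      · rw [Fin.le_def]; rw [Fin.lt_def] at hi; omega
    · intro h
      have h1 : (s a).1 = (s b).1 := by
        ext w l c
        have := congrFun (congrFun (congrFun h w) l) c
        rcases hmid w l c with ⟨h1, h2⟩ | ⟨h1, h2⟩ <;> omega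
      have h2 := hs.1 a
      rw [h1, hs.1 b] at h2
      omega
    · intro s' h1 h2
      have haj' : a ≠ j := by intro h; rw [h] at ha1; omega
      have hbj' : b ≠ j := by intro h; rw [h] at hb1; omega
      rw [hr, h2, h1 a haj', h1 b hbj', hr]
      ext w l c
      ring

theorem cellRank_smul (g : treeGroup k) (x : TreeCell k m M) :
    cellRank (g • x).1 = cellRank x.1 := by
  unfold cellRank
  simp only [treeCell_smul_val]
  exact sum_node_smul (fun w j => oddCount (x.1 w j))
    (fun j w w' h => x.2.1.oddCount_congr j w w' h) g

open Classical in
/-- The top simplices of the barycentric subdivision of the product of spheres. -/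
noncomputable def treeSystem (k m : ℕ) (M : ℤ) (hM : Even M) (hM0 : 0 < M)
    (hd : 0 < Fintype.card (Node k) * m) :
    ChainSystem (treeGroup k) (TreeCell k m M) (Fintype.card (Node k) * m) :=
  have := Fintype.ofFinite (TreeCell k m M)
  have key : ∀ j, ∀ s : Fin (Fintype.card (Node k) * m + 1) → TreeCell k m M,
    (hs : IsFlag s) →
    IsFlag (Function.update s j ⟨rawFlip j s, rawFlip_compat j s, (rawFlip_spec rfl hM hM0 hd hs j).1⟩) := by
    intro j s hs
    obtain ⟨h1, h2, h3, h4, h5, h6⟩ := rawFlip_spec rfl hM hM0 hd hs j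
    constructor
    · intro i
      by_cases hi : i = j
      · subst hi; simpa using h2
      · simpa [hi] using hs.1 i
    · intro i i' hii
      by_cases hi : i = j
      · subst hi
        by_cases hi' : i' = i
        · subst hi'; exact TreeFace.rfl' _
        · simpa [hi'] using h4 i' (lt_of_le_of_ne hii (Ne.symm hi'))
      · by_cases hi' : i' = j
        · subst hi'; simpa [hi] using h3 i (lt_of_le_of_ne hii hi)
        · simpa [hi, hi'] using hs.2 i i' hii
  { C := Finset.univ.filter IsFlag
    rk := fun x => cellRank x.1
    flip := fun j s => if hs : IsFlag s then Function.update s j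
      ⟨rawFlip j s, rawFlip_compat j s, (rawFlip_spec rfl hM hM0 hd hs j).1⟩ else s
    free := treeCell_free hM0
    rk_smul := cellRank_smul
    rk_apply := fun s hs i => (Finset.mem_filter.1 hs).2.1 i
    smul_mem := fun g s hs => by
      rw [Finset.mem_filter] at hs ⊢
      refine ⟨Finset.mem_univ _, fun i => ?_, fun i i' h w j => ?_⟩
      · rw [cellRank_smul]; exact hs.2.1 i
      · exact hs.2.2 i i' h _ j
    flip_mem := fun j s hs => by
      rw [Finset.mem_filter] at hs ⊢
      rw [dif_pos hs.2]
      exact ⟨Finset.mem_univ _, key j s hs.2⟩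
    flip_flip := fun j s hs => by
      rw [Finset.mem_filter] at hs
      rw [dif_pos hs.2, dif_pos (key j s hs.2)]
      ext i : 1
      by_cases hi : i = j
      · subst hi
        rw [Function.update_self]
        apply Subtype.ext
        exact (rawFlip_spec rfl hM hM0 hd hs.2 i).2.2.2.2.2 _
          (fun l hl => by rw [Function.update_of_ne hl]) (by rw [Function.update_self])
      · simp [hi]
    flip_ne := fun j s hs => by
      rw [Finset.mem_filter] at hs
      rw [dif_pos hs.2]
      intro h
      have h1 := congrArg Subtype.val (congrFun h j)
      rw [Function.update_self] at h1
      exact (rawFlip_spec rfl hM hM0 hd hs.2 j).2.2.2.2.1 h1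
    flip_apply := fun j s hs i hi => by
      rw [Finset.mem_filter] at hs
      rw [dif_pos hs.2, Function.update_of_ne hi] }

theorem mem_treeSystem {hM : Even M} {hM0 : 0 < M} {hd : 0 < Fintype.card (Node k) * m}
    (s : Fin (Fintype.card (Node k) * m + 1) → TreeCell k m M) :
    s ∈ (treeSystem k m M hM hM0 hd).C ↔ IsFlag s := by
  classical
  simp [treeSystem]

end TreeFlags

section TestLabels

theorem flag_rigid {d : ℕ} (z : Fin (d + 1) → Fin d → ℤ)
    (hz : ∀ i i', i ≤ i' → ∀ q, IntFace (z i q) (z i' q))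
    (hcard : ∀ r, (Finset.univ.filter fun q => Odd (z r q)).card = r.1)
    (c : Fin (d + 1) → ℝ) (hc : ∀ i, 0 ≤ c i) (hS : 0 < ∑ i, c i)
    (hsum : ∀ q : Fin d, ∑ r, c r * (z r q : ℝ) = ((q.1 : ℝ) + 1) / (d + 1) * ∑ i, c i) :
    (∀ r q, z r q = if d ≤ r.1 + q.1 then 1 else 0) ∧ ∀ r, 0 < c r := by
  set S := ∑ i, c i with hSdef
  have hd1 : (0 : ℝ) < d + 1 := by positivity
  have heven : ∀ q, Even (z 0 q) := by
    intro q
    have h := hcard 0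
    rw [Fin.val_zero, Finset.card_eq_zero, Finset.filter_eq_empty_iff] at h
    exact Int.not_odd_iff_even.1 (h (Finset.mem_univ q))
  have hodd : ∀ q, Odd (z (Fin.last d) q) := by
    intro q
    have h : (Finset.univ.filter fun q => Odd (z (Fin.last d) q)) = Finset.univ :=
      (Finset.card_eq_iff_eq_univ _).1 (by rw [hcard]; simp)
    have : q ∈ (Finset.univ.filter fun q => Odd (z (Fin.last d) q)) := by
      rw [h]; exact Finset.mem_univ q
    simpa using this
  have h01 : ∀ q, ∀ r, (z r q = z 0 q ∨ z r q = z (Fin.last d) q) := by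
    intro q r
    have h1 := hz 0 r (Fin.zero_le r) q
    have h2 := hz r (Fin.last d) (Fin.le_last r) q
    by_cases hr : Even (z r q)
    · exact Or.inl (h1.eq_of_even hr).symm
    · right
      rcases h2 with h2 | ⟨h2, h3⟩
      · exact h2
      · exfalso
        apply hr
        rcases h2 with ⟨p, hp⟩
        rcases abs_eq (zero_le_one' ℤ) |>.1 h3 with h | h
        · exact ⟨p, by omega⟩
        · exact ⟨p + 1, by omega⟩
  have hzv : ∀ q, z 0 q = 0 ∧ z (Fin.last d) q = 1 := by
    intro q
    have hq : ((q.1 : ℝ) + 1) < d + 1 := by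
      have := q.2
      have : (q.1 : ℝ) < d := by exact_mod_cast this
      linarith
    have hlt : ((q.1 : ℝ) + 1) / (d + 1) * S < S := by
      have : ((q.1 : ℝ) + 1) / (d + 1) < 1 := by rw [div_lt_one hd1]; exact hq
      nlinarith
    have hpos : 0 < ((q.1 : ℝ) + 1) / (d + 1) * S := by positivity
    rw [← hsum q] at hlt hpos
    have hle1 : min (z 0 q) (z (Fin.last d) q) < 1 := by
      by_contra! h
      apply absurd hlt
      rw [not_lt, hSdef]
      refine Finset.sum_le_sum fun r _ => ?_
      have : (1 : ℤ) ≤ z r q := by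
        rw [le_min_iff] at h
        rcases h01 q r with h' | h' <;> rw [h'] <;> tauto
      have : (1 : ℝ) ≤ z r q := by exact_mod_cast this
      nlinarith [hc r]
    have hge0 : 0 < max (z 0 q) (z (Fin.last d) q) := by
      by_contra! h
      apply absurd hpos
      rw [not_lt]
      refine Finset.sum_nonpos fun r _ => ?_
      have : z r q ≤ 0 := by
        rw [max_le_iff] at h
        rcases h01 q r with h' | h' <;> rw [h'] <;> tauto
      have : (z r q : ℝ) ≤ 0 := by exact_mod_cast this
      nlinarith [hc r]
    rcases hz 0 (Fin.last d) (Fin.zero_le _) q with h | ⟨h, h'⟩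
    · exfalso
      have := heven q
      rw [h] at this
      exact Int.not_even_iff_odd.2 (hodd q) this
    · obtain ⟨p, hp⟩ := h
      obtain ⟨p', hp'⟩ := heven q
      rcases abs_eq (zero_le_one' ℤ) |>.1 h' with h | h <;>
        rcases min_cases (z 0 q) (z (Fin.last d) q) with ⟨h1, h2⟩ | ⟨h1, h2⟩ <;>
        rcases max_cases (z 0 q) (z (Fin.last d) q) with ⟨h3, h4⟩ | ⟨h3, h4⟩ <;> omega
  have hmono : ∀ r r' q, r ≤ r' → Odd (z r q) → Odd (z r' q) := by
    intro r r' q h ho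
    rcases hz r r' h q with h | ⟨h, -⟩
    · rw [← h]; exact ho
    · exact h
  have hval : ∀ r q, z r q = if Odd (z r q) then 1 else 0 := by
    intro r q
    rcases h01 q r with h | h
    · rw [h, (hzv q).1]; simp
    · rw [h, (hzv q).2]; simp
  have hord : ∀ r q q', Odd (z r q) → ¬ Odd (z r q') → q' < q := by
    intro r q q' ho hno
    have hle : ∑ r, c r * (z r q' : ℝ) ≤ ∑ r, c r * (z r q : ℝ) := by
      refine Finset.sum_le_sum fun r' _ => mul_le_mul_of_nonneg_left ?_ (hc r')
      have : z r' q' ≤ z r' q := by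
        rw [hval r' q', hval r' q]
        by_cases h : Odd (z r' q')
        · have : Odd (z r' q) := by
            rcases le_total r r' with h1 | h1
            · exact hmono _ _ _ h1 ho
            · exact absurd (hmono _ _ _ h1 h) hno
          simp [h, this]
        · rw [if_neg h]; split_ifs <;> simp
      exact_mod_cast this
    rw [hsum, hsum] at hle
    have h1 := le_of_mul_le_mul_right hle hS
    rw [div_le_div_iff_of_pos_right hd1] at h1
    have h2 : q'.1 ≤ q.1 := by
      have : (q'.1 : ℝ) ≤ q.1 := by linarith
      exact_mod_cast this
    refine lt_of_le_of_ne h2 ?_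
    rintro rfl
    exact hno ho
  have hiff : ∀ r q, Odd (z r q) ↔ d ≤ r.1 + q.1 := by
    intro r q
    constructor
    · intro h
      have h1 : (Finset.univ.filter fun q' => ¬ Odd (z r q')) ⊆ Finset.Iio q := by
        intro q' hq'
        simp only [Finset.mem_filter, Finset.mem_univ, true_and] at hq'
        exact Finset.mem_Iio.2 (hord r q q' h hq')
      have h2 := Finset.card_le_card h1
      have h3 := Finset.card_filter_add_card_filter_not (s := Finset.univ) (fun q => Odd (z r q))
      rw [hcard, Finset.card_univ, Fintype.card_fin] at h3
      rw [Fin.card_Iio] at h2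
      omega
    · intro h
      by_contra hno
      have h1 : (Finset.univ.filter fun q' => Odd (z r q')) ⊆ Finset.Ioi q := by
        intro q' hq'
        simp only [Finset.mem_filter, Finset.mem_univ, true_and] at hq'
        exact Finset.mem_Ioi.2 (hord r q' q hq' hno)
      have h2 := Finset.card_le_card h1
      rw [hcard, Fin.card_Ioi] at h2
      have := q.2
      omega
  refine ⟨fun r q => by rw [hval r q]; simp only [hiff], fun r => ?_⟩
  have htail : ∀ q : ℕ, q ≤ d → (∑ r : Fin (d + 1), if d ≤ r.1 + q then c r else 0) =
      ((q : ℝ) + 1) / (d + 1) * S := by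
    intro q hq
    rcases hq.lt_or_eq with hq | hq
    · rw [← hsum ⟨q, hq⟩]
      refine Finset.sum_congr rfl fun r _ => ?_
      rw [hval r ⟨q, hq⟩]
      simp only [hiff]
      split_ifs <;> simp
    · subst hq
      simp only [le_add_iff_nonneg_left, zero_le, if_true]
      rw [div_self hd1.ne', one_mul]
  have hr := r.2
  have h1 := htail (d - r.1) (by omega)
  have hsplit : (∑ r' : Fin (d + 1), if d ≤ r'.1 + (d - r.1) then c r' else 0) = c r +
      ∑ r' : Fin (d + 1), if r.1 + 1 ≤ r'.1 then c r' else 0 := by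
    have : ∀ r' : Fin (d + 1), (if d ≤ r'.1 + (d - r.1) then c r' else 0) =
        (if r' = r then c r' else 0) + if r.1 + 1 ≤ r'.1 then c r' else 0 := by
      intro r'
      by_cases h : r' = r
      · subst h
        have e : d ≤ r'.1 + (d - r'.1) := by omega
        simp [e]
      · have : r'.1 ≠ r.1 := fun h' => h (Fin.ext h')
        have e : (d ≤ r'.1 + (d - r.1)) ↔ r.1 + 1 ≤ r'.1 := by omega
        simp [e, h]
    rw [Finset.sum_congr rfl fun r' _ => this r', Finset.sum_add_distrib]
    simp
  rw [hsplit] at h1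
  have hlt : (∑ r' : Fin (d + 1), if r.1 + 1 ≤ r'.1 then c r' else 0) <
      (((d - r.1 : ℕ) : ℝ) + 1) / (d + 1) * S := by
    rcases Nat.eq_zero_or_pos (d - r.1) with h0 | h0
    · rw [h0]
      have : (∑ r' : Fin (d + 1), if r.1 + 1 ≤ r'.1 then c r' else 0) = 0 := by
        refine Finset.sum_eq_zero fun r' _ => if_neg ?_
        have := r'.2
        omega
      rw [this]
      positivity
    · have h2 := htail (d - r.1 - 1) (by omega)
      have : (∑ r' : Fin (d + 1), if r.1 + 1 ≤ r'.1 then c r' else 0) =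
          ∑ r' : Fin (d + 1), if d ≤ r'.1 + (d - r.1 - 1) then c r' else 0 := by
        refine Finset.sum_congr rfl fun r' _ => ?_
        have e : (d ≤ r'.1 + (d - r.1 - 1)) ↔ r.1 + 1 ≤ r'.1 := by omega
        simp [e]
      rw [this, h2]
      refine mul_lt_mul_of_pos_right ?_ hS
      rw [div_lt_div_iff_of_pos_right hd1]
      have : (((d - r.1 - 1 : ℕ) : ℝ)) < ((d - r.1 : ℕ) : ℝ) := by exact_mod_cast (by omega)
      linarith
  linarith

end TestLabels

section TestLabels

variable {k m : ℕ} {M : ℤ}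

/-- The branch of the tree given by the signs of the leading coordinates. -/
def signBranch (y : Fin k → Fin (m + 1) → ℤ) : Fin k → Bool := fun l => decide (y l 0 < 0)

/-- One branch of the test label. -/
noncomputable def testRow (θ : Node k × Fin m → ℝ) (M : ℤ) (y : Fin k → Fin (m + 1) → ℤ) :
    Fin k → Fin m → ℝ :=
  fun j i => y j i.succ - θ (⟦(signBranch y, j)⟧, i) / M * y j 0

theorem node_eq {v v' : Fin k → Bool} {j : Fin k} (h : Agree j.1 v v') :
    (⟦(v, j)⟧ : Node k) = ⟦(v', j)⟧ := Quotient.sound ⟨rfl, h⟩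

theorem Compat.eq_of_agree {N : Type*} [Neg N] {x : (Fin k → Bool) → Fin k → N} (hx : Compat x)
    {j : ℕ} {w w' : Fin k → Bool} (h : Agree j w w') (l : Fin k) (hl : l.1 < j) : x w' l = x w l := by
  rw [hx l w w' (h.mono hl.le), if_pos (h l hl)]

theorem testRow_compat (θ : Node k × Fin m → ℝ) {x : (Fin k → Bool) → Fin k → Fin (m + 1) → ℤ}
    (hx : Compat x) : Compat fun w => testRow θ M (x w) := by
  intro j w w' h
  have h1 : Agree j.1 (signBranch (x w')) (signBranch (x w)) := by
    intro l hl
    simp only [signBranch, hx.eq_of_agree h l hl]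
  unfold testRow
  beta_reduce
  rw [node_eq h1, hx j w w' h]
  split_ifs
  · rfl
  · ext i; simp; ring

/-- The test labelling. -/
noncomputable def testLabel (θ : Node k × Fin m → ℝ) (x : TreeCell k m M) : labelSpace k m :=
  ⟨fun w => testRow θ M (x.1 w), testRow_compat θ x.2.1⟩

theorem testLabel_equivariant (θ : Node k × Fin m → ℝ) :
    ChainSystem.Equivariant (labelRep k m) (testLabel (M := M) θ) := fun _ _ => rfl

theorem IsFlag.intFace_last {D : ℕ} {s : Fin (D + 1) → TreeCell k m M} (hs : IsFlag s) (r w j c) :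
    IntFace ((s r).1 w j c) ((s (Fin.last D)).1 w j c) := hs.2 r _ (Fin.le_last r) w j c

theorem leading_const (hM : Even M) (hM0 : 0 < M) {θ : Node k × Fin m → ℝ}
    (hθ : ∀ q, 0 < θ q ∧ θ q < 1) {D : ℕ} {s : Fin (D + 1) → TreeCell k m M} (hs : IsFlag s)
    {a : Fin (D + 1) → ℝ} (ha : ∀ r, 0 ≤ a r) (hS : 0 < ∑ r, a r)
    (hz : ∑ r, a r • testLabel θ (s r) = 0) (w : Fin k → Bool) (j : ℕ) :
    ∀ hj : j < k, |(s 0).1 w ⟨j, hj⟩ 0| = M ∧ ∀ r, (s r).1 w ⟨j, hj⟩ 0 = (s 0).1 w ⟨j, hj⟩ 0 := by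
  induction j using Nat.strong_induction_on with
  | _ j ih =>
  intro hj
  have hM2 : (2 : ℝ) ≤ M := by
    obtain ⟨p, hp⟩ := hM
    exact_mod_cast (by omega : (2 : ℤ) ≤ M)
  have hsb : ∀ r, (⟦(signBranch ((s r).1 w), ⟨j, hj⟩)⟧ : Node k) =
      ⟦(signBranch ((s 0).1 w), ⟨j, hj⟩)⟧ := by
    intro r
    apply node_eq
    intro l hl
    simp only [signBranch]
    rw [(ih l.1 hl l.2).2 r]
  obtain ⟨c, hc⟩ := ((s (Fin.last D)).2.2 w ⟨j, hj⟩).2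
  have hcr : ∀ r, (s r).1 w ⟨j, hj⟩ c = (s (Fin.last D)).1 w ⟨j, hj⟩ c := fun r =>
    (hs.intFace_last r w _ c).eq_of_even (by rw [← even_abs, hc]; exact hM)
  suffices c = 0 by
    subst this
    exact ⟨by rw [hcr, hc], fun r => by rw [hcr r, hcr 0]⟩
  by_contra hc0
  obtain ⟨i, rfl⟩ := Fin.exists_succ_eq.2 hc0
  have h1 := congrFun (congrFun (congrFun (congrArg Subtype.val hz) w) ⟨j, hj⟩) i
  simp only [testLabel, testRow, AddSubmonoidClass.coe_finsetSum, Submodule.coe_smul,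
    Finset.sum_apply, Pi.smul_apply, smul_eq_mul, ZeroMemClass.coe_zero, Pi.zero_apply, hsb, hcr,
    mul_sub, Finset.sum_sub_distrib, ← Finset.sum_mul] at h1
  obtain ⟨ht0, ht1⟩ := hθ (⟦(signBranch ((s 0).1 w), ⟨j, hj⟩)⟧, i)
  set t := θ (⟦(signBranch ((s 0).1 w), ⟨j, hj⟩)⟧, i)
  have h2 : |∑ r, a r * (t / M * (s r).1 w ⟨j, hj⟩ 0)| ≤ ∑ r, a r * 1 := by
    refine (Finset.abs_sum_le_sum_abs _ _).trans (Finset.sum_le_sum fun r _ => ?_)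
    rw [abs_mul, abs_of_nonneg (ha r), abs_mul, abs_of_pos (by positivity : 0 < t / (M : ℝ))]
    refine mul_le_mul_of_nonneg_left ?_ (ha r)
    have : |((s r).1 w ⟨j, hj⟩ 0 : ℝ)| ≤ M := by
      exact_mod_cast ((s r).2.2 w ⟨j, hj⟩).1 0
    calc t / M * |((s r).1 w ⟨j, hj⟩ 0 : ℝ)| ≤ t / M * M := by gcongr
      _ = t := by field_simp
      _ ≤ 1 := ht1.le
  have h3 : |(∑ r, a r) * ((s (Fin.last D)).1 w ⟨j, hj⟩ i.succ : ℝ)| = (∑ r, a r) * M := by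
    rw [abs_mul, abs_of_pos hS]
    congr 1
    exact_mod_cast hc
  rw [sub_eq_zero] at h1
  simp only [mul_one] at h2
  rw [← h1, h3] at h2
  nlinarith

end TestLabels

section StandardFlag

variable {k m : ℕ} {M : ℤ}

/-- The sign attached to a side of a node. -/
def sideSign (b : Bool) : ℤ := if b then -1 else 1

theorem sideSign_mul_self (b : Bool) : sideSign b * sideSign b = 1 := by cases b <;> simp [sideSign]

theorem odd_sideSign_mul (b : Bool) (x : ℤ) : Odd (sideSign b * x) ↔ Odd x := by
  cases b <;> simp [sideSign]

theorem compat_sideSign {N : Type*} (f : Node k → N → ℤ) :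
    Compat fun (v : Fin k → Bool) j (c : N) => sideSign (v j) * f ⟦(v, j)⟧ c := by
  intro j w w' h
  beta_reduce
  rw [node_eq h]
  cases w j <;> cases w' j <;> simp [sideSign] <;> ext <;> simp

theorem Compat.sideSign_mul {N : Type*} {x : (Fin k → Bool) → Fin k → N → ℤ} (hx : Compat x)
    {j : Fin k} {w w' : Fin k → Bool} (h : Agree j.1 w w') (c : N) :
    sideSign (w j) * x w j c = sideSign (w' j) * x w' j c := by
  rw [hx j w w' h]
  cases w j <;> cases w' j <;> simp [sideSign]

theorem card_filter_le_add (D r : ℕ) (hr : r ≤ D) :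
    (Finset.univ.filter fun q : Fin D => D ≤ r + q.1).card = r := by
  have h : (Finset.univ.filter fun q : Fin D => ¬ D ≤ r + q.1).card = D - r := by
    have h1 : (Finset.univ.filter fun q : Fin D => q.1 < D - r).card = D - r := by
      rw [Fin.card_filter_val_lt, min_eq_right (Nat.sub_le _ _)]
    rw [← h1]
    congr 1
    ext q
    simp only [Finset.mem_filter, Finset.mem_univ, true_and]
    omega
  have h2 := Finset.card_filter_add_card_filter_not (s := Finset.univ)
    (fun q : Fin D => D ≤ r + q.1)
  rw [Finset.card_univ, Fintype.card_fin] at h2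
  omega

/-- An order of the coordinates of the label space. -/
noncomputable def coordEquiv (k m : ℕ) : Node k × Fin m ≃ Fin (Fintype.card (Node k) * m) :=
  Fintype.equivFinOfCardEq (by simp)

/-- The node data of the standard flag. -/
noncomputable def stdNode (k m : ℕ) (M : ℤ) (r : ℕ) (n : Node k) : Fin (m + 1) → ℤ :=
  Fin.cons M fun i => if Fintype.card (Node k) * m ≤ r + (coordEquiv k m (n, i)).1 then 1 else 0

/-- The standard flag, the only zero of the test labelling up to symmetry. -/
noncomputable def stdFlag (k m : ℕ) (M : ℤ) (hM0 : 0 < M)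
    (r : Fin (Fintype.card (Node k) * m + 1)) : TreeCell k m M :=
  ⟨fun v j c => sideSign (v j) * stdNode k m M r.1 ⟦(v, j)⟧ c, compat_sideSign _, fun w j => by
    have habs : ∀ x : ℤ, |sideSign (w j) * x| = |x| := fun x => by
      cases w j <;> simp [sideSign]
    constructor
    · intro c
      rw [habs]
      refine Fin.cases ?_ (fun i => ?_) c
      · simp [stdNode, abs_of_pos hM0]
      · simp only [stdNode, Fin.cons_succ]
        split_ifs <;> simp <;> omega
    · exact ⟨0, by rw [habs]; simp [stdNode, abs_of_pos hM0]⟩⟩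

theorem cellRank_eq_card (hM : Even M) {x : TreeCell k m M} (h0 : ∀ w j, |x.1 w j 0| = M) :
    cellRank x.1 = (Finset.univ.filter fun q => Odd (x.1 ((coordEquiv k m).symm q).1.out.1
      ((coordEquiv k m).symm q).1.out.2 ((coordEquiv k m).symm q).2.succ)).card := by
  rw [Finset.card_filter, (coordEquiv k m).symm.sum_comp
    (fun p : Node k × Fin m => if Odd (x.1 p.1.out.1 p.1.out.2 p.2.succ) then 1 else 0),
    Fintype.sum_prod_type]
  unfold cellRank
  refine Finset.sum_congr rfl fun n _ => ?_
  rw [oddCount_eq_sum, Fin.sum_univ_succ, if_neg, zero_add]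
  rw [Int.not_odd_iff_even, ← even_abs, h0]
  exact hM

theorem stdFlag_leading (hM0 : 0 < M) (r : Fin (Fintype.card (Node k) * m + 1)) (w j) :
    (stdFlag k m M hM0 r).1 w j 0 = sideSign (w j) * M := by
  simp [stdFlag, stdNode]

theorem stdFlag_succ (hM0 : 0 < M) (r : Fin (Fintype.card (Node k) * m + 1)) (w j) (i : Fin m) :
    (stdFlag k m M hM0 r).1 w j i.succ = sideSign (w j) *
      if Fintype.card (Node k) * m ≤ r.1 + (coordEquiv k m (⟦(w, j)⟧, i)).1 then 1 else 0 := by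
  simp [stdFlag, stdNode]

theorem signBranch_of_leading (hM0 : 0 < M) {y : Fin k → Fin (m + 1) → ℤ} {w : Fin k → Bool}
    (h : ∀ j, y j 0 = sideSign (w j) * M) : signBranch y = w := by
  ext j
  unfold signBranch
  rw [h]
  cases w j <;> simp [sideSign] <;> omega

theorem abs_sideSign_mul (b : Bool) (x : ℤ) : |sideSign b * x| = |x| := by
  cases b <;> simp [sideSign]

theorem isFlag_stdFlag (hM : Even M) (hM0 : 0 < M) : IsFlag (stdFlag k m M hM0) := by
  constructor
  · intro r
    rw [cellRank_eq_card hM, ← card_filter_le_add (Fintype.card (Node k) * m) r.1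
      (Nat.le_of_lt_succ r.2)]
    · congr 1
      ext q
      simp only [Finset.mem_filter, Finset.mem_univ, true_and, stdFlag_succ, odd_sideSign_mul]
      have : (⟦(((coordEquiv k m).symm q).1.out.1, ((coordEquiv k m).symm q).1.out.2)⟧ : Node k)
        = ((coordEquiv k m).symm q).1 := Quotient.out_eq _
      rw [this, Prod.mk.eta, Equiv.apply_symm_apply]
      split_ifs with h <;> simp [h]
    · intro w j
      rw [stdFlag_leading, abs_sideSign_mul, abs_of_pos hM0]
  · intro r r' h w j c
    refine Fin.cases ?_ (fun i => ?_) c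
    · rw [stdFlag_leading, stdFlag_leading]; exact Or.inl rfl
    · rw [stdFlag_succ, stdFlag_succ]
      rw [Fin.le_def] at h
      by_cases h1 : Fintype.card (Node k) * m ≤ r.1 + (coordEquiv k m (⟦(w, j)⟧, i)).1
      · rw [if_pos h1, if_pos (by omega)]; exact Or.inl rfl
      · rw [if_neg h1]
        split_ifs with h2
        · refine Or.inr ⟨?_, ?_⟩
          · rw [odd_sideSign_mul]; exact odd_one
          · rw [mul_zero, sub_zero, abs_sideSign_mul]; simp
        · exact Or.inl rfl

/-- The slopes of the test labelling. -/
noncomputable def testSlope (k m : ℕ) (q : Node k × Fin m) : ℝ :=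
  (((coordEquiv k m q).1 : ℝ) + 1) / (((Fintype.card (Node k) * m : ℕ) : ℝ) + 1)

theorem testSlope_mem (q : Node k × Fin m) : 0 < testSlope k m q ∧ testSlope k m q < 1 := by
  have h := (coordEquiv k m q).2
  have h' : ((coordEquiv k m q).1 : ℝ) < ((Fintype.card (Node k) * m : ℕ) : ℝ) := by
    exact_mod_cast h
  unfold testSlope
  refine ⟨by positivity, ?_⟩
  rw [div_lt_one (by positivity)]
  linarith

theorem eq_stdFlag (hM : Even M) (hM0 : 0 < M)
    {t : Fin (Fintype.card (Node k) * m + 1) → TreeCell k m M} (ht : IsFlag t)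
    {a : Fin (Fintype.card (Node k) * m + 1) → ℝ} (ha : ∀ r, 0 ≤ a r) (hS : 0 < ∑ r, a r)
    (hz : ∑ r, a r • testLabel (testSlope k m) (t r) = 0) (hsign : ∀ w, signBranch ((t 0).1 w) = w) :
    t = stdFlag k m M hM0 ∧ ∀ r, 0 < a r := by
  have hlead : ∀ r w j, (t r).1 w j 0 = sideSign (w j) * M := by
    intro r w j
    obtain ⟨h1, h2⟩ := leading_const hM hM0 testSlope_mem ht ha hS hz w j.1 j.2
    rw [Fin.eta] at h1 h2
    rw [h2 r]
    have h3 : decide ((t 0).1 w j 0 < 0) = w j := congrFun (hsign w) j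
    cases hw : w j with
    | true =>
      rw [hw, decide_eq_true_iff] at h3
      rw [abs_of_neg h3] at h1
      simp [sideSign]; omega
    | false =>
      rw [hw, decide_eq_false_iff_not] at h3
      rw [abs_of_nonneg (not_lt.1 h3)] at h1
      simp [sideSign]; omega
  have hsign' : ∀ r w, signBranch ((t r).1 w) = w :=
    fun r w => signBranch_of_leading hM0 (hlead r w)
  have habs : ∀ r w j, |(t r).1 w j 0| = M := fun r w j => by
    rw [hlead, abs_sideSign_mul, abs_of_pos hM0]
  set e := coordEquiv k m with he
  set z : Fin (Fintype.card (Node k) * m + 1) → Fin (Fintype.card (Node k) * m) → ℤ := fun r q =>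
    sideSign ((e.symm q).1.out.1 (e.symm q).1.out.2) *
      (t r).1 (e.symm q).1.out.1 (e.symm q).1.out.2 (e.symm q).2.succ with hzdef
  have hMR : (M : ℝ) ≠ 0 := by exact_mod_cast hM0.ne'
  have hrigid := flag_rigid z ?_ ?_ a ha hS ?_
  · refine ⟨?_, hrigid.2⟩
    funext r
    refine Subtype.ext (funext fun w => funext fun j => funext fun c => ?_)
    refine Fin.cases ?_ (fun i => ?_) c
    · rw [hlead, stdFlag_leading]
    · rw [stdFlag_succ]
      have h1 := hrigid.1 r (e (⟦(w, j)⟧, i))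
      rw [← h1]
      simp only [hzdef, Equiv.symm_apply_apply]
      have h2 := node_out w j
      rw [h2.1, ← (t r).2.1.sideSign_mul h2.2, ← mul_assoc, sideSign_mul_self, one_mul]
  · intro i i' hi q
    rcases ht.2 i i' hi (e.symm q).1.out.1 (e.symm q).1.out.2 (e.symm q).2.succ with h | ⟨h1, h2⟩
    · exact Or.inl (by simp only [hzdef, h])
    · refine Or.inr ⟨?_, ?_⟩
      · simp only [hzdef, odd_sideSign_mul]; exact h1
      · simp only [hzdef]; rw [← mul_sub, abs_sideSign_mul, h2]
  · intro r
    rw [← ht.1 r, cellRank_eq_card hM (habs r)]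
    simp only [hzdef, odd_sideSign_mul, he]
  · intro q
    have h1 := congrFun (congrFun (congrFun (congrArg Subtype.val hz) (e.symm q).1.out.1)
      (e.symm q).1.out.2) (e.symm q).2
    have h2 : (⟦((e.symm q).1.out.1, (e.symm q).1.out.2)⟧ : Node k) = (e.symm q).1 :=
      Quotient.out_eq _
    simp only [testLabel, testRow, AddSubmonoidClass.coe_finsetSum, Submodule.coe_smul,
      Finset.sum_apply, Pi.smul_apply, smul_eq_mul, ZeroMemClass.coe_zero, Pi.zero_apply, hsign',
      h2, hlead, mul_sub, Finset.sum_sub_distrib, ← Finset.sum_mul] at h1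
    rw [sub_eq_zero] at h1
    have h3 : testSlope k m ((e.symm q).1, (e.symm q).2) = ((q.1 : ℝ) + 1) /
        (((Fintype.card (Node k) * m : ℕ) : ℝ) + 1) := by
      rw [Prod.mk.eta, testSlope, ← he, Equiv.apply_symm_apply]
    rw [h3] at h1
    set b := (e.symm q).1.out.1 (e.symm q).1.out.2
    have hb : (sideSign b : ℝ) * sideSign b = 1 := by exact_mod_cast sideSign_mul_self b
    simp only [hzdef]
    push_cast at h1 ⊢
    calc _ = (sideSign b : ℝ) * ∑ r, a r *
          ((t r).1 (e.symm q).1.out.1 (e.symm q).1.out.2 (e.symm q).2.succ : ℝ) := by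
          rw [Finset.mul_sum]
          exact Finset.sum_congr rfl fun r _ => by ring
      _ = _ := by
          rw [h1]
          have h4 : ∀ σ A T : ℝ, σ * (A * (T / M * (σ * M))) = σ * σ * (T * A) := by
            intro σ A T
            field_simp
          rw [h4, hb, one_mul]

end StandardFlag

section TestZeros

variable {k m : ℕ} {M : ℤ}

theorem agree_signBranch (hM0 : 0 < M) {x : TreeCell k m M} (hx : ∀ w j, |x.1 w j 0| = M) (j : ℕ)
    (w w' : Fin k → Bool) :
    Agree j (signBranch (x.1 w)) (signBranch (x.1 w')) ↔ Agree j w w' := by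
  induction j with
  | zero => exact ⟨fun _ i hi => absurd hi (Nat.not_lt_zero _), fun _ i hi => absurd hi (Nat.not_lt_zero _)⟩
  | succ j ih =>
    by_cases hj : j < k
    · have e := fun v v' : Fin k → Bool => agree_succ_iff (j := ⟨j, hj⟩) (w := v) (w' := v')
      simp only at e
      rw [e, e, ih]
      refine and_congr_right fun h => ?_
      have h1 := x.2.1 ⟨j, hj⟩ w w' h
      have h2 := hx w ⟨j, hj⟩
      have h3 : x.1 w ⟨j, hj⟩ 0 ≠ 0 := by
        intro h3; rw [h3] at h2; simp at h2; omega
      simp only [signBranch, h1]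
      by_cases hw : w ⟨j, hj⟩ = w' ⟨j, hj⟩
      · simp [hw]
      · simp only [hw, if_false, iff_false, Pi.neg_apply, decide_eq_decide]
        omega
    · have e : ∀ v v' : Fin k → Bool, Agree (j + 1) v v' ↔ Agree j v v' := fun v v' =>
        ⟨fun h => h.mono (Nat.le_succ _), fun h i hi => h i (by have := i.2; omega)⟩
      rw [e, e, ih]

theorem exists_signPerm (hM0 : 0 < M) {x : TreeCell k m M} (hx : ∀ w j, |x.1 w j 0| = M) :
    ∃ g : treeGroup k, ∀ w, g.1 w = signBranch (x.1 w) := by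
  have hinj : Function.Injective fun w => signBranch (x.1 w) := by
    intro w w' h
    have := (agree_signBranch hM0 hx k w w').1 (fun i _ => congrFun h i)
    exact funext fun i => this i i.2
  refine ⟨⟨Equiv.ofBijective _ (Function.Injective.bijective_of_finite hinj), ?_⟩, fun w => rfl⟩
  intro j w w'
  exact agree_signBranch hM0 hx j w w'

theorem IsFlag.smul {D : ℕ} {s : Fin (D + 1) → TreeCell k m M} (hs : IsFlag s) (g : treeGroup k) :
    IsFlag fun i => g • s i :=
  ⟨fun i => by rw [cellRank_smul]; exact hs.1 i, fun i i' h _ j => hs.2 i i' h _ j⟩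

theorem testLabel_zero (hM : Even M) (hM0 : 0 < M)
    {s : Fin (Fintype.card (Node k) * m + 1) → TreeCell k m M} (hs : IsFlag s)
    {a : Fin (Fintype.card (Node k) * m + 1) → ℝ} (ha : ∀ r, 0 ≤ a r) (hne : a ≠ 0)
    (hz : ∑ r, a r • testLabel (testSlope k m) (s r) = 0) :
    (∃ g : treeGroup k, s = fun r => g • stdFlag k m M hM0 r) ∧ ∀ r, 0 < a r := by
  have hS : 0 < ∑ r, a r := by
    obtain ⟨i, hi⟩ := Function.ne_iff.1 hne
    exact Finset.sum_pos' (fun r _ => ha r) ⟨i, Finset.mem_univ _, lt_of_le_of_ne (ha i) (Ne.symm hi)⟩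
  obtain ⟨g, hg⟩ := exists_signPerm hM0 (x := s 0)
    (fun w j => (leading_const hM hM0 testSlope_mem hs ha hS hz w j.1 j.2).1)
  obtain ⟨h1, h2⟩ := eq_stdFlag hM hM0 (hs.smul g) ha hS (by
    have := congrArg (labelRep k m g) hz
    rw [map_sum, map_zero] at this
    rw [← this]
    refine Finset.sum_congr rfl fun r _ => ?_
    rw [map_smul]; rfl) (by
    intro w
    rw [treeCell_smul_val, ← hg]
    exact Equiv.apply_symm_apply g.1 w)
  refine ⟨⟨g⁻¹, ?_⟩, h2⟩
  rw [← h1]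
  simp

theorem sum_ite_le_add (D : ℕ) (q : Fin D) :
    (∑ r : Fin (D + 1), if D ≤ r.1 + q.1 then (1 : ℝ) else 0) = (q.1 : ℝ) + 1 := by
  have h2 : ((Finset.univ : Finset (Fin (D + 1))).filter fun r => D ≤ r.1 + q.1) =
      Finset.Ici ⟨D - q.1, by omega⟩ := by
    ext r
    simp only [Finset.mem_filter, Finset.mem_univ, true_and, Finset.mem_Ici, Fin.le_def]
    omega
  have h3 := q.2
  have h4 : D + 1 - (D - q.1) = q.1 + 1 := by omega
  rw [Finset.sum_boole, h2, Fin.card_Ici, h4]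
  push_cast
  rfl

theorem stdFlag_zero (hM0 : 0 < M) : ∑ r, testLabel (testSlope k m) (stdFlag k m M hM0 r) = 0 := by
  refine Subtype.ext (funext fun w => funext fun j => funext fun i => ?_)
  have hs : ∀ r, signBranch ((stdFlag k m M hM0 r).1 w) = w := fun r =>
    signBranch_of_leading hM0 (fun j => stdFlag_leading hM0 r w j)
  simp only [testLabel, testRow, AddSubmonoidClass.coe_finsetSum, Finset.sum_apply,
    ZeroMemClass.coe_zero, Pi.zero_apply, hs, stdFlag_leading, stdFlag_succ,
    Finset.sum_sub_distrib]
  have hMR : (M : ℝ) ≠ 0 := by exact_mod_cast hM0.ne'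
  have hD1 : ((Fintype.card (Node k) * m : ℕ) : ℝ) + 1 ≠ 0 := by positivity
  push_cast
  rw [← Finset.mul_sum, sum_ite_le_add, Finset.sum_const, Finset.card_univ, Fintype.card_fin,
    nsmul_eq_mul, testSlope]
  push_cast at hD1 ⊢
  field_simp
  ring

theorem nondeg_testLabel (hM : Even M) (hM0 : 0 < M) (hd : 0 < Fintype.card (Node k) * m) :
    (treeSystem k m M hM hM0 hd).Nondeg (testLabel (testSlope k m)) := by
  rintro s hs j ⟨a, ha, hne, hj, hz⟩
  have := (testLabel_zero hM hM0 ((mem_treeSystem s).1 hs) ha hne hz).2 j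
  rw [hj j (by simp)] at this
  exact lt_irrefl _ this

theorem zeros_testLabel (hM : Even M) (hM0 : 0 < M) (hd : 0 < Fintype.card (Node k) * m) :
    (treeSystem k m M hM hM0 hd).zeros (testLabel (testSlope k m)) =
      Fintype.card (treeGroup k) := by
  classical
  unfold ChainSystem.zeros
  rw [← Finset.card_univ (α := treeGroup k)]
  symm
  have hstd := (mem_treeSystem (hM := hM) (hM0 := hM0) (hd := hd) _).2
    (isFlag_stdFlag (k := k) (m := m) hM hM0)
  refine Finset.card_bij (fun g _ => fun r => g • stdFlag k m M hM0 r) ?_ ?_ ?_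
  · intro g _
    rw [Finset.mem_filter]
    refine ⟨(treeSystem k m M hM hM0 hd).smul_mem g _ hstd, ?_⟩
    refine (testLabel_equivariant (testSlope k m)).zeroOn_smul g
      ⟨fun _ => 1, fun _ => zero_le_one, ?_, fun i hi => absurd (Set.mem_univ i) hi, ?_⟩
    · intro h
      exact one_ne_zero (congrFun h 0)
    · simp only [one_smul]
      exact stdFlag_zero hM0
  · intro g _ g' _ h
    have h1 := congrFun h 0
    have : (g'⁻¹ * g) • stdFlag k m M hM0 0 = stdFlag k m M hM0 0 := by
      rw [mul_smul, h1, inv_smul_smul]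
    have := treeCell_free hM0 _ _ this
    rw [inv_mul_eq_one] at this
    exact this.symm
  · intro s hs
    rw [Finset.mem_filter] at hs
    obtain ⟨a, ha, hne, -, hz⟩ := hs.2
    obtain ⟨g, hg⟩ := (testLabel_zero hM hM0 ((mem_treeSystem s).1 hs.1) ha hne hz).1
    exact ⟨g, Finset.mem_univ _, hg.symm⟩

theorem exists_flag_approx_zero (hM : Even M) (hM0 : 0 < M) (hd : 0 < Fintype.card (Node k) * m)
    {F : TreeCell k m M → labelSpace k m} (hF : ChainSystem.Equivariant (labelRep k m) F) {ε : ℝ}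
    (hε : 0 < ε) : ∃ s : Fin (Fintype.card (Node k) * m + 1) → TreeCell k m M, IsFlag s ∧
      ∃ c : Fin (Fintype.card (Node k) * m + 1) → ℝ, (∀ i, 0 ≤ c i) ∧ ∑ i, c i = 1 ∧
        ‖∑ i, c i • F (s i)‖ ≤ ε := by
  obtain ⟨s, hs, h⟩ := (treeSystem k m M hM hM0 hd).exists_approx_zero (labelRep k m)
    (finrank_labelSpace k m) (testLabel_equivariant (testSlope k m)) hF
    (nondeg_testLabel hM hM0 hd) (zeros_testLabel hM hM0 hd) hε
  exact ⟨s, (mem_treeSystem s).1 hs, h⟩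

end TestZeros

section TreeBorsukUlam

variable {k m : ℕ}

open Classical in
/-- The differences, over all nodes of the tree, of the sums of `G` over the two sides. -/
noncomputable def nodeDiff (G : (Fin k → Bool) → Fin m → ℝ) : (Fin k → Bool) → Fin k → Fin m → ℝ :=
  fun w j => ∑ v, if Agree j.1 v w then (if v j = w j then G v else -G v) else 0

theorem nodeDiff_compat (G : (Fin k → Bool) → Fin m → ℝ) : Compat (nodeDiff G) := by
  intro j w w' h
  have h1 : ∀ v, Agree j.1 v w' ↔ Agree j.1 v w := fun v =>
    ⟨fun h' => h'.trans h.symm, fun h' => h'.trans h⟩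
  unfold nodeDiff
  split_ifs with hw
  · refine Finset.sum_congr rfl fun v _ => ?_
    by_cases hv : Agree j.1 v w
    · rw [if_pos hv, if_pos ((h1 v).2 hv), hw]
    · rw [if_neg hv, if_neg (mt (h1 v).1 hv)]
  · rw [← Finset.sum_neg_distrib]
    refine Finset.sum_congr rfl fun v _ => ?_
    by_cases hv : Agree j.1 v w
    · rw [if_pos hv, if_pos ((h1 v).2 hv)]
      cases e1 : v j <;> cases e2 : w j <;> cases e3 : w' j <;> simp_all
    · rw [if_neg hv, if_neg (mt (h1 v).1 hv), neg_zero]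

theorem nodeDiff_smul (G : (Fin k → Bool) → Fin m → ℝ) (g : treeGroup k) (w : Fin k → Bool) :
    nodeDiff (fun v => G (g⁻¹.1 v)) w = nodeDiff G (g⁻¹.1 w) := by
  funext j
  classical
  simp only [nodeDiff]
  refine Eq.trans ?_ (Equiv.sum_comp (g⁻¹.1) fun v => if Agree j.1 v (g⁻¹.1 w) then
    (if v j = (g⁻¹.1 w) j then G v else -G v) else 0)
  refine Finset.sum_congr rfl fun v _ => ?_
  by_cases hv : Agree j.1 v w
  · have hv' := (treeGroup_inv_agree g j.1 v w).2 hv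
    rw [if_pos hv, if_pos hv']
    have h2 := treeGroup_inv_agree g (j.1 + 1) v w
    rw [agree_succ_iff, agree_succ_iff] at h2
    have h3 : (g⁻¹.1 v) j = (g⁻¹.1 w) j ↔ v j = w j :=
      ⟨fun h4 => (h2.1 ⟨hv', h4⟩).2, fun h4 => (h2.2 ⟨hv, h4⟩).2⟩
    simp only [h3]
  · have hv' := mt (treeGroup_inv_agree g j.1 v w).1 hv
    rw [if_neg hv, if_neg hv']

theorem eq_of_nodeDiff_eq_zero {G : (Fin k → Bool) → Fin m → ℝ} (h : nodeDiff G = 0)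
    (w w' : Fin k → Bool) : G w = G w' := by
  classical
  have key : ∀ w : Fin k → Bool, ∀ j, j ≤ k →
      ∑ v, G v = (2 : ℝ) ^ j • ∑ v, if Agree j v w then G v else 0 := by
    intro w j
    induction j with
    | zero =>
      intro _
      have : ∀ v : Fin k → Bool, Agree 0 v w := fun v i hi => absurd hi (Nat.not_lt_zero _)
      simp [this]
    | succ j ih =>
      intro hj
      rw [ih (by omega), pow_succ, mul_smul]
      congr 1
      have h1 := congrFun (congrFun h w) ⟨j, hj⟩
      simp only [nodeDiff, Pi.zero_apply] at h1
      rw [two_smul, eq_comm, ← sub_eq_zero]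
      refine Eq.trans ?_ h1
      rw [← Finset.sum_add_distrib, ← Finset.sum_sub_distrib]
      refine Finset.sum_congr rfl fun v _ => ?_
      have h2 : Agree (j + 1) v w ↔ Agree j v w ∧ v ⟨j, hj⟩ = w ⟨j, hj⟩ :=
        agree_succ_iff (j := ⟨j, hj⟩)
      rw [h2]
      by_cases h3 : Agree j v w <;> by_cases h4 : v ⟨j, hj⟩ = w ⟨j, hj⟩ <;> simp [h3, h4]
  have hk : ∀ w : Fin k → Bool, ∑ v, G v = (2 : ℝ) ^ k • G w := by
    intro w
    rw [key w k le_rfl]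
    congr 1
    rw [Finset.sum_eq_single w]
    · rw [if_pos]; exact fun _ _ => rfl
    · intro v _ hv
      rw [if_neg]
      exact fun h => hv (funext fun i => h i i.2)
    · simp
  have h2 := (hk w).symm.trans (hk w')
  exact smul_right_injective _ (by positivity : (2 : ℝ) ^ k ≠ 0) h2

/-- Simultaneous Borsuk--Ulam theorem over a binary tree: vectors of unit length can be chosen at
the nodes of the tree such that a continuous function of the signed vectors along a branch takes
the same value at all branches. -/
theorem tree_borsukUlam (hm : 0 < m) (g : (Fin k → Fin (m + 1) → ℝ) → Fin m → ℝ)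
    (hg : ContinuousOn g {u | ∀ j, ‖u j‖ = 1}) :
    ∃ x : (Fin k → Bool) → Fin k → Fin (m + 1) → ℝ, Compat x ∧ (∀ w j, ‖x w j‖ = 1) ∧
      ∀ w w', g (x w) = g (x w') := by
  rcases Nat.eq_zero_or_pos k with rfl | hk
  · exact ⟨fun _ j => j.elim0, fun j => j.elim0, fun _ j => j.elim0,
      fun w w' => by rw [Subsingleton.elim w w']⟩
  have hd : 0 < Fintype.card (Node k) * m :=
    Nat.mul_pos (Fintype.card_pos_iff.2 ⟨⟦(fun _ => true, ⟨0, hk⟩)⟧⟩) hm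
  set X : Set ((Fin k → Bool) → Fin k → Fin (m + 1) → ℝ) := {x | Compat x ∧ ∀ w j, ‖x w j‖ = 1}
    with hX
  set Φ : ((Fin k → Bool) → Fin k → Fin (m + 1) → ℝ) → (Fin k → Bool) → Fin k → Fin m → ℝ :=
    fun x => nodeDiff fun w => g (x w) with hΦ
  suffices ∃ x ∈ X, Φ x = 0 by
    obtain ⟨x, hx, h0⟩ := this
    exact ⟨x, hx.1, hx.2, eq_of_nodeDiff_eq_zero h0⟩
  have hXc : IsCompact X := by
    refine Metric.isCompact_of_isClosed_isBounded ?_ ?_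
    · have h1 : X = (⋂ (j : Fin k) (w : Fin k → Bool) (w' : Fin k → Bool) (_ : Agree j.1 w w'),
          {x | x w' j = if w j = w' j then x w j else -x w j}) ∩ ⋂ (w) (j), {x | ‖x w j‖ = 1} := by
        ext x
        simp [hX, Compat]
      rw [h1]
      refine IsClosed.inter ?_ ?_
      · refine isClosed_iInter fun j => isClosed_iInter fun w => isClosed_iInter fun w' =>
          isClosed_iInter fun _ => isClosed_eq (by fun_prop) ?_
        split_ifs <;> fun_prop
      · exact isClosed_iInter fun w => isClosed_iInter fun j =>
          isClosed_eq (by fun_prop) continuous_const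
    · refine (Metric.isBounded_iff_subset_closedBall 0).2 ⟨1, fun x hx => ?_⟩
      rw [mem_closedBall_zero_iff, pi_norm_le_iff_of_nonneg zero_le_one]
      intro w
      rw [pi_norm_le_iff_of_nonneg zero_le_one]
      exact fun j => (hx.2 w j).le
  have hΦc : ContinuousOn Φ X := by
    have h1 : ∀ v, ContinuousOn (fun x : (Fin k → Bool) → Fin k → Fin (m + 1) → ℝ => g (x v)) X :=
      fun v => hg.comp (by fun_prop) fun x hx => hx.2 v
    refine continuousOn_pi.2 fun w => continuousOn_pi.2 fun j => ?_
    simp only [hΦ, nodeDiff]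
    refine continuousOn_finsetSum _ fun v _ => ?_
    split_ifs
    · exact h1 v
    · exact (h1 v).neg
    · exact continuousOn_const
  by_contra! hne
  have hcell : ∀ {M : ℤ}, 0 < M → ∀ x : TreeCell k m M, (fun w j c => (x.1 w j c : ℝ) / M) ∈ X := by
    intro M hM x
    have hMR : (0 : ℝ) < M := by exact_mod_cast hM
    constructor
    · intro j w w' h
      ext c
      simp only [x.2.1 j w w' h]
      split_ifs
      · rfl
      · simp [neg_div]
    · intro w j
      apply le_antisymm
      · rw [pi_norm_le_iff_of_nonneg zero_le_one]
        intro c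
        rw [Real.norm_eq_abs, abs_div, abs_of_pos hMR, div_le_one hMR]
        exact_mod_cast (x.2.2 w j).1 c
      · obtain ⟨c, hc⟩ := (x.2.2 w j).2
        refine le_trans (le_of_eq ?_) (norm_le_pi_norm _ c)
        rw [Real.norm_eq_abs, abs_div, abs_of_pos hMR, eq_comm, div_eq_one_iff_eq hMR.ne']
        exact_mod_cast hc
  have hXn : X.Nonempty := by
    refine ⟨_, hcell (M := 2) (by norm_num) ⟨unfoldNode fun _ _ => 2, unfoldNode_compat _, ?_⟩⟩
    intro w j
    unfold unfoldNode
    split_ifs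
    · exact ⟨fun c => by simp, 0, by simp⟩
    · exact ⟨fun c => by simp, 0, by simp⟩
  obtain ⟨x₀, hx₀, hmin⟩ := hXc.exists_isMinOn hXn hΦc.norm
  set ε := ‖Φ x₀‖ / 4 with hε
  have hε0 : 0 < ε := by have := norm_pos_iff.2 (hne x₀ hx₀); positivity
  have huc := hXc.uniformContinuousOn_of_continuous hΦc
  rw [Metric.uniformContinuousOn_iff] at huc
  obtain ⟨δ, hδ, huc⟩ := huc ε hε0
  obtain ⟨N, hN⟩ := exists_nat_gt (1 / δ)
  have hN0 : 0 < (N : ℝ) := lt_trans (by positivity) hN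
  have hN0' : 0 < N := by exact_mod_cast hN0
  set M : ℤ := 2 * N with hM
  have hM0 : 0 < M := by omega
  have hMR : (0 : ℝ) < M := by exact_mod_cast hM0
  set F : TreeCell k m M → labelSpace k m := fun x =>
    ⟨Φ fun w j c => (x.1 w j c : ℝ) / M, nodeDiff_compat _⟩ with hF
  have hFe : ChainSystem.Equivariant (labelRep k m) F := by
    intro γ x
    refine Subtype.ext (funext fun w => ?_)
    exact nodeDiff_smul (fun w => g fun j c => (x.1 w j c : ℝ) / M) γ w
  obtain ⟨s, hs, c, hc0, hc1, hc⟩ := exists_flag_approx_zero (even_two_mul (N : ℤ)) hM0 hd hFe hε0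
  have hclose : ∀ i, ‖F (s i) - F (s 0)‖ ≤ ε := by
    intro i
    have h1 := huc _ (hcell hM0 (s i)) _ (hcell hM0 (s 0)) (by
      rw [dist_pi_lt_iff hδ]; intro w
      rw [dist_pi_lt_iff hδ]; intro j
      rw [dist_pi_lt_iff hδ]; intro c
      rw [Real.dist_eq, ← sub_div, abs_div, abs_of_pos hMR, div_lt_iff₀ hMR]
      have h2 : |(s i).1 w j c - (s 0).1 w j c| ≤ 1 := by
        rcases hs.2 0 i (Fin.zero_le i) w j c with h | ⟨-, h⟩
        · rw [h]; simp
        · exact h.le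
      have h3 : |((s i).1 w j c : ℝ) - (s 0).1 w j c| ≤ 1 := by exact_mod_cast h2
      refine h3.trans_lt ?_
      rw [div_lt_iff₀ hδ] at hN
      have : (M : ℝ) = 2 * N := by simp [hM]
      rw [this]
      nlinarith)
    rw [dist_eq_norm] at h1
    exact h1.le
  have h1 : ‖F (s 0)‖ ≤ 2 * ε := by
    have h2 : F (s 0) = ∑ i, c i • F (s i) - ∑ i, c i • (F (s i) - F (s 0)) := by
      simp only [smul_sub, Finset.sum_sub_distrib, ← Finset.sum_smul, hc1, one_smul]
      abel
    rw [h2]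
    refine (norm_sub_le _ _).trans ?_
    have h3 : ‖∑ i, c i • (F (s i) - F (s 0))‖ ≤ ε := by
      refine (norm_sum_le _ _).trans ?_
      calc _ ≤ ∑ i, c i * ε := Finset.sum_le_sum fun i _ => by
            rw [norm_smul, Real.norm_of_nonneg (hc0 i)]
            exact mul_le_mul_of_nonneg_left (hclose i) (hc0 i)
        _ = ε := by rw [← Finset.sum_mul, hc1, one_mul]
    linarith
  have h2 : ‖Φ x₀‖ ≤ ‖F (s 0)‖ := hmin (hcell hM0 (s 0))
  linarith

end TreeBorsukUlam

open MeasureTheory Pointwise in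
theorem volume_add_volume_le_of_midpoint {A B C : Set ℝ} (hA : MeasurableSet A)
    (hB : MeasurableSet B) (hAn : A.Nonempty) (hBn : B.Nonempty)
    (h : ∀ a ∈ A, ∀ b ∈ B, (a + b) / 2 ∈ C) :
    volume A + volume B ≤ 2 * volume C := by
  have key : ∀ K L : Set ℝ, IsCompact K → IsCompact L → K.Nonempty → L.Nonempty → K ⊆ A →
      L ⊆ B → volume K + volume L ≤ 2 * volume C := by
    intro K L hK hL hKn hLn hKA hLB
    obtain ⟨a, haK, ha⟩ := hK.exists_isGreatest hKn
    obtain ⟨b, hbL, hb⟩ := hL.exists_isLeast hLn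
    set K' : Set ℝ := (fun x => (1 / 2 : ℝ) * x + b / 2) '' K with hK'
    set L' : Set ℝ := (fun x => (1 / 2 : ℝ) * x + a / 2) '' L with hL'
    have hsc : ∀ (c : ℝ) (S : Set ℝ),
        2 * volume ((fun x => (1 / 2 : ℝ) * x + c) '' S) = volume S := by
      intro c S
      have : (fun x => (1 / 2 : ℝ) * x + c) '' S = (fun x => x + c) '' ((fun x => (1 / 2 : ℝ) • x) '' S) := by
        rw [Set.image_image]; simp
      rw [this, Set.image_add_right, measure_preimage_add_right, Set.image_smul, Measure.addHaar_smul]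
      rw [← mul_assoc]
      have h2 : (2 : ℝ≥0∞) * ENNReal.ofReal |(1 / 2 : ℝ) ^ Module.finrank ℝ ℝ| = 1 := by
        rw [Module.finrank_self, pow_one, abs_of_pos (by norm_num)]
        rw [show (2 : ℝ≥0∞) = ENNReal.ofReal 2 by simp, ← ENNReal.ofReal_mul (by norm_num)]
        norm_num
      rw [h2, one_mul]
    have hKc : MeasurableSet K' := (hK.image (by fun_prop)).measurableSet
    have hintegrable : volume (K' ∩ L') = 0 := by
      apply measure_mono_null (t := {(a + b) / 2}) _ (by simp)
      rintro _ ⟨⟨x, hx, rfl⟩, ⟨y, hy, hxy⟩⟩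
      have h1 := ha hx
      have h2 := hb hy
      simp only [Set.mem_singleton_iff] at hxy ⊢
      linarith
    have hsub : K' ∪ L' ⊆ C := by
      rintro _ (⟨x, hx, rfl⟩ | ⟨x, hx, rfl⟩)
      · have := h x (hKA hx) b (hLB hbL)
        convert this using 1; ring
      · have := h a (hKA haK) x (hLB hx)
        convert this using 1; ring
    have := measure_union_add_inter' (μ := volume) hKc L'
    rw [hintegrable, add_zero] at this
    calc volume K + volume L = 2 * volume K' + 2 * volume L' := by rw [hK', hL', hsc, hsc]
      _ = 2 * volume (K' ∪ L') := by rw [this, mul_add]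
      _ ≤ _ := by gcongr
  obtain ⟨a₀, ha₀⟩ := hAn
  obtain ⟨b₀, hb₀⟩ := hBn
  have key2 : ∀ K L : Set ℝ, IsCompact K → IsCompact L → K ⊆ A →
      L ⊆ B → volume K + volume L ≤ 2 * volume C := by
    intro K L hK hL hKA hLB
    refine le_trans ?_ (key (insert a₀ K) (insert b₀ L) (hK.insert _) (hL.insert _)
      (Set.insert_nonempty _ _) (Set.insert_nonempty _ _) (Set.insert_subset ha₀ hKA)
      (Set.insert_subset hb₀ hLB))
    gcongr <;> exact Set.subset_insert _ _
  rw [hA.measure_eq_iSup_isCompact, hB.measure_eq_iSup_isCompact]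
  simp_rw [iSup_and']
  exact ENNReal.biSup_add_biSup_le' ⟨∅, Set.empty_subset _, isCompact_empty⟩
    ⟨∅, Set.empty_subset _, isCompact_empty⟩ fun K hK L hL => key2 K L hK.2 hL.2 hK.1 hL.1

theorem ENNReal.four_mul_mul_le_sq_add (x y : ℝ≥0∞) : 4 * (x * y) ≤ (x + y) ^ 2 := by
  by_cases hx : x = ⊤
  · simp [hx]
  by_cases hy : y = ⊤
  · simp [hy]
  lift x to ℝ≥0 using hx
  lift y to ℝ≥0 using hy
  norm_cast
  rw [← NNReal.coe_le_coe]
  push_cast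
  nlinarith [sq_nonneg ((x : ℝ) - y)]

open MeasureTheory in
/-- The one-dimensional Prékopa–Leindler inequality for midpoints. -/
theorem lintegral_mul_lintegral_le_sq_of_midpoint {f g h : ℝ → ℝ} (hf : Measurable f)
    (hg : Measurable g) (hh : Measurable h) (hf0 : ∀ s, 0 ≤ f s) (hg0 : ∀ s, 0 ≤ g s)
    (hh0 : ∀ s, 0 ≤ h s) (hfb : BddAbove (Set.range f)) (hgb : BddAbove (Set.range g))
    (H : ∀ s t, f s * g t ≤ h ((s + t) / 2) ^ 2) :
    (∫⁻ s, ENNReal.ofReal (f s)) * (∫⁻ s, ENNReal.ofReal (g s)) ≤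
      (∫⁻ s, ENNReal.ofReal (h s)) ^ 2 := by
  set a := ⨆ s, f s with ha
  set b := ⨆ s, g s with hb
  have hfa : ∀ s, f s ≤ a := fun s => le_ciSup hfb s
  have hgb' : ∀ s, g s ≤ b := fun s => le_ciSup hgb s
  rcases (le_trans (hf0 0) (hfa 0)).eq_or_lt with ha0 | ha0
  · have : ∀ s, f s = 0 := fun s => le_antisymm (by rw [ha0]; exact hfa s) (hf0 s)
    simp [this]
  rcases (le_trans (hg0 0) (hgb' 0)).eq_or_lt with hb0 | hb0
  · have : ∀ s, g s = 0 := fun s => le_antisymm (by rw [hb0]; exact hgb' s) (hg0 s)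
    simp [this]
  set c := Real.sqrt (a * b) with hc
  have hc0 : 0 < c := Real.sqrt_pos.2 (mul_pos ha0 hb0)
  have hcc : c ^ 2 = a * b := Real.sq_sqrt (mul_pos ha0 hb0).le
  have layer : ∀ (φ : ℝ → ℝ) (d : ℝ), Measurable φ → (∀ s, 0 ≤ φ s) → 0 < d →
      ∫⁻ s, ENNReal.ofReal (φ s) =
        ENNReal.ofReal d * ∫⁻ t in Set.Ioi (0 : ℝ), volume {s | t < φ s / d} := by
    intro φ d hφ hφ0 hd
    rw [← lintegral_eq_lintegral_meas_lt volume
      (Eventually.of_forall fun s => div_nonneg (hφ0 s) hd.le) (by fun_prop),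
      ← lintegral_const_mul _ (by fun_prop)]
    congr 1
    ext s
    rw [← ENNReal.ofReal_mul hd.le]
    congr 1
    field_simp
  have hanti : ∀ φ : ℝ → ℝ, Measurable fun t : ℝ => volume {s | t < φ s} := fun φ => by
    apply Antitone.measurable
    intro t t' htt
    exact measure_mono fun s hs => lt_of_le_of_lt htt hs
  have hcut : ∀ (φ : ℝ → ℝ), (∀ s, φ s ≤ 1) →
      ∫⁻ t in Set.Ioi (0 : ℝ), volume {s | t < φ s} =
        ∫⁻ t in Set.Ioo (0 : ℝ) 1, volume {s | t < φ s} := by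
    intro φ hφ
    rw [← lintegral_indicator measurableSet_Ioi, ← lintegral_indicator measurableSet_Ioo]
    congr 1
    ext t
    by_cases h0 : 0 < t
    · by_cases h1 : t < 1
      · simp [h0, h1]
      · have : {s | t < φ s} = ∅ := by
          ext s
          simpa using (hφ s).trans (not_lt.1 h1)
        simp [h0, h1, this]
    · simp [h0]
  have main : (∫⁻ t in Set.Ioo (0 : ℝ) 1, volume {s | t < f s / a}) +
      (∫⁻ t in Set.Ioo (0 : ℝ) 1, volume {s | t < g s / b}) ≤
      2 * ∫⁻ t in Set.Ioi (0 : ℝ), volume {s | t < h s / c} := by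
    rw [← lintegral_add_left (hanti _)]
    calc _ ≤ ∫⁻ t in Set.Ioo (0 : ℝ) 1, 2 * volume {s | t < h s / c} := by
            apply setLIntegral_mono (by exact (hanti _).const_mul 2)
            rintro t ⟨ht0, ht1⟩
            apply volume_add_volume_le_of_midpoint
            · exact measurableSet_lt measurable_const (by fun_prop)
            · exact measurableSet_lt measurable_const (by fun_prop)
            · obtain ⟨s, hs⟩ := exists_lt_of_lt_ciSup (show t * a < ⨆ s, f s by nlinarith)
              exact ⟨s, (lt_div_iff₀ ha0).2 hs⟩
            · obtain ⟨s, hs⟩ := exists_lt_of_lt_ciSup (show t * b < ⨆ s, g s by nlinarith)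
              exact ⟨s, (lt_div_iff₀ hb0).2 hs⟩
            · intro x hx y hy
              have hx' := (lt_div_iff₀ ha0).1 hx
              have hy' := (lt_div_iff₀ hb0).1 hy
              refine (lt_div_iff₀ hc0).2 ?_
              refine lt_of_pow_lt_pow_left₀ 2 (hh0 _) (lt_of_lt_of_le ?_ (H x y))
              rw [mul_pow, hcc]
              calc t ^ 2 * (a * b) = (t * a) * (t * b) := by ring
                _ < _ := mul_lt_mul'' hx' hy' (by positivity) (by positivity)
      _ ≤ _ := by
            rw [lintegral_const_mul _ (hanti _)]
            gcongr
            exact Set.Ioo_subset_Ioi_self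
  rw [layer f a hf hf0 ha0, layer g b hg hg0 hb0, layer h c hh hh0 hc0,
    hcut _ (fun s => (div_le_one ha0).2 (hfa s)), hcut _ (fun s => (div_le_one hb0).2 (hgb' s))]
  set X := ∫⁻ t in Set.Ioo (0 : ℝ) 1, volume {s | t < f s / a}
  set Y := ∫⁻ t in Set.Ioo (0 : ℝ) 1, volume {s | t < g s / b}
  set Z := ∫⁻ t in Set.Ioi (0 : ℝ), volume {s | t < h s / c}
  have hXY : X * Y ≤ Z ^ 2 := by
    have h4 : 4 * (X * Y) ≤ 4 * Z ^ 2 := by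
      calc 4 * (X * Y) ≤ (X + Y) ^ 2 := ENNReal.four_mul_mul_le_sq_add X Y
        _ ≤ (2 * Z) ^ 2 := by gcongr
        _ = 4 * Z ^ 2 := by ring
    exact (ENNReal.mul_le_mul_iff_right (by norm_num) (by norm_num)).1 h4
  calc ENNReal.ofReal a * X * (ENNReal.ofReal b * Y)
      = ENNReal.ofReal (a * b) * (X * Y) := by rw [ENNReal.ofReal_mul ha0.le]; ring
    _ ≤ ENNReal.ofReal (c ^ 2) * Z ^ 2 := by rw [hcc]; gcongr
    _ = _ := by rw [ENNReal.ofReal_pow hc0.le]; ring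

open MeasureTheory in
/-- The multiplicative Brunn–Minkowski inequality for midpoints. -/
theorem volume_mul_volume_le_sq_of_midpoint : ∀ {n : ℕ} {A B C : Set (Fin n → ℝ)},
    MeasurableSet A → MeasurableSet B → MeasurableSet C → Bornology.IsBounded A →
    Bornology.IsBounded B → Bornology.IsBounded C →
    (∀ a ∈ A, ∀ b ∈ B, (1 / 2 : ℝ) • (a + b) ∈ C) →
    volume A * volume B ≤ volume C ^ 2 := by
  intro n
  induction n with
  | zero =>
    intro A B C _ _ _ _ _ _ h
    by_cases hA : A.Nonempty
    · by_cases hB : B.Nonempty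
      · obtain ⟨a, ha⟩ := hA
        obtain ⟨b, hb⟩ := hB
        have hC : C = Set.univ := by
          apply Subsingleton.eq_univ_of_nonempty ⟨_, h a ha b hb⟩
        have h1 : ∀ S : Set (Fin 0 → ℝ), volume S ≤ 1 := fun S => by
          refine (measure_mono (Set.subset_univ S)).trans ?_
          rw [volume_pi, Measure.pi_univ]; simp
        have h2 : volume C = 1 := by rw [hC, volume_pi, Measure.pi_univ]; simp
        rw [h2, one_pow]
        exact mul_le_one' (h1 A) (h1 B)
      · simp [Set.not_nonempty_iff_eq_empty.1 hB]
    · simp [Set.not_nonempty_iff_eq_empty.1 hA]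
  | succ n ih =>
    intro A B C hA hB hC hAb hBb hCb h
    let e := (MeasurableEquiv.piFinSuccAbove (fun _ : Fin (n + 1) => ℝ) 0).symm
    have he : ∀ s z, e (s, z) = Fin.cons s z := fun s z => by
      simp [e, MeasurableEquiv.piFinSuccAbove, Fin.consEquiv]
    let sec : Set (Fin (n + 1) → ℝ) → ℝ → Set (Fin n → ℝ) := fun S s => {z | Fin.cons s z ∈ S}
    have hsec : ∀ S s, Prod.mk s ⁻¹' (e ⁻¹' S) = sec S s := fun S s => by
      ext z
      simp [sec, he]
    have hvol : ∀ S : Set (Fin (n + 1) → ℝ), MeasurableSet S →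
        volume S = ∫⁻ s, volume (sec S s) := by
      intro S hS
      have hp := (volume_preserving_piFinSuccAbove (fun _ : Fin (n + 1) => ℝ) 0).symm
      rw [← hp.measure_preimage hS.nullMeasurableSet]
      change (volume.prod volume) _ = _
      rw [Measure.prod_apply (e.measurable hS)]
      simp only [hsec]
    have hsm : ∀ S : Set (Fin (n + 1) → ℝ), MeasurableSet S → ∀ s, MeasurableSet (sec S s) := by
      intro S hS s
      rw [← hsec]
      exact (measurable_prodMk_left (x := s)) (e.measurable hS)
    have hmeas : ∀ S : Set (Fin (n + 1) → ℝ), MeasurableSet S →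
        Measurable fun s => volume (sec S s) := by
      intro S hS
      simp only [← hsec]
      exact measurable_measure_prodMk_left (e.measurable hS)
    have hsb : ∀ S : Set (Fin (n + 1) → ℝ), Bornology.IsBounded S →
        ∃ R : ℝ, ∀ s, sec S s ⊆ Metric.closedBall 0 R := by
      intro S hS
      obtain ⟨R, hR⟩ := hS.subset_closedBall 0
      refine ⟨R, fun s z hz => ?_⟩
      have := hR hz
      rw [mem_closedBall_zero_iff] at this ⊢
      have hR0 : 0 ≤ R := (norm_nonneg _).trans this
      rw [pi_norm_le_iff_of_nonneg hR0] at this ⊢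
      intro i
      simpa using this i.succ
    have hfin : ∀ S : Set (Fin (n + 1) → ℝ), Bornology.IsBounded S → ∀ s,
        volume (sec S s) ≠ ⊤ := by
      intro S hS s
      obtain ⟨R, hR⟩ := hsb S hS
      exact ((measure_mono (hR s)).trans_lt (isCompact_closedBall _ _).measure_lt_top).ne
    have hbdd : ∀ S : Set (Fin (n + 1) → ℝ), Bornology.IsBounded S →
        BddAbove (Set.range fun s => (volume (sec S s)).toReal) := by
      intro S hS
      obtain ⟨R, hR⟩ := hsb S hS
      refine ⟨(volume (Metric.closedBall (0 : Fin n → ℝ) R)).toReal, ?_⟩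
      rintro _ ⟨s, rfl⟩
      exact ENNReal.toReal_mono (isCompact_closedBall _ _).measure_lt_top.ne (measure_mono (hR s))
    have := lintegral_mul_lintegral_le_sq_of_midpoint (hmeas A hA).ennreal_toReal
      (hmeas B hB).ennreal_toReal (hmeas C hC).ennreal_toReal
      (fun _ => ENNReal.toReal_nonneg) (fun _ => ENNReal.toReal_nonneg)
      (fun _ => ENNReal.toReal_nonneg) (hbdd A hAb) (hbdd B hBb) (by
        intro s t
        have := ih (hsm A hA s) (hsm B hB t) (hsm C hC ((s + t) / 2))
          (Metric.isBounded_closedBall.subset ((hsb A hAb).choose_spec s))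
          (Metric.isBounded_closedBall.subset ((hsb B hBb).choose_spec t))
          (Metric.isBounded_closedBall.subset ((hsb C hCb).choose_spec _)) (by
            intro a ha b hb
            have := h _ ha _ hb
            change Fin.cons _ _ ∈ C
            convert this using 1
            ext i
            refine Fin.cases ?_ (fun i => ?_) i
            · simp; ring
            · simp; ring)
        rw [← ENNReal.toReal_mul, ← ENNReal.toReal_pow]
        exact ENNReal.toReal_mono (ENNReal.pow_ne_top (hfin C hCb _)) this)
    simp only [ENNReal.ofReal_toReal (hfin _ hAb _), ENNReal.ofReal_toReal (hfin _ hBb _),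
      ENNReal.ofReal_toReal (hfin _ hCb _)] at this
    rwa [hvol A hA, hvol B hB, hvol C hC]

theorem convex_of_isClosed_of_midpoint {E : Type*} [AddCommGroup E] [Module ℝ E]
    [TopologicalSpace E] [ContinuousAdd E] [ContinuousSMul ℝ E] {F : Set E} (hF : IsClosed F)
    (h : ∀ x ∈ F, ∀ y ∈ F, (1 / 2 : ℝ) • (x + y) ∈ F) : Convex ℝ F := by
  rw [convex_iff_add_mem]
  intro x hx y hy a b ha hb hab
  let γ : ℝ → E := fun s => (1 - s) • x + s • y
  have hγ : Continuous γ := by fun_prop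
  let G : Set ℝ := γ ⁻¹' F
  have hG : IsClosed G := hF.preimage hγ
  have hmid : ∀ s ∈ G, ∀ t ∈ G, (s + t) / 2 ∈ G := by
    intro s hs t ht
    have := h _ hs _ ht
    change γ _ ∈ F
    convert this using 1
    simp only [γ]
    module
  have h0 : (0 : ℝ) ∈ G := by simpa [G, γ] using hx
  have h1 : (1 : ℝ) ∈ G := by simpa [G, γ] using hy
  suffices hbG : b ∈ G by
    have : γ b ∈ F := hbG
    have ha' : a = 1 - b := by linarith
    rw [ha']; exact this
  obtain ⟨α, ⟨hαG, hα⟩, hαm⟩ := ((isCompact_Icc (a := 0) (b := b)).inter_left hG).exists_isGreatest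
    ⟨0, h0, le_rfl, hb⟩
  obtain ⟨β, ⟨hβG, hβ⟩, hβm⟩ := ((isCompact_Icc (a := b) (b := 1)).inter_left hG).exists_isLeast
    ⟨1, h1, by linarith, le_rfl⟩
  have hm := hmid α hαG β hβG
  by_contra hbn
  have hαb : α < b := lt_of_le_of_ne hα.2 (fun h => hbn (h ▸ hαG))
  have hβb : b < β := lt_of_le_of_ne hβ.1 (fun h => hbn (h ▸ hβG))
  rcases le_total ((α + β) / 2) b with hle | hle
  · have := hαm ⟨hm, by constructor <;> linarith [hα.1]⟩
    linarith
  · have := hβm ⟨hm, by constructor <;> linarith [hβ.2]⟩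
    linarith

open MeasureTheory

/-- The volume of the part of `P` within distance `η` of `x`. -/
noncomputable def locVol {n : ℕ} (P : Set (Fin n → ℝ)) (η : ℝ) (x : Fin n → ℝ) : ℝ :=
  volume.real (P ∩ Metric.closedBall x η)

section locVol

variable {n : ℕ} {P P' : Set (Fin n → ℝ)} {η : ℝ} {x y : Fin n → ℝ}

theorem locVol_nonneg : 0 ≤ locVol P η x := measureReal_nonneg

theorem volume_inter_closedBall_ne_top : volume (P ∩ Metric.closedBall x η) ≠ ⊤ :=
  ((measure_mono Set.inter_subset_right).trans_lt
    (isCompact_closedBall x η).measure_lt_top).ne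

theorem volumeReal_closedBall_pi (hη : 0 ≤ η) :
    volume.real (Metric.closedBall x η) = (2 * η) ^ n := by
  rw [Measure.real, Real.volume_pi_closedBall x hη, ENNReal.toReal_ofReal (by positivity)]
  simp

theorem locVol_le (hη : 0 ≤ η) : locVol P η x ≤ (2 * η) ^ n := by
  rw [← volumeReal_closedBall_pi (x := x) hη]
  exact measureReal_mono Set.inter_subset_right (isCompact_closedBall x η).measure_lt_top.ne

theorem locVol_le_add (hη : 0 ≤ η) :
    locVol P η x ≤ locVol P η y + ((2 * (η + dist x y)) ^ n - (2 * η) ^ n) := by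
  have hsub : Metric.closedBall y η ⊆ Metric.closedBall y (η + dist x y) :=
    Metric.closedBall_subset_closedBall (by linarith [dist_nonneg (x := x) (y := y)])
  have hd : volume.real (Metric.closedBall y (η + dist x y) \ Metric.closedBall y η) =
      (2 * (η + dist x y)) ^ n - (2 * η) ^ n := by
    rw [measureReal_sdiff hsub Metric.isClosed_closedBall.measurableSet
      (isCompact_closedBall y _).measure_lt_top.ne,
      volumeReal_closedBall_pi (by positivity), volumeReal_closedBall_pi hη]
  rw [← hd]
  refine (measureReal_mono ?_ ?_).trans (measureReal_union_le _ _)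
  · rintro z ⟨hzP, hz⟩
    by_cases hzy : z ∈ Metric.closedBall y η
    · exact Or.inl ⟨hzP, hzy⟩
    · refine Or.inr ⟨?_, hzy⟩
      rw [Metric.mem_closedBall] at hz ⊢
      linarith [dist_triangle z x y]
  · refine (measure_union_lt_top (lt_top_iff_ne_top.2 volume_inter_closedBall_ne_top) ?_).ne
    exact (measure_mono Set.sdiff_subset).trans_lt (isCompact_closedBall y _).measure_lt_top

theorem continuous_locVol (hη : 0 ≤ η) : Continuous (locVol P η) := by
  rw [continuous_iff_continuousAt]
  intro x
  have hc : Continuous fun y => (2 * (η + dist x y)) ^ n - (2 * η) ^ n := by fun_prop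
  have hc0 : Tendsto (fun y => (2 * (η + dist x y)) ^ n - (2 * η) ^ n) (𝓝 x) (𝓝 0) := by
    simpa using hc.tendsto x
  refine tendsto_of_tendsto_of_tendsto_of_le_of_le
    (g := fun y => locVol P η x - ((2 * (η + dist x y)) ^ n - (2 * η) ^ n))
    (h := fun y => locVol P η x + ((2 * (η + dist x y)) ^ n - (2 * η) ^ n)) ?_ ?_ ?_ ?_
  · simpa using tendsto_const_nhds.sub hc0
  · simpa using tendsto_const_nhds.add hc0
  · intro y
    have := locVol_le_add (P := P) (x := x) (y := y) hη
    beta_reduce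
    linarith
  · intro y
    have := locVol_le_add (P := P) (x := y) (y := x) hη
    rw [dist_comm] at this
    exact this

theorem locVol_mul_le_sq (hP : IsClosed P) (hPc : Convex ℝ P) :
    locVol P η x * locVol P η y ≤ locVol P η ((1 / 2 : ℝ) • (x + y)) ^ 2 := by
  have hm : ∀ z, MeasurableSet (P ∩ Metric.closedBall z η) := fun z =>
    (hP.inter Metric.isClosed_closedBall).measurableSet
  have hb : ∀ z, Bornology.IsBounded (P ∩ Metric.closedBall z η) := fun z =>
    Metric.isBounded_closedBall.subset Set.inter_subset_right
  have := volume_mul_volume_le_sq_of_midpoint (hm x) (hm y) (hm ((1 / 2 : ℝ) • (x + y)))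
    (hb _) (hb _) (hb _) (by
      rintro a ⟨ha, hax⟩ b ⟨hb, hby⟩
      refine ⟨?_, ?_⟩
      · rw [smul_add]
        exact hPc ha hb (by norm_num) (by norm_num) (by norm_num)
      · rw [mem_closedBall_iff_norm] at *
        rw [← smul_sub, norm_smul, show a + b - (x + y) = (a - x) + (b - y) by abel]
        have := norm_add_le (a - x) (b - y)
        norm_num
        linarith)
  unfold locVol Measure.real
  rw [← ENNReal.toReal_mul, ← ENNReal.toReal_pow]
  exact ENNReal.toReal_mono (ENNReal.pow_ne_top volume_inter_closedBall_ne_top) this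

theorem convex_setOf_lt_locVol (hη : 0 ≤ η) (hP : IsClosed P) (hPc : Convex ℝ P) (a : ℝ)
    (ha : 0 ≤ a) : Convex ℝ {x | a < locVol P η x} := by
  have key : ∀ b, 0 ≤ b → Convex ℝ {x | b ≤ locVol P η x} := by
    intro b hb
    apply convex_of_isClosed_of_midpoint (isClosed_le continuous_const (continuous_locVol hη))
    intro x hx y hy
    refine le_of_sq_le_sq ?_ locVol_nonneg
    refine le_trans ?_ (locVol_mul_le_sq hP hPc)
    rw [sq]
    exact mul_le_mul hx hy hb locVol_nonneg
  intro x hx y hy s t hs ht hst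
  have hb : a < min (locVol P η x) (locVol P η y) := lt_min hx hy
  exact hb.trans_le (key _ (ha.trans hb.le) (min_le_left _ _ : min _ (locVol P η y) ≤ locVol P η x)
    (min_le_right _ _ : min (locVol P η x) _ ≤ locVol P η y) hs ht hst)

/-- Contracting `P` towards a point of `P` near `y`. -/
theorem pow_mul_locVol_le (hPc : Convex ℝ P) {ρ : ℝ} (h0 : 0 ≤ ρ) (h1 : ρ < 1)
    (hy : (P ∩ Metric.closedBall y η).Nonempty) :
    (1 - ρ) ^ n * locVol P η x ≤ locVol P η ((1 - ρ) • x + ρ • y) := by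
  obtain ⟨p, hp, hpy⟩ := hy
  have himg : (fun z => (1 - ρ) • z + ρ • p) '' (P ∩ Metric.closedBall x η) ⊆
      P ∩ Metric.closedBall ((1 - ρ) • x + ρ • y) η := by
    rintro _ ⟨z, ⟨hz, hzx⟩, rfl⟩
    refine ⟨hPc hz hp (by linarith) h0 (by ring), ?_⟩
    rw [mem_closedBall_iff_norm] at *
    calc ‖(1 - ρ) • z + ρ • p - ((1 - ρ) • x + ρ • y)‖
        = ‖(1 - ρ) • (z - x) + ρ • (p - y)‖ := by congr 1; module
      _ ≤ (1 - ρ) * ‖z - x‖ + ρ * ‖p - y‖ := by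
        refine (norm_add_le _ _).trans ?_
        rw [norm_smul, norm_smul, Real.norm_of_nonneg h0, Real.norm_of_nonneg (by linarith)]
      _ ≤ (1 - ρ) * η + ρ * η := by gcongr
      _ = η := by ring
  have hv : volume ((fun z => (1 - ρ) • z + ρ • p) '' (P ∩ Metric.closedBall x η)) =
      ENNReal.ofReal ((1 - ρ) ^ n) * volume (P ∩ Metric.closedBall x η) := by
    rw [show (fun z => (1 - ρ) • z + ρ • p) = (fun z => z + ρ • p) ∘ fun z => (1 - ρ) • z from rfl,
      Set.image_comp, Set.image_add_right, measure_preimage_add_right, Set.image_smul,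
      Measure.addHaar_smul, abs_of_nonneg (pow_nonneg (by linarith) _), Module.finrank_fin_fun]
  calc (1 - ρ) ^ n * locVol P η x
      = volume.real ((fun z => (1 - ρ) • z + ρ • p) '' (P ∩ Metric.closedBall x η)) := by
        rw [Measure.real, hv, ENNReal.toReal_mul,
          ENNReal.toReal_ofReal (pow_nonneg (by linarith) _)]
        rfl
    _ ≤ _ := measureReal_mono himg volume_inter_closedBall_ne_top

theorem locVol_le_add_symmDiff (hPP : volume (symmDiff P P') ≠ ⊤) :
    locVol P η x ≤ locVol P' η x + volume.real (symmDiff P P') := by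
  refine (measureReal_mono ?_ ?_).trans (measureReal_union_le _ _)
  · rintro z ⟨hz, hzx⟩
    by_cases h : z ∈ P'
    · exact Or.inl ⟨h, hzx⟩
    · exact Or.inr (Or.inl ⟨hz, h⟩)
  · exact (measure_union_lt_top (lt_top_iff_ne_top.2 volume_inter_closedBall_ne_top)
      (lt_top_iff_ne_top.2 hPP)).ne

theorem exists_locVol_pos (hP : volume P ≠ 0) (hη : 0 < η) : ∃ x, 0 < locVol P η x := by
  obtain ⟨x, _, hx⟩ := exists_mem_forall_mem_nhdsWithin_pos_measure hP
  refine ⟨x, ENNReal.toReal_pos (hx _ ?_).ne' volume_inter_closedBall_ne_top⟩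
  exact inter_mem_nhdsWithin _ (Metric.closedBall_mem_nhds x hη)

end locVol

/-- Continuous choice of a point that almost maximizes the local volume. -/
theorem exists_continuous_center {X : Type*} [TopologicalSpace X] [NormalSpace X]
    [ParacompactSpace X] {n : ℕ} (P : X → Set (Fin n → ℝ)) (hPcl : ∀ x, IsClosed (P x))
    (hPc : ∀ x, Convex ℝ (P x)) (hP0 : ∀ x, volume (P x) ≠ 0) (hPt : ∀ x, volume (P x) ≠ ⊤)
    (hcont : ∀ x, Tendsto (fun x' => volume.real (symmDiff (P x') (P x))) (𝓝 x) (𝓝 0))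
    {η κ : ℝ} (hη : 0 < η) (hκ0 : 0 < κ) (hκ1 : κ < 1) :
    ∃ c : C(X, Fin n → ℝ), ∀ x y, κ * locVol (P x) η y ≤ locVol (P x) η (c x) := by
  have hbdd : ∀ x, BddAbove (Set.range fun y => locVol (P x) η y) := fun x =>
    ⟨(2 * η) ^ n, by rintro _ ⟨y, rfl⟩; exact locVol_le hη.le⟩
  let M : X → ℝ := fun x => ⨆ y, locVol (P x) η y
  have hM : ∀ x y, locVol (P x) η y ≤ M x := fun x y => le_ciSup (hbdd x) y
  have hM0 : ∀ x, 0 < M x := fun x => by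
    obtain ⟨y, hy⟩ := exists_locVol_pos (hP0 x) hη
    exact hy.trans_le (hM x y)
  have hs : ∀ x x', volume (symmDiff (P x) (P x')) ≠ ⊤ := fun x x' =>
    ((measure_mono (Set.symmDiff_subset_union)).trans_lt (measure_union_lt_top
      (lt_top_iff_ne_top.2 (hPt _)) (lt_top_iff_ne_top.2 (hPt _)))).ne
  obtain ⟨c, hc⟩ := exists_continuous_forall_mem_convex_of_local_const
    (t := fun x => {z | κ * M x < locVol (P x) η z})
    (fun x => convex_setOf_lt_locVol hη.le (hPcl x) (hPc x) _ (mul_pos hκ0 (hM0 x)).le) (by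
      intro x
      obtain ⟨z, hz⟩ := exists_lt_of_lt_ciSup (show κ * M x < ⨆ y, locVol (P x) η y by
        change _ < M x
        nlinarith [hM0 x])
      refine ⟨z, ?_⟩
      filter_upwards [(hcont x).eventually_lt_const
        (show 0 < (locVol (P x) η z - κ * M x) / 2 by linarith)] with x' hx'
      have h1 : M x' ≤ M x + volume.real (symmDiff (P x') (P x)) := ciSup_le fun y =>
        (locVol_le_add_symmDiff (hs x' x)).trans (by gcongr; exact hM x y)
      have h2 := locVol_le_add_symmDiff (η := η) (x := z) (hs x x')
      rw [symmDiff_comm] at h2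
      change κ * M x' < locVol (P x') η z
      nlinarith [measureReal_nonneg (μ := volume) (s := symmDiff (P x') (P x))])
  exact ⟨c, fun x y => (mul_le_mul_of_nonneg_left (hM x y) hκ0.le).trans (hc x).le⟩

section halfspace

variable {n : ℕ}

theorem volume_level_eq_zero {h : (Fin n → ℝ) →L[ℝ] ℝ} (hh : h ≠ 0) (τ : ℝ) :
    volume {z | h z = τ} = 0 := by
  obtain ⟨v, hv⟩ : ∃ v, h v ≠ 0 := by
    by_contra hcon
    push Not at hcon
    exact hh (ContinuousLinearMap.ext hcon)
  let A : AffineSubspace ℝ (Fin n → ℝ) :=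
    (AffineSubspace.mk' τ (⊥ : Submodule ℝ ℝ)).comap h.toLinearMap.toAffineMap
  have hA : (A : Set (Fin n → ℝ)) = {z | h z = τ} := by
    ext z
    simp [A, AffineSubspace.mem_mk', sub_eq_zero]
  rw [← hA]
  apply Measure.addHaar_affineSubspace
  intro htop
  have h0 : (0 : Fin n → ℝ) ∈ {z | h z = τ} := by rw [← hA, htop]; trivial
  have h1 : v ∈ {z | h z = τ} := by rw [← hA, htop]; trivial
  simp only [Set.mem_ofPred_eq, map_zero] at h0 h1
  exact hv (h1.trans h0.symm)

theorem volumeReal_image_homothety (K : Set (Fin n → ℝ)) (y : Fin n → ℝ) {s : ℝ} (hs : 0 ≤ s) :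
    volume.real ((fun z => s • z + (1 - s) • y) '' K) = s ^ n * volume.real K := by
  rw [show (fun z => s • z + (1 - s) • y) = (fun z => z + (1 - s) • y) ∘ fun z => s • z from rfl,
    Set.image_comp, Set.image_add_right, Measure.real, measure_preimage_add_right, Set.image_smul,
    Measure.addHaar_smul, abs_of_nonneg (pow_nonneg hs _), Module.finrank_fin_fun,
    ENNReal.toReal_mul, ENNReal.toReal_ofReal (pow_nonneg hs _)]
  rfl

/-- The mean of a linear functional over a convex body is not too close to its maximum. -/
theorem mean_le_of_convex {P : Set (Fin n → ℝ)} (hP : IsCompact P) (hPc : Convex ℝ P)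
    (hP0 : volume P ≠ 0) (h : (Fin n → ℝ) →L[ℝ] ℝ) {a b : ℝ} (ha : ∀ x ∈ P, a ≤ h x)
    (hb : ∀ x ∈ P, h x ≤ b) (haP : ∃ x ∈ P, h x = a) :
    ⨍ x in P, h x ≤ b - (1 / 2) ^ (n + 1) * (b - a) := by
  obtain ⟨y, hy, rfl⟩ := haP
  set a := h y
  have hPt : volume P ≠ ⊤ := hP.measure_lt_top.ne
  have hV : 0 < volume.real P := ENNReal.toReal_pos hP0 hPt
  let P' := (fun z => (1 / 2 : ℝ) • z + (1 - 1 / 2 : ℝ) • y) '' P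
  have hP'P : P' ⊆ P := by
    rintro _ ⟨z, hz, rfl⟩
    exact hPc hz hy (by norm_num) (by norm_num) (by norm_num)
  have hP'm : MeasurableSet P' := (hP.image (by fun_prop)).measurableSet
  have hintegrable : IntegrableOn (fun x => b - h x) P :=
    (by fun_prop : Continuous fun x => b - h x).continuousOn.integrableOn_compact hP
  have h1 : ∫ x in P', (b - h x) ≤ ∫ x in P, (b - h x) := by
    apply setIntegral_mono_set hintegrable
    · exact (ae_restrict_iff' hP.measurableSet).2 (Eventually.of_forall fun x hx => by
        simpa using hb x hx)
    · exact LE.le.eventuallyLE hP'P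
  have h2 : (1 / 2 * (b - a)) * volume.real P' ≤ ∫ x in P', (b - h x) := by
    have hc : ∫ x in P', (1 / 2 * (b - a)) = (1 / 2 * (b - a)) * volume.real P' := by
      simp [mul_comm]
    rw [← hc]
    apply setIntegral_mono_on
    · exact integrableOn_const (measure_mono hP'P |>.trans_lt hP.measure_lt_top).ne
    · exact hintegrable.mono_set hP'P
    · exact hP'm
    · rintro _ ⟨z, hz, rfl⟩
      have := hb z hz
      simp only [map_add, map_smul, smul_eq_mul]
      change _ ≤ b - (1 / 2 * h z + (1 - 1 / 2) * a)
      linarith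
  have h3 : ∫ x in P, (b - h x) = volume.real P * (b - ⨍ x in P, h x) := by
    have hi1 : Integrable (fun _ => b) (volume.restrict P) := integrableOn_const hPt
    have hi2 : Integrable (fun x => h x) (volume.restrict P) :=
      h.continuous.continuousOn.integrableOn_compact hP
    rw [integral_sub hi1 hi2,
      setAverage_eq, mul_sub, smul_eq_mul, ← mul_assoc, mul_inv_cancel₀ hV.ne', one_mul]
    simp
  rw [show volume.real P' = _ from volumeReal_image_homothety P y (by norm_num)] at h2
  rw [h3] at h1
  have h4 := h2.trans h1
  have h5 : volume.real P * ((1 / 2) ^ (n + 1) * (b - a)) ≤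
      volume.real P * (b - ⨍ x in P, h x) := by
    refine le_trans (le_of_eq ?_) h4
    ring
  have := le_of_mul_le_mul_left h5 hV
  linarith

/-- Cutting a convex set by a hyperplane through the mean of a smaller convex body with the same
extent keeps a fixed proportion of the volume. -/
theorem le_volume_inter_halfspace {P K : Set (Fin n → ℝ)} (hP : IsCompact P)
    (hPc : Convex ℝ P) (hP0 : volume P ≠ 0) (hK : IsCompact K) (hKc : Convex ℝ K)
    (hPK : P ⊆ K) {h : (Fin n → ℝ) →L[ℝ] ℝ} (hh : h ≠ 0) (hex : ∀ z ∈ K, ∃ x ∈ P, h z = h x) :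
    ((1 / 2) ^ (n + 2)) ^ n * volume.real K ≤
      volume.real (K ∩ {z | ⨍ x in P, h x < h z}) := by
  have hPn : P.Nonempty := nonempty_of_measure_ne_zero hP0
  obtain ⟨x₁, hx₁, hmax⟩ := hP.exists_isMaxOn hPn h.continuous.continuousOn
  obtain ⟨x₀, hx₀, hmin⟩ := hP.exists_isMinOn hPn h.continuous.continuousOn
  have hle := mean_le_of_convex hP hPc hP0 h hmin hmax ⟨x₀, hx₀, rfl⟩
  have hlt : h x₀ < h x₁ := by
    by_contra hcon
    apply hP0
    refine measure_mono_null (fun x hx => ?_) (volume_level_eq_zero hh (h x₁))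
    exact le_antisymm (hmax hx) ((not_lt.1 hcon).trans (hmin hx))
  rw [← volumeReal_image_homothety K x₁ (by positivity)]
  refine measureReal_mono ?_ (measure_mono Set.inter_subset_left |>.trans_lt hK.measure_lt_top).ne
  rintro _ ⟨z, hz, rfl⟩
  have hs1 : ((1 : ℝ) / 2) ^ (n + 2) ≤ 1 := pow_le_one₀ (by norm_num) (by norm_num)
  refine ⟨hKc hz (hPK hx₁) (by positivity) (by linarith) (by ring), ?_⟩
  obtain ⟨x, hx, hzx⟩ := hex z hz
  have h0 : h x₀ ≤ h x := hmin hx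
  simp only [Set.mem_ofPred_eq, map_add, map_smul, smul_eq_mul, hzx]
  refine hle.trans_lt ?_
  have hp : ((1 : ℝ) / 2) ^ (n + 1) = 2 * (1 / 2) ^ (n + 2) := by rw [pow_succ _ (n + 1)]; ring
  rw [hp]
  have hpos : (0 : ℝ) < (1 / 2) ^ (n + 2) := by positivity
  set s : ℝ := (1 / 2) ^ (n + 2)
  nlinarith [mul_le_mul_of_nonneg_left h0 hpos.le, mul_lt_mul_of_pos_left hlt hpos]

theorem volume_inter_halfspace_le {P K : Set (Fin n → ℝ)} (hP : IsCompact P)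
    (hPc : Convex ℝ P) (hP0 : volume P ≠ 0) (hK : IsCompact K) (hKc : Convex ℝ K)
    (hPK : P ⊆ K) {h : (Fin n → ℝ) →L[ℝ] ℝ} (hh : h ≠ 0) (hex : ∀ z ∈ K, ∃ x ∈ P, h z = h x) :
    volume.real (K ∩ {z | ⨍ x in P, h x ≤ h z}) ≤
      (1 - ((1 / 2) ^ (n + 2)) ^ n) * volume.real K := by
  have h1 := le_volume_inter_halfspace hP hPc hP0 hK hKc hPK (neg_ne_zero.2 hh) (fun z hz => by
    obtain ⟨x, hx, hzx⟩ := hex z hz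
    exact ⟨x, hx, by simp [hzx]⟩)
  have h2 : ⨍ x in P, (-h) x = -⨍ x in P, h x := by
    simp only [setAverage_eq, _root_.neg_apply, integral_neg, smul_neg]
  rw [h2] at h1
  have h3 : K ∩ {z | -⨍ x in P, h x < (-h) z} = K \ {z | ⨍ x in P, h x ≤ h z} := by
    ext z
    simp
  rw [h3] at h1
  have h4 := measureReal_inter_add_sdiff (μ := volume) (s := K)
    (t := {z | ⨍ x in P, h x ≤ h z})
    (measurableSet_le measurable_const h.continuous.measurable) hK.measure_lt_top.ne
  linarith

end halfspace

section region

variable {n m : ℕ}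

/-- The linear functional with coefficients `y` on the coordinates selected by `e`. -/
noncomputable def coordFun (e : Fin (m + 1) → Fin n) (y : Fin (m + 1) → ℝ) :
    (Fin n → ℝ) →L[ℝ] ℝ :=
  ∑ i, y i • ContinuousLinearMap.proj (R := ℝ) (φ := fun _ : Fin n => ℝ) (e i)

theorem coordFun_apply (e : Fin (m + 1) → Fin n) (y : Fin (m + 1) → ℝ) (z : Fin n → ℝ) :
    coordFun e y z = ∑ i, y i * z (e i) := by
  simp [coordFun]

theorem coordFun_neg (e : Fin (m + 1) → Fin n) (y : Fin (m + 1) → ℝ) :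
    coordFun e (-y) = -coordFun e y := by
  ext z
  simp [coordFun_apply]

theorem coordFun_ne_zero {e : Fin (m + 1) → Fin n} (he : Function.Injective e)
    {y : Fin (m + 1) → ℝ} (hy : y ≠ 0) : coordFun e y ≠ 0 := by
  obtain ⟨i, hi⟩ := Function.ne_iff.1 hy
  intro h
  have := DFunLike.congr_fun h (Pi.single (e i) 1)
  rw [coordFun_apply, Finset.sum_eq_single i] at this
  · simp at this; exact hi this
  · intro j _ hj
    rw [Pi.single_eq_of_ne (fun h => hj (he h)), mul_zero]
  · simp

/-- Successively cut the unit cube by halfspaces through the mean. -/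
noncomputable def region (e : ℕ → Fin (m + 1) → Fin n) (y : ℕ → Fin (m + 1) → ℝ) :
    ℕ → Set (Fin n → ℝ)
  | 0 => Set.Icc 0 1
  | l + 1 => region e y l ∩
      {z | ⨍ x in region e y l, coordFun (e l) (y l) x ≤ coordFun (e l) (y l) z}

variable {e : ℕ → Fin (m + 1) → Fin n} {y y' : ℕ → Fin (m + 1) → ℝ} {l : ℕ}

theorem region_congr (h : ∀ j < l, y j = y' j) : region e y l = region e y' l := by
  induction l with
  | zero => rfl
  | succ l ih =>
    rw [region, region, ih fun j hj => h j (by omega), h l (by omega)]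

theorem region_succ_subset : region e y (l + 1) ⊆ region e y l := Set.inter_subset_left

theorem region_subset_Icc : region e y l ⊆ Set.Icc 0 1 := by
  induction l with
  | zero => exact subset_rfl
  | succ l ih => exact region_succ_subset.trans ih

theorem isClosed_region : IsClosed (region e y l) := by
  induction l with
  | zero => exact isClosed_Icc
  | succ l ih => exact ih.inter (isClosed_le continuous_const (coordFun _ _).continuous)

theorem isCompact_region : IsCompact (region e y l) :=
  isCompact_Icc.of_isClosed_subset isClosed_region region_subset_Icc

theorem measurableSet_region : MeasurableSet (region e y l) := isClosed_region.measurableSet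

theorem convex_region : Convex ℝ (region e y l) := by
  induction l with
  | zero => exact convex_Icc _ _
  | succ l ih => exact ih.inter (convex_halfSpace_ge (coordFun (e l) (y l)).isLinear _)

theorem volume_region_ne_top : volume (region e y l) ≠ ⊤ := isCompact_region.measure_lt_top.ne

theorem volume_region_ne_zero (he : ∀ j, Function.Injective (e j)) (hy : ∀ j < l, y j ≠ 0) :
    volume (region e y l) ≠ 0 := by
  induction l with
  | zero =>
    simp only [region]
    rw [Real.volume_Icc_pi]
    simp
  | succ l ih =>
    have h0 := ih fun j hj => hy j (by omega)
    have h1 := le_volume_inter_halfspace isCompact_region convex_region h0 isCompact_region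
      convex_region subset_rfl (coordFun_ne_zero (he l) (hy l (by omega)))
      (fun z hz => ⟨z, hz, rfl⟩)
    have h2 : 0 < volume.real (region e y l) := ENNReal.toReal_pos h0 volume_region_ne_top
    have h3 : 0 < volume.real (region e y l ∩
        {z | ⨍ x in region e y l, coordFun (e l) (y l) x < coordFun (e l) (y l) z}) :=
      lt_of_lt_of_le (by positivity) h1
    have h4 : region e y l ∩
        {z | ⨍ x in region e y l, coordFun (e l) (y l) x < coordFun (e l) (y l) z} ⊆
        region e y (l + 1) := fun z hz => by
      have h6 := hz.2
      rw [Set.mem_ofPred_eq] at h6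
      exact ⟨hz.1, h6.le⟩
    intro h5
    rw [Measure.real, measure_mono_null h4 h5] at h3
    simp at h3

theorem continuous_coordFun_apply (e : Fin (m + 1) → Fin n) (z : Fin n → ℝ) :
    Continuous fun y => coordFun e y z := by
  simp only [coordFun_apply]
  fun_prop

theorem tendsto_mean_region (l : ℕ) (hV : volume (region e y l) ≠ 0)
    (h : ∀ᵐ z, ∀ᶠ v in 𝓝 y, (z ∈ region e v l ↔ z ∈ region e y l)) :
    Tendsto (fun v => ⨍ x in region e v l, coordFun (e l) (v l) x) (𝓝 y)
      (𝓝 (⨍ x in region e y l, coordFun (e l) (y l) x)) := by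
  have hvol := tendsto_measure_of_ae_tendsto_indicator (𝓝 y)
    (measurableSet_region (e := e) (y := y) (l := l))
    (fun v => measurableSet_region (e := e) (y := v) (l := l))
    (measurableSet_Icc (a := (0 : Fin n → ℝ)) (b := 1)) isCompact_Icc.measure_lt_top.ne
    (Eventually.of_forall fun v => region_subset_Icc) h
  have hvol' : Tendsto (fun v => volume.real (region e v l)) (𝓝 y)
      (𝓝 (volume.real (region e y l))) :=
    (ENNReal.tendsto_toReal volume_region_ne_top).comp hvol
  have hintegrable : Tendsto (fun v => ∫ x in region e v l, coordFun (e l) (v l) x) (𝓝 y)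
      (𝓝 (∫ x in region e y l, coordFun (e l) (y l) x)) := by
    simp only [← integral_indicator measurableSet_region]
    refine tendsto_integral_filter_of_dominated_convergence
      ((Set.Icc (0 : Fin n → ℝ) 1).indicator fun _ => ∑ i, (|y l i| + 1)) ?_ ?_ ?_ ?_
    · exact Eventually.of_forall fun v =>
        ((coordFun _ _).continuous.measurable.indicator measurableSet_region).aestronglyMeasurable
    · have hev : ∀ᶠ v in 𝓝 y, ∀ i, |v l i| < |y l i| + 1 := by
        rw [eventually_all]
        intro i
        have hc : Continuous fun v : ℕ → Fin (m + 1) → ℝ => |v l i| := by fun_prop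
        exact (hc.tendsto y).eventually_lt_const (by linarith)
      filter_upwards [hev] with v hv
      refine Eventually.of_forall fun x => ?_
      by_cases hx : x ∈ region e v l
      · have hxQ := region_subset_Icc hx
        rw [Set.indicator_of_mem hx, Set.indicator_of_mem hxQ, coordFun_apply]
        refine (norm_sum_le _ _).trans (Finset.sum_le_sum fun i _ => ?_)
        rw [Real.norm_eq_abs, abs_mul, abs_of_nonneg (hxQ.1 _)]
        have h1 : x (e l i) ≤ 1 := hxQ.2 _
        have h0 : 0 ≤ x (e l i) := hxQ.1 _
        nlinarith [hv i, abs_nonneg (v l i)]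
      · rw [Set.indicator_of_notMem hx, norm_zero]
        apply Set.indicator_nonneg
        intro _ _
        positivity
    · exact (integrable_indicator_iff measurableSet_Icc).2
        (integrableOn_const isCompact_Icc.measure_lt_top.ne)
    · filter_upwards [h] with z hz
      have hc : Tendsto (fun v : ℕ → Fin (m + 1) → ℝ => coordFun (e l) (v l) z) (𝓝 y)
          (𝓝 (coordFun (e l) (y l) z)) :=
        ((continuous_coordFun_apply (e l) z).comp (continuous_apply l)).tendsto y
      by_cases hzy : z ∈ region e y l
      · rw [Set.indicator_of_mem hzy]
        refine hc.congr' ?_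
        filter_upwards [hz] with v hv
        rw [Set.indicator_of_mem (hv.2 hzy)]
      · rw [Set.indicator_of_notMem hzy]
        refine tendsto_const_nhds.congr' ?_
        filter_upwards [hz] with v hv
        rw [Set.indicator_of_notMem fun hh => hzy (hv.1 hh)]
  simp only [setAverage_eq]
  exact (hvol'.inv₀ (ENNReal.toReal_pos hV volume_region_ne_top).ne').smul hintegrable

theorem ae_eventually_mem_region_iff (he : ∀ j, Function.Injective (e j)) (hy : ∀ j < l, y j ≠ 0) :
    ∀ᵐ z, ∀ᶠ v in 𝓝 y, (z ∈ region e v l ↔ z ∈ region e y l) := by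
  induction l with
  | zero => exact Eventually.of_forall fun z => Eventually.of_forall fun v => Iff.rfl
  | succ l ih =>
    have hy' : ∀ j < l, y j ≠ 0 := fun j hj => hy j (by omega)
    have h := ih hy'
    have hmean := tendsto_mean_region l (volume_region_ne_zero he hy') h
    have hnull := volume_level_eq_zero (coordFun_ne_zero (he l) (hy l (by omega)))
      (⨍ x in region e y l, coordFun (e l) (y l) x)
    filter_upwards [h, measure_eq_zero_iff_ae_notMem.1 hnull] with z hz hzn
    have hc : Tendsto (fun v : ℕ → Fin (m + 1) → ℝ => coordFun (e l) (v l) z) (𝓝 y)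
        (𝓝 (coordFun (e l) (y l) z)) :=
      ((continuous_coordFun_apply (e l) z).comp (continuous_apply l)).tendsto y
    rcases lt_or_gt_of_ne (show coordFun (e l) (y l) z ≠ _ from hzn) with hlt | hlt
    · filter_upwards [hz, hc.eventually_lt hmean hlt] with v hv hv2
      exact ⟨fun hh => absurd hh.2 (not_le.2 hv2), fun hh => absurd hh.2 (not_le.2 hlt)⟩
    · filter_upwards [hz, hmean.eventually_lt hc hlt] with v hv hv2
      exact ⟨fun hh => ⟨hv.1 hh.1, le_of_lt hlt⟩, fun hh => ⟨hv.2 hh.1, le_of_lt hv2⟩⟩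

theorem tendsto_volume_symmDiff_region (he : ∀ j, Function.Injective (e j))
    (hy : ∀ j < l, y j ≠ 0) :
    Tendsto (fun v => volume.real (symmDiff (region e v l) (region e y l))) (𝓝 y) (𝓝 0) := by
  have h := tendsto_measure_of_ae_tendsto_indicator (𝓝 y) (μ := volume) MeasurableSet.empty
    (fun v => (measurableSet_region (e := e) (y := v) (l := l)).symmDiff
      (measurableSet_region (e := e) (y := y) (l := l)))
    (measurableSet_Icc (a := (0 : Fin n → ℝ)) (b := 1)) isCompact_Icc.measure_lt_top.ne
    (Eventually.of_forall fun v => Set.symmDiff_subset_union.trans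
      (Set.union_subset region_subset_Icc region_subset_Icc)) (by
      filter_upwards [ae_eventually_mem_region_iff he hy] with z hz
      filter_upwards [hz] with v hv
      simp [Set.mem_symmDiff, hv])
  rw [measure_empty] at h
  have h2 := (ENNReal.tendsto_toReal ENNReal.zero_ne_top).comp h
  rw [ENNReal.toReal_zero] at h2
  exact h2

end region

section leaves

variable {n m k : ℕ}

/-- Extend a finite sequence of vectors to an infinite one. -/
def extendSeq (u : Fin k → Fin (m + 1) → ℝ) (j : ℕ) : Fin (m + 1) → ℝ :=
  if h : j < k then u ⟨j, h⟩ else 1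

theorem extendSeq_of_lt (u : Fin k → Fin (m + 1) → ℝ) {j : ℕ} (h : j < k) :
    extendSeq u j = u ⟨j, h⟩ := dif_pos h

theorem continuous_extendSeq : Continuous (extendSeq (m := m) (k := k)) := by
  apply continuous_pi
  intro j
  by_cases h : j < k
  · simp only [extendSeq_of_lt _ h]
    fun_prop
  · simp only [extendSeq, dif_neg h]
    fun_prop

variable {e : ℕ → Fin (m + 1) → Fin n} {x : (Fin k → Bool) → Fin k → Fin (m + 1) → ℝ}

theorem region_extendSeq_of_agree (hx : Compat x) {l : ℕ} {w w' : Fin k → Bool}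
    (h : Agree l w w') : region e (extendSeq (x w')) l = region e (extendSeq (x w)) l := by
  apply region_congr
  intro j hj
  by_cases hjk : j < k
  · rw [extendSeq_of_lt _ hjk, extendSeq_of_lt _ hjk]
    exact hx.eq_of_agree h _ hj
  · simp only [extendSeq, dif_neg hjk]

theorem mean_coordFun_neg (e : Fin (m + 1) → Fin n) (y : Fin (m + 1) → ℝ)
    (R : Set (Fin n → ℝ)) :
    ⨍ z in R, coordFun e (-y) z = -⨍ z in R, coordFun e y z := by
  simp only [coordFun_neg, setAverage_eq, _root_.neg_apply, integral_neg, smul_neg]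

theorem exists_mem_region (hx : Compat x) {z : Fin n → ℝ} (hz : z ∈ Set.Icc 0 1) {l : ℕ}
    (hl : l ≤ k) : ∃ w, z ∈ region e (extendSeq (x w)) l := by
  induction l with
  | zero => exact ⟨fun _ => true, hz⟩
  | succ l ih =>
    obtain ⟨w, hw⟩ := ih (by omega)
    by_cases hcut : ⨍ a in region e (extendSeq (x w)) l, coordFun (e l) (extendSeq (x w) l) a ≤
        coordFun (e l) (extendSeq (x w) l) z
    · exact ⟨w, hw, hcut⟩
    · let j : Fin k := ⟨l, by omega⟩
      let w' := Function.update w j (!w j)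
      have hag : Agree l w w' := by
        intro i hi
        have : i ≠ j := fun h => by rw [h] at hi; exact lt_irrefl _ hi
        simp [w', this]
      have hne : w j ≠ w' j := by simp [w']
      have hxj : extendSeq (x w') l = -extendSeq (x w) l := by
        rw [extendSeq_of_lt _ (show l < k by omega), extendSeq_of_lt _ (show l < k by omega)]
        have := hx j w w' hag
        rwa [if_neg hne] at this
      refine ⟨w', ?_, ?_⟩
      · rw [region_extendSeq_of_agree hx hag]; exact hw
      · rw [Set.mem_ofPred_eq, region_extendSeq_of_agree hx hag, hxj, mean_coordFun_neg,
          coordFun_neg]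
        exact neg_le_neg (not_le.1 hcut).le

theorem region_subset_of_le {y : ℕ → Fin (m + 1) → ℝ} {l l' : ℕ} (h : l ≤ l') :
    region e y l' ⊆ region e y l := by
  induction h with
  | refl => exact subset_rfl
  | step _ ih => exact region_succ_subset.trans ih

theorem aedisjoint_region (he : ∀ j, Function.Injective (e j)) (hx : Compat x)
    (hx0 : ∀ w j, x w j ≠ 0) {w w' : Fin k → Bool} (hw : w ≠ w') :
    AEDisjoint volume (region e (extendSeq (x w)) k) (region e (extendSeq (x w')) k) := by
  classical
  have hex : ∃ l, ∃ h : l < k, w ⟨l, h⟩ ≠ w' ⟨l, h⟩ := by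
    obtain ⟨i, hi⟩ := Function.ne_iff.1 hw
    exact ⟨i.1, i.2, hi⟩
  obtain ⟨hlk, hl⟩ := Nat.find_spec hex
  set l := Nat.find hex with hldef
  have hag : Agree l w w' := by
    intro i hi
    by_contra hcon
    exact Nat.find_min hex hi ⟨i.2, hcon⟩
  have hxj : extendSeq (x w') l = -extendSeq (x w) l := by
    rw [extendSeq_of_lt _ hlk, extendSeq_of_lt _ hlk]
    have := hx ⟨l, hlk⟩ w w' hag
    rwa [if_neg hl] at this
  have hne : extendSeq (x w) l ≠ 0 := by
    rw [extendSeq_of_lt _ hlk]; exact hx0 _ _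
  refine measure_mono_null ?_ (volume_level_eq_zero (coordFun_ne_zero (he l) hne)
    (⨍ a in region e (extendSeq (x w)) l, coordFun (e l) (extendSeq (x w) l) a))
  rintro z ⟨hz, hz'⟩
  have h1 := (region_subset_of_le (Nat.succ_le_of_lt hlk) hz).2
  have h2 := (region_subset_of_le (Nat.succ_le_of_lt hlk) hz').2
  rw [Set.mem_ofPred_eq] at h1 h2
  rw [region_extendSeq_of_agree hx hag, hxj, mean_coordFun_neg, coordFun_neg] at h2
  exact le_antisymm (neg_le_neg_iff.1 h2) h1

theorem one_le_sum_volume_region (hx : Compat x) :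
    1 ≤ ∑ w, volume.real (region e (extendSeq (x w)) k) := by
  have h1 : volume.real (Set.Icc (0 : Fin n → ℝ) 1) = 1 := by
    rw [Measure.real, Real.volume_Icc_pi]; simp
  rw [← h1]
  refine (measureReal_mono (s₂ := ⋃ w, region e (extendSeq (x w)) k) (fun z hz => ?_) ?_).trans
    (measureReal_iUnion_fintype_le _)
  · obtain ⟨w, hw⟩ := exists_mem_region (e := e) hx hz le_rfl
    exact Set.mem_iUnion.2 ⟨w, hw⟩
  · exact ((measure_iUnion_le _).trans_lt (by
      rw [tsum_fintype]
      exact ENNReal.sum_lt_top.2 fun w _ => lt_top_iff_ne_top.2 volume_region_ne_top)).ne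

theorem sum_volume_region_inter_le (he : ∀ j, Function.Injective (e j)) (hx : Compat x)
    (hx0 : ∀ w j, x w j ≠ 0) (s : Finset (Fin k → Bool)) {B : Set (Fin n → ℝ)}
    (hB : MeasurableSet B) (hBt : volume B ≠ ⊤) :
    ∑ w ∈ s, volume.real (region e (extendSeq (x w)) k ∩ B) ≤ volume.real B := by
  have h := measure_biUnion_finset₀ (μ := volume) (s := s)
    (f := fun w => region e (extendSeq (x w)) k ∩ B)
    (fun w _ w' _ hww => (aedisjoint_region he hx hx0 hww).mono Set.inter_subset_left
      Set.inter_subset_left)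
    (fun w _ => (measurableSet_region.inter hB).nullMeasurableSet)
  unfold Measure.real
  rw [← ENNReal.toReal_sum fun w _ => (measure_mono Set.inter_subset_left |>.trans_lt
    (lt_top_iff_ne_top.2 volume_region_ne_top)).ne, ← h]
  exact ENNReal.toReal_mono hBt (measure_mono (Set.iUnion₂_subset fun _ _ =>
    Set.inter_subset_right))

end leaves

section thinning

open Pointwise

variable {n m : ℕ}

/-- The coordinate face of the unit cube spanned by the directions in `S`. -/
def cubeFace (S : Finset (Fin n)) : Set (Fin n → ℝ) :=
  Set.Icc 0 fun i => if i ∈ S then 1 else 0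

theorem isCompact_cubeFace (S : Finset (Fin n)) : IsCompact (cubeFace S) := isCompact_Icc

theorem convex_cubeFace (S : Finset (Fin n)) : Convex ℝ (cubeFace S) := convex_Icc _ _

theorem zero_mem_cubeFace (S : Finset (Fin n)) : 0 ∈ cubeFace S :=
  ⟨le_rfl, fun i => by simp only [Pi.zero_apply]; split_ifs <;> norm_num⟩

theorem eq_zero_of_mem_cubeFace {S : Finset (Fin n)} {v : Fin n → ℝ} (hv : v ∈ cubeFace S)
    {i : Fin n} (hi : i ∉ S) : v i = 0 := by
  have h1 := hv.1 i
  have h2 := hv.2 i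
  simp only [if_neg hi] at h2
  exact le_antisymm h2 h1

theorem coordFun_eq_zero_of_mem_cubeFace {S : Finset (Fin n)} {e : Fin (m + 1) → Fin n}
    (he : ∀ i, e i ∉ S) (y : Fin (m + 1) → ℝ) {v : Fin n → ℝ} (hv : v ∈ cubeFace S) :
    coordFun e y v = 0 := by
  rw [coordFun_apply]
  exact Finset.sum_eq_zero fun i _ => by rw [eq_zero_of_mem_cubeFace hv (he i), mul_zero]

variable {e : ℕ → Fin (m + 1) → Fin n} {y : ℕ → Fin (m + 1) → ℝ} {l : ℕ}

theorem isCompact_region_add (S : Finset (Fin n)) : IsCompact (region e y l + cubeFace S) :=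
  isCompact_region.add (isCompact_cubeFace S)

theorem volume_region_succ_add_le (S : Finset (Fin n)) :
    volume.real (region e y (l + 1) + cubeFace S) ≤ volume.real (region e y l + cubeFace S) :=
  measureReal_mono (Set.add_subset_add_right region_succ_subset)
    (isCompact_region_add S).measure_lt_top.ne

theorem volume_region_succ_add_le_mul {S : Finset (Fin n)} (he : Function.Injective (e l))
    (heS : ∀ i, e l i ∉ S) (hy : y l ≠ 0) (h0 : volume (region e y l) ≠ 0) :
    volume.real (region e y (l + 1) + cubeFace S) ≤
      (1 - ((1 / 2) ^ (n + 2)) ^ n) * volume.real (region e y l + cubeFace S) := by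
  refine le_trans (measureReal_mono ?_ ?_) (volume_inter_halfspace_le (K := region e y l + cubeFace S)
    isCompact_region convex_region h0 (isCompact_region_add S)
    (convex_region.add (convex_cubeFace S))
    (fun z hz => ⟨z, hz, 0, zero_mem_cubeFace S, add_zero z⟩) (coordFun_ne_zero he hy) ?_)
  · rintro _ ⟨z, hz, v, hv, rfl⟩
    refine ⟨⟨z, hz.1, v, hv, rfl⟩, ?_⟩
    have h2 := hz.2
    rw [Set.mem_ofPred_eq] at h2 ⊢
    simp only [map_add, coordFun_eq_zero_of_mem_cubeFace heS _ hv, add_zero]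
    exact h2
  · exact (measure_mono Set.inter_subset_left |>.trans_lt
      (isCompact_region_add S).measure_lt_top).ne
  · rintro _ ⟨z, hz, v, hv, rfl⟩
    refine ⟨z, hz, ?_⟩
    simp only [map_add, coordFun_eq_zero_of_mem_cubeFace heS _ hv, add_zero]

theorem volume_Icc_zero_add_le (S : Finset (Fin n)) :
    volume.real (Set.Icc (0 : Fin n → ℝ) 1 + cubeFace S) ≤ 2 ^ n := by
  have h : volume.real (Set.Icc (0 : Fin n → ℝ) fun _ => 2) = 2 ^ n := by
    rw [Measure.real, Real.volume_Icc_pi]; simp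
  rw [← h]
  refine measureReal_mono ?_ isCompact_Icc.measure_lt_top.ne
  rintro _ ⟨z, hz, v, hv, rfl⟩
  refine ⟨fun i => add_nonneg (hz.1 i) (hv.1 i), fun i => ?_⟩
  have h1 : z i ≤ 1 := hz.2 i
  have h2 : v i ≤ 1 := (hv.2 i).trans (by beta_reduce; split_ifs <;> norm_num)
  simp only [Pi.add_apply]
  linarith

open Classical in
theorem volume_region_add_le (he : ∀ j, Function.Injective (e j)) (S : Finset (Fin n))
    (hy : ∀ j < l, y j ≠ 0) :
    volume.real (region e y l + cubeFace S) ≤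
      (1 - ((1 / 2) ^ (n + 2)) ^ n) ^ ((Finset.range l).filter fun j => ∀ i, e j i ∉ S).card *
        2 ^ n := by
  induction l with
  | zero => simpa [region] using volume_Icc_zero_add_le S
  | succ l ih =>
    have hy' : ∀ j < l, y j ≠ 0 := fun j hj => hy j (by omega)
    have ih' := ih hy'
    rw [Finset.range_add_one, Finset.filter_insert]
    split_ifs with h
    · rw [Finset.card_insert_of_notMem (by simp), pow_succ']
      refine (volume_region_succ_add_le_mul (he l) h (hy l (by omega))
        (volume_region_ne_zero he hy')).trans ?_
      rw [mul_assoc]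
      refine mul_le_mul_of_nonneg_left ih' (sub_nonneg.2 ?_)
      exact pow_le_one₀ (by positivity) (pow_le_one₀ (by norm_num) (by norm_num))
    · exact (volume_region_succ_add_le S).trans ih'

theorem exists_thin_regions (hmn : m + 1 ≤ n) {δ : ℝ} (hδ : 0 < δ) :
    ∃ (k : ℕ) (e : ℕ → Fin (m + 1) → Fin n), (∀ j, Function.Injective (e j)) ∧
      ∀ y : ℕ → Fin (m + 1) → ℝ, (∀ j < k, y j ≠ 0) → ∀ S : Finset (Fin n),
        S.card + m + 1 ≤ n → volume.real (region e y k + cubeFace S) ≤ δ := by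
  classical
  let q : ℝ := 1 - ((1 / 2) ^ (n + 2)) ^ n
  have hq0 : 0 ≤ q := sub_nonneg.2
    (pow_le_one₀ (by positivity) (pow_le_one₀ (by norm_num) (by norm_num)))
  have hq1 : q < 1 := sub_lt_self _ (by positivity)
  obtain ⟨L, hL⟩ := exists_pow_lt_of_lt_one (show 0 < δ / 2 ^ n by positivity) hq1
  let I := {f : Fin (m + 1) → Fin n // Function.Injective f}
  have hI : Nonempty I := ⟨⟨Fin.castLE hmn, Fin.castLE_injective hmn⟩⟩
  let N := Fintype.card I
  have hN : 0 < N := Fintype.card_pos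
  let E : I ≃ Fin N := Fintype.equivFin I
  refine ⟨N * L, fun j => (E.symm ⟨j % N, Nat.mod_lt _ hN⟩).1, fun j => Subtype.prop _, ?_⟩
  intro y hy S hS
  have hcard : Fintype.card (Fin (m + 1)) ≤ Fintype.card {i // i ∉ S} := by
    rw [Fintype.card_subtype_compl, Fintype.card_fin, Fintype.card_fin, Fintype.card_coe]
    omega
  obtain ⟨g⟩ := Function.Embedding.nonempty_of_card_le hcard
  let f : I := ⟨fun i => (g i).1, Subtype.val_injective.comp g.injective⟩
  refine (volume_region_add_le (fun j => Subtype.prop _) S hy).trans ?_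
  have hLc : L ≤ ((Finset.range (N * L)).filter fun j =>
      ∀ i, (E.symm ⟨j % N, Nat.mod_lt _ hN⟩).1 i ∉ S).card := by
    conv_lhs => rw [← Finset.card_range L]
    refine Finset.card_le_card_of_injOn (fun i => (E f).1 + N * i) ?_ ?_
    · intro i hi
      have hi' : i < L := by simpa using hi
      simp only [Finset.coe_filter, Finset.mem_range, Set.mem_ofPred_eq]
      constructor
      · calc (E f).1 + N * i < N + N * i := by have := (E f).2; omega
          _ = N * (i + 1) := by ring
          _ ≤ N * L := Nat.mul_le_mul_left _ hi'
      · intro j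
        have h1 : (⟨((E f).1 + N * i) % N, Nat.mod_lt _ hN⟩ : Fin N) = E f := by
          ext
          simp [Nat.add_mul_mod_self_left, Nat.mod_eq_of_lt (E f).2]
        rw [h1, Equiv.symm_apply_apply]
        exact (g j).2
    · intro i _ j _ hij
      have : N * i = N * j := by simpa using hij
      exact Nat.eq_of_mul_eq_mul_left hN this
  calc _ ≤ q ^ L * 2 ^ n := by
        gcongr ?_ * _
        exact pow_le_pow_of_le_one hq0 hq1.le hLc
    _ ≤ δ := by
        rw [← le_div_iff₀ (by positivity)]
        exact hL.le

end thinning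

section steiner

open Pointwise

variable {n : ℕ}

/-- The coordinate face of side length `ε` spanned by the directions in `S`. -/
def scaledFace (ε : ℝ) (S : Finset (Fin n)) : Set (Fin n → ℝ) :=
  Set.Icc 0 fun i => if i ∈ S then ε else 0

theorem isCompact_scaledFace (ε : ℝ) (S : Finset (Fin n)) : IsCompact (scaledFace ε S) :=
  isCompact_Icc

theorem convex_scaledFace (ε : ℝ) (S : Finset (Fin n)) : Convex ℝ (scaledFace ε S) :=
  convex_Icc _ _

theorem Icc_zero_add_Icc_zero {a b : Fin n → ℝ} (ha : 0 ≤ a) (hb : 0 ≤ b) :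
    Set.Icc 0 a + Set.Icc 0 b = Set.Icc 0 (a + b) := by
  ext z
  constructor
  · rintro ⟨u, hu, v, hv, rfl⟩
    exact ⟨add_nonneg hu.1 hv.1, add_le_add hu.2 hv.2⟩
  · intro hz
    refine ⟨z ⊓ a, ⟨le_inf hz.1 ha, inf_le_right⟩, z - z ⊓ a, ⟨sub_nonneg.2 inf_le_left, ?_⟩,
      by simp⟩
    intro i
    have h1 := hz.2 i
    have h2 := hb i
    simp only [Pi.sub_apply, Pi.inf_apply, Pi.add_apply, Pi.zero_apply] at *
    rcases le_total (z i) (a i) with h | h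
    · rw [inf_eq_left.2 h]; linarith
    · rw [inf_eq_right.2 h]; linarith

theorem scaledFace_insert {ε : ℝ} (hε : 0 ≤ ε) {S : Finset (Fin n)} {i : Fin n} (hi : i ∉ S) :
    scaledFace ε (insert i S) = scaledFace ε S + scaledFace ε {i} := by
  have h0 : ∀ T : Finset (Fin n), (0 : Fin n → ℝ) ≤ fun j => if j ∈ T then ε else 0 := by
    intro T j
    simp only [Pi.zero_apply]
    split_ifs <;> simp [hε]
  rw [scaledFace, scaledFace, scaledFace, Icc_zero_add_Icc_zero (h0 S) (h0 _)]
  congr 1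
  ext j
  simp only [Pi.add_apply, Finset.mem_insert, Finset.mem_singleton]
  by_cases hj : j = i
  · subst hj; simp [hi]
  · simp [hj]

theorem mem_scaledFace_singleton {ε : ℝ} {i : Fin n} {v : Fin n → ℝ} :
    v ∈ scaledFace ε {i} ↔ ∃ t, 0 ≤ t ∧ t ≤ ε ∧ v = t • Pi.single i 1 := by
  constructor
  · intro hv
    have h2 := hv.2 i
    simp only [Finset.mem_singleton, if_true] at h2
    refine ⟨v i, hv.1 i, h2, ?_⟩
    ext j
    by_cases hj : j = i
    · subst hj; simp
    · have h3 := hv.2 j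
      have h4 := hv.1 j
      simp only [Finset.mem_singleton, if_neg hj] at h3
      simp only [Pi.smul_apply, Pi.single_eq_of_ne hj, smul_zero]
      exact le_antisymm h3 h4
  · rintro ⟨t, h0, h1, rfl⟩
    constructor
    · intro j
      by_cases hj : j = i
      · subst hj; simpa
      · simp [hj]
    · intro j
      by_cases hj : j = i
      · subst hj; simpa
      · simp [hj]

/-- A convex body grows concavely when it is swept along a segment. -/
theorem volume_add_scaledFace_singleton_le {C : Set (Fin n → ℝ)} (hC : IsCompact C)
    (hCc : Convex ℝ C) (i : Fin n) {N : ℕ} (hN : 0 < N) :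
    volume.real (C + scaledFace (1 / N) {i}) ≤
      volume.real C + 1 / N * volume.real (C + scaledFace 1 {i}) := by
  have hN' : (0 : ℝ) < N := by exact_mod_cast hN
  set v : Fin n → ℝ := Pi.single i 1 with hv
  have hF : ∀ ε : ℝ, IsCompact (C + scaledFace ε {i}) := fun ε => hC.add isCompact_Icc
  let D := (C + scaledFace (1 / N) {i}) \ C
  have hD : MeasurableSet D := (hF _).measurableSet.diff hC.measurableSet
  have hDs : ∀ z ∈ D, ∃ t, 0 ≤ t ∧ t ≤ 1 / (N : ℝ) ∧ z - t • v ∈ C ∧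
      ∀ s : ℝ, 0 ≤ s → z + s • v ∉ C := by
    rintro z ⟨⟨c, hc, u, hu, rfl⟩, hz⟩
    obtain ⟨t, h0, h1, rfl⟩ := mem_scaledFace_singleton.1 hu
    refine ⟨t, h0, h1, by
      change c + t • v - t • v ∈ C
      rwa [add_sub_cancel_right], ?_⟩
    intro s hs hcon
    apply hz
    rcases h0.eq_or_lt with h00 | h00
    · simpa [← h00] using hc
    have hts : 0 < t + s := by linarith
    have := hCc hc hcon (a := s / (t + s)) (b := t / (t + s)) (by positivity) (by positivity)
      (by field_simp; ring)
    convert this using 1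
    beta_reduce
    rw [smul_add, smul_add, ← add_assoc, ← add_assoc, ← add_smul, smul_smul, smul_smul, add_assoc,
      ← add_smul, show s / (t + s) + t / (t + s) = 1 by field_simp; ring,
      show t / (t + s) * t + t / (t + s) * s = t by field_simp, one_smul]
  let Dj : ℕ → Set (Fin n → ℝ) := fun j => (fun z => z + (j / N : ℝ) • v) '' D
  have hDjv : ∀ j, volume (Dj j) = volume D := fun j => by
    simp only [Dj, Set.image_add_right, measure_preimage_add_right]
  have hDjm : ∀ j, MeasurableSet (Dj j) := fun j => by
    simp only [Dj, Set.image_add_right]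
    exact hD.preimage (by fun_prop)
  have hdisj : ∀ j j', j < j' → Disjoint (Dj j) (Dj j') := by
    intro j j' hjj
    rw [Set.disjoint_left]
    rintro _ ⟨z0, hz0, rfl⟩ ⟨z1, hz1, h⟩
    obtain ⟨t, ht0, ht1, htC, -⟩ := hDs z0 hz0
    obtain ⟨-, -, -, -, hs⟩ := hDs z1 hz1
    have hle : (j : ℝ) / N + 1 / N ≤ j' / N := by
      rw [← add_div]
      gcongr
      exact_mod_cast hjj
    apply hs ((j' : ℝ) / N - j / N - t) (by linarith)
    convert htC using 1
    have : z0 = z1 + (j' / N : ℝ) • v - (j / N : ℝ) • v := by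
      beta_reduce at h
      rw [h]; simp
    rw [this]
    module
  have hsub : ∀ j < N, Dj j ⊆ C + scaledFace 1 {i} := by
    rintro j hj _ ⟨z, hz, rfl⟩
    obtain ⟨t, ht0, ht1, htC, -⟩ := hDs z hz
    refine ⟨_, htC, (t + j / N) • v, mem_scaledFace_singleton.2 ⟨_, by positivity, ?_, rfl⟩, ?_⟩
    · have : (j : ℝ) + 1 ≤ N := by exact_mod_cast hj
      calc t + j / N ≤ 1 / N + j / N := by gcongr
        _ = (j + 1) / N := by ring
        _ ≤ 1 := by rw [div_le_one hN']; exact this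
    · beta_reduce; module
  have hsum : (N : ℝ) * volume.real D ≤ volume.real (C + scaledFace 1 {i}) := by
    have h1 := measure_biUnion_finset (μ := volume) (s := Finset.range N) (f := Dj)
      (fun j _ j' _ hne => by
        rcases lt_or_gt_of_ne hne with h | h
        · exact hdisj _ _ h
        · exact (hdisj _ _ h).symm) (fun j _ => hDjm j)
    simp only [hDjv, Finset.sum_const, Finset.card_range, nsmul_eq_mul] at h1
    have h2 : (N : ℝ≥0∞) * volume D ≤ volume (C + scaledFace 1 {i}) := by
      rw [← h1]
      exact measure_mono (Set.iUnion₂_subset fun j hj => hsub j (Finset.mem_range.1 hj))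
    have h3 := ENNReal.toReal_mono (hF 1).measure_lt_top.ne h2
    rwa [ENNReal.toReal_mul, ENNReal.toReal_natCast] at h3
  have hDt : volume D ≠ ⊤ := (measure_mono Set.sdiff_subset |>.trans_lt (hF _).measure_lt_top).ne
  calc volume.real (C + scaledFace (1 / N) {i}) ≤ volume.real (C ∪ D) := by
        refine measureReal_mono (fun z hz => ?_)
          (measure_union_lt_top hC.measure_lt_top (lt_top_iff_ne_top.2 hDt)).ne
        by_cases h : z ∈ C
        · exact Or.inl h
        · exact Or.inr ⟨hz, h⟩
    _ ≤ volume.real C + volume.real D := measureReal_union_le _ _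
    _ ≤ _ := by
        gcongr
        rw [one_div, ← div_eq_inv_mul, le_div_iff₀ hN']
        linarith

theorem volume_add_scaledFace_le {N : ℕ} (hN : 0 < N) (T : Finset (Fin n)) :
    ∀ {A : Set (Fin n → ℝ)}, IsCompact A → Convex ℝ A →
    volume.real (A + scaledFace (1 / N) T) ≤
      ∑ S ∈ T.powerset, (1 / N : ℝ) ^ S.card * volume.real (A + cubeFace S) := by
  induction T using Finset.induction_on with
  | empty =>
    intro A hA hAc
    have h : scaledFace (1 / N) (∅ : Finset (Fin n)) = cubeFace ∅ := by
      simp [scaledFace, cubeFace]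
    rw [h]
    simp
  | insert i T hi ih =>
    intro A hA hAc
    rw [scaledFace_insert (by positivity) hi, ← add_assoc, Finset.sum_powerset_insert hi]
    refine (volume_add_scaledFace_singleton_le
      (hA.add (isCompact_scaledFace _ T))
      (hAc.add (convex_scaledFace _ T)) i hN).trans ?_
    refine add_le_add (ih hA hAc) ?_
    rw [add_assoc, add_comm (scaledFace _ T), ← add_assoc]
    have h1 := ih (hA.add (isCompact_scaledFace 1 {i}))
      (hAc.add (convex_scaledFace 1 {i}))
    refine (mul_le_mul_of_nonneg_left h1 (by positivity)).trans (le_of_eq ?_)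
    rw [Finset.mul_sum]
    refine Finset.sum_congr rfl fun S hS => ?_
    have hiS : i ∉ S := fun h => hi (Finset.mem_powerset.1 hS h)
    rw [Finset.card_insert_of_notMem hiS, pow_succ', mul_assoc, add_assoc,
      show cubeFace (insert i S) = scaledFace 1 (insert i S) from rfl,
      scaledFace_insert zero_le_one hiS, add_comm (scaledFace 1 S)]
    rfl

theorem volume_closedBall_add_cubeFace_le (z : Fin n → ℝ) {R : ℝ} (hR : 0 ≤ R)
    (S : Finset (Fin n)) :
    volume.real (Metric.closedBall z R + cubeFace S) ≤
      (2 * R) ^ (n - S.card) * (1 + 2 * R) ^ n := by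
  have hsub : Metric.closedBall z R + cubeFace S ⊆
      Set.Icc (fun i => z i - R) fun i => z i + R + if i ∈ S then 1 else 0 := by
    rintro _ ⟨u, hu, v, hv, rfl⟩
    rw [Metric.mem_closedBall, dist_pi_le_iff hR] at hu
    constructor <;> intro i
    · have h1 := hu i
      have h2 : 0 ≤ v i := hv.1 i
      rw [Real.dist_eq, abs_le] at h1
      simp only [Pi.add_apply]
      linarith
    · have h1 := hu i
      have h2 : v i ≤ _ := hv.2 i
      rw [Real.dist_eq, abs_le] at h1
      simp only [Pi.add_apply]
      linarith
  refine (measureReal_mono hsub isCompact_Icc.measure_lt_top.ne).trans ?_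
  have hnn : ∀ i : Fin n, 0 ≤ 2 * R + if i ∈ S then 1 else 0 := fun i => by
    split_ifs <;> linarith
  have hvol : volume.real (Set.Icc (fun i => z i - R) fun i => z i + R + if i ∈ S then 1 else 0) =
      ∏ i, (2 * R + if i ∈ S then 1 else 0) := by
    rw [Measure.real, Real.volume_Icc_pi, ← ENNReal.ofReal_prod_of_nonneg, ENNReal.toReal_ofReal]
    · exact Finset.prod_congr rfl fun i _ => by ring
    · exact Finset.prod_nonneg fun i _ => by have := hnn i; linarith
    · intro i _
      have := hnn i; linarith
  rw [hvol, ← Finset.prod_mul_prod_compl S, mul_comm]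
  have h1 : ∏ i ∈ S, (2 * R + if i ∈ S then 1 else 0) = (1 + 2 * R) ^ S.card := by
    rw [← Finset.prod_const]
    exact Finset.prod_congr rfl fun i hi => by rw [if_pos hi]; ring
  have h2 : ∏ i ∈ Sᶜ, (2 * R + if i ∈ S then 1 else 0) = (2 * R) ^ (n - S.card) := by
    rw [show n - S.card = Sᶜ.card by rw [Finset.card_compl, Fintype.card_fin],
      ← Finset.prod_const]
    exact Finset.prod_congr rfl fun i hi => by rw [if_neg (Finset.mem_compl.1 hi)]; ring
  rw [h1, h2]
  gcongr
  · linarith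
  · exact card_finset_fin_le S

theorem volume_add_closedBall_le {m : ℕ} {P : Set (Fin n → ℝ)} (hP : IsCompact P)
    (hPc : Convex ℝ P) {N : ℕ} (hN : 0 < N) {β δ : ℝ} (hβ : 1 ≤ β)
    (hthin : ∀ S : Finset (Fin n), S.card + m + 1 ≤ n → volume.real (P + cubeFace S) ≤ δ)
    (hδ : 0 ≤ δ) (z : Fin n → ℝ) :
    volume.real (P ∩ Metric.closedBall z (1 / N * β / 2) + Metric.closedBall 0 (1 / N / 2)) ≤
      2 ^ n * (δ + (1 / N) ^ n * β ^ m * (1 + 1 / N * β) ^ n) := by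
  have hε0 : (0 : ℝ) < 1 / N := by positivity
  have hε1 : (1 : ℝ) / N ≤ 1 := by
    rw [div_le_one (by positivity)]
    exact_mod_cast hN
  set A := P ∩ Metric.closedBall z (1 / N * β / 2) with hA
  have hAk : IsCompact A := hP.inter_right Metric.isClosed_closedBall
  have hAc : Convex ℝ A := hPc.inter (convex_closedBall _ _)
  have hball : Metric.closedBall (0 : Fin n → ℝ) (1 / N / 2) =
      (fun u => u + fun _ => -(1 / N / 2 : ℝ)) '' scaledFace (1 / N) Finset.univ := by
    rw [Set.image_add_right, scaledFace]
    ext u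
    rw [mem_closedBall_zero_iff, pi_norm_le_iff_of_nonneg (by positivity)]
    simp only [Finset.mem_univ, if_true, Set.mem_preimage, Set.mem_Icc, Pi.le_def, Pi.add_apply,
      Pi.neg_apply, Pi.zero_apply, Real.norm_eq_abs, abs_le, neg_neg]
    constructor
    · intro h
      exact ⟨fun i => by linarith [(h i).1], fun i => by linarith [(h i).2]⟩
    · intro h i
      constructor <;> linarith [h.1 i, h.2 i]
  have htr : A + Metric.closedBall 0 (1 / N / 2) =
      (fun u => u + fun _ => -(1 / N / 2 : ℝ)) '' (A + scaledFace (1 / N) Finset.univ) := by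
    rw [hball]
    ext u
    simp only [Set.mem_add, Set.mem_image]
    constructor
    · rintro ⟨a, ha, _, ⟨b, hb, rfl⟩, rfl⟩
      exact ⟨a + b, ⟨a, ha, b, hb, rfl⟩, by abel⟩
    · rintro ⟨_, ⟨a, ha, b, hb, rfl⟩, rfl⟩
      exact ⟨a, ha, _, ⟨b, hb, rfl⟩, by abel⟩
  have hv : volume.real (A + Metric.closedBall 0 (1 / N / 2)) =
      volume.real (A + scaledFace (1 / N) Finset.univ) := by
    rw [htr, Set.image_add_right, Measure.real, measure_preimage_add_right]
    rfl
  rw [hv]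
  refine (volume_add_scaledFace_le hN _ hAk hAc).trans ?_
  have hcard : ((Finset.univ : Finset (Fin n)).powerset).card = 2 ^ n := by simp
  rw [show (2 : ℝ) ^ n = ((Finset.univ : Finset (Fin n)).powerset.card : ℝ) by
    rw [hcard]; simp, ← nsmul_eq_mul]
  apply Finset.sum_le_card_nsmul
  intro S _
  have hSn : S.card ≤ n := card_finset_fin_le S
  by_cases hS : S.card + m + 1 ≤ n
  · have h1 : volume.real (A + cubeFace S) ≤ δ :=
      (measureReal_mono (Set.add_subset_add_right Set.inter_subset_left)
        (hP.add (isCompact_cubeFace S)).measure_lt_top.ne).trans (hthin S hS)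
    have h2 : (1 / N : ℝ) ^ S.card * volume.real (A + cubeFace S) ≤ 1 * δ := by
      gcongr
      exact pow_le_one₀ hε0.le hε1
    have h3 : 0 ≤ (1 / N : ℝ) ^ n * β ^ m * (1 + 1 / N * β) ^ n := by positivity
    linarith
  · have h1 : volume.real (A + cubeFace S) ≤
        (1 / N * β) ^ (n - S.card) * (1 + 1 / N * β) ^ n := by
      refine (measureReal_mono (Set.add_subset_add_right Set.inter_subset_right)
        ((isCompact_closedBall _ _).add (isCompact_cubeFace S)).measure_lt_top.ne).trans ?_
      have := volume_closedBall_add_cubeFace_le z (R := 1 / N * β / 2) (by positivity) S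
      rwa [show 2 * (1 / N * β / 2) = 1 / N * β by ring] at this
    calc (1 / N : ℝ) ^ S.card * volume.real (A + cubeFace S)
        ≤ (1 / N) ^ S.card * ((1 / N * β) ^ (n - S.card) * (1 + 1 / N * β) ^ n) := by gcongr
      _ = (1 / N) ^ n * β ^ (n - S.card) * (1 + 1 / N * β) ^ n := by
          rw [mul_pow, ← mul_assoc, ← mul_assoc, ← pow_add, Nat.add_sub_cancel' hSn]
      _ ≤ (1 / N) ^ n * β ^ m * (1 + 1 / N * β) ^ n := by
          gcongr
          omega
      _ ≤ _ := by linarith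

end steiner

section overlap

open Pointwise

variable {n : ℕ}

theorem lintegral_volume_slice_comm {S : Set ((Fin n → ℝ) × (Fin n → ℝ))} (hS : MeasurableSet S) :
    ∫⁻ y, volume {z | (y, z) ∈ S} = ∫⁻ z, volume {y | (y, z) ∈ S} :=
  (Measure.prod_apply (μ := (volume : Measure (Fin n → ℝ)))
    (ν := (volume : Measure (Fin n → ℝ))) hS).symm.trans (Measure.prod_apply_symm hS)

theorem volume_le_of_center {P : Set (Fin n → ℝ)} (hP : IsCompact P) (hP1 : P ⊆ Set.Icc 0 1)
    (hPc : Convex ℝ P) {η ρ κ V : ℝ} (hη : 0 < η) (hρ0 : 0 < ρ) (hρ1 : ρ < 1) (hκ : 0 ≤ κ)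
    {c : Fin n → ℝ} (hc : ∀ y, κ * locVol P η y ≤ locVol P η c)
    (hV : ∀ z, volume.real (P ∩ Metric.closedBall z (η / ρ + η) + Metric.closedBall 0 η) ≤ V) :
    κ * (1 - ρ) ^ n * (2 * η) ^ n * volume.real P ≤
      V * volume.real (P ∩ Set.Icc (fun i => (1 - ρ) * c i - 2 * η)
        (fun i => (1 - ρ) * c i + ρ + 2 * η)) := by
  set B := Set.Icc (fun i => (1 - ρ) * c i - 2 * η) (fun i => (1 - ρ) * c i + ρ + 2 * η) with hB
  have hρ' : 0 < 1 - ρ := by linarith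
  have hV0 : 0 ≤ V := measureReal_nonneg.trans (hV 0)
  have hPt : ∀ s, volume (P ∩ s) ≠ ⊤ := fun s =>
    (measure_mono Set.inter_subset_left |>.trans_lt hP.measure_lt_top).ne
  let D := P + Metric.closedBall (0 : Fin n → ℝ) η
  have hDk : IsCompact D := hP.add (isCompact_closedBall _ _)
  have hD : ∀ y, y ∈ D ↔ (P ∩ Metric.closedBall y η).Nonempty := by
    intro y
    constructor
    · rintro ⟨p, hp, u, hu, rfl⟩
      refine ⟨p, hp, ?_⟩
      rw [mem_closedBall_zero_iff] at hu
      simpa [dist_eq_norm] using hu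
    · rintro ⟨p, hp, hpy⟩
      refine ⟨p, hp, y - p, ?_, by simp⟩
      rw [mem_closedBall_zero_iff, ← dist_eq_norm, dist_comm]
      exact hpy
  let S₁ : Set ((Fin n → ℝ) × (Fin n → ℝ)) := {q | q.2 ∈ P ∧ dist q.2 q.1 ≤ η}
  let S₂ : Set ((Fin n → ℝ) × (Fin n → ℝ)) :=
    {q | q.1 ∈ D ∧ q.2 ∈ P ∧ dist q.2 ((1 - ρ) • c + ρ • q.1) ≤ η}
  have hS₁ : MeasurableSet S₁ := by
    refine IsClosed.measurableSet ((hP.isClosed.preimage continuous_snd).inter ?_)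
    exact isClosed_le (f := fun q : (Fin n → ℝ) × (Fin n → ℝ) => dist q.2 q.1) (g := fun _ => η)
      (by fun_prop) (by fun_prop)
  have hS₂ : MeasurableSet S₂ := by
    refine IsClosed.measurableSet ((hDk.isClosed.preimage continuous_fst).inter
      ((hP.isClosed.preimage continuous_snd).inter ?_))
    exact isClosed_le
      (f := fun q : (Fin n → ℝ) × (Fin n → ℝ) => dist q.2 ((1 - ρ) • c + ρ • q.1))
      (g := fun _ => η) (by fun_prop) (by fun_prop)
  have e1 : ∀ y, {z | (y, z) ∈ S₁} = P ∩ Metric.closedBall y η := fun y => rfl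
  have hI1 : ∫⁻ y, volume {z | (y, z) ∈ S₁} = ENNReal.ofReal ((2 * η) ^ n) * volume P := by
    rw [lintegral_volume_slice_comm hS₁]
    have : ∀ z, volume {y | (y, z) ∈ S₁} = P.indicator (fun _ => ENNReal.ofReal ((2 * η) ^ n)) z := by
      intro z
      by_cases hz : z ∈ P
      · rw [Set.indicator_of_mem hz, ← volumeReal_closedBall_pi (x := z) hη.le,
          ofReal_measureReal (isCompact_closedBall z η).measure_lt_top.ne]
        congr 1
        ext y
        constructor
        · intro h
          have := h.2
          rwa [dist_comm] at this
        · intro h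
          refine ⟨hz, ?_⟩
          rw [dist_comm]
          exact h
      · rw [Set.indicator_of_notMem hz]
        convert measure_empty (μ := (volume : Measure (Fin n → ℝ)))
        ext y
        simp only [Set.mem_empty_iff_false, iff_false]
        exact fun h => hz h.1
    simp only [this]
    rw [lintegral_indicator_const hP.measurableSet]
  have hI2 : ∫⁻ y, volume {z | (y, z) ∈ S₂} ≤ ENNReal.ofReal V * volume (P ∩ B) := by
    rw [lintegral_volume_slice_comm hS₂,
      ← lintegral_indicator_const (hP.measurableSet.inter measurableSet_Icc)]
    refine lintegral_mono fun z => ?_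
    beta_reduce
    by_cases hz : z ∈ P ∩ B
    · rw [Set.indicator_of_mem hz]
      let z' := ρ⁻¹ • (z - (1 - ρ) • c)
      have hz' : z = (1 - ρ) • c + ρ • z' := by
        simp only [z']
        rw [smul_inv_smul₀ hρ0.ne']
        abel
      have hsub : {y | (y, z) ∈ S₂} ⊆
          P ∩ Metric.closedBall z' (η / ρ + η) + Metric.closedBall 0 η := by
        rintro y ⟨hyD, -, hyz⟩
        obtain ⟨p, hp, u, hu, rfl⟩ := hyD
        have h1 : dist z' (p + u) ≤ η / ρ := by
          rw [le_div_iff₀ hρ0]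
          simp only at hyz
          rw [hz', dist_add_left, dist_smul₀, Real.norm_eq_abs, abs_of_pos hρ0] at hyz
          linarith
        refine ⟨p, ⟨hp, ?_⟩, u, hu, rfl⟩
        rw [mem_closedBall_zero_iff] at hu
        have h2 : dist p (p + u) ≤ η := by simpa [dist_eq_norm] using hu
        calc dist p z' ≤ dist p (p + u) + dist (p + u) z' := dist_triangle _ _ _
          _ ≤ η / ρ + η := by rw [dist_comm (p + u)]; linarith
      refine (measure_mono hsub).trans ?_
      rw [← ofReal_measureReal (((hP.inter_right Metric.isClosed_closedBall).add
        (isCompact_closedBall _ _)).measure_lt_top.ne)]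
      exact ENNReal.ofReal_le_ofReal (hV z')
    · rw [Set.indicator_of_notMem hz, nonpos_iff_eq_zero]
      convert measure_empty (μ := (volume : Measure (Fin n → ℝ)))
      ext y
      simp only [Set.mem_empty_iff_false, iff_false]
      rintro ⟨hyD, hzP, hyz⟩
      refine hz ⟨hzP, ?_⟩
      obtain ⟨p, hp, u, hu, rfl⟩ := hyD
      simp only at hyz
      rw [dist_pi_le_iff hη.le] at hyz
      rw [mem_closedBall_zero_iff, pi_norm_le_iff_of_nonneg hη.le] at hu
      constructor <;> intro i
      all_goals
        have h1 := hyz i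
        have h2 := hu i
        have h3 : 0 ≤ p i := (hP1 hp).1 i
        have h4 : p i ≤ 1 := (hP1 hp).2 i
        rw [Real.dist_eq, abs_le] at h1
        rw [Real.norm_eq_abs, abs_le] at h2
        simp only [Pi.add_apply, Pi.smul_apply, smul_eq_mul] at h1
        nlinarith [mul_nonneg hρ0.le h3, mul_nonneg hρ0.le (sub_nonneg.2 h4),
          mul_nonneg hρ0.le (neg_le_iff_add_nonneg'.1 h2.1),
          mul_nonneg hρ0.le (sub_nonneg.2 h2.2), mul_pos hη hρ', h1.1, h1.2]
  have hpt : ∀ y, ENNReal.ofReal (κ * (1 - ρ) ^ n) * volume {z | (y, z) ∈ S₁} ≤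
      volume {z | (y, z) ∈ S₂} := by
    intro y
    rw [e1]
    by_cases hy : y ∈ D
    · have e2 : {z | (y, z) ∈ S₂} = P ∩ Metric.closedBall ((1 - ρ) • c + ρ • y) η := by
        ext z
        exact ⟨fun h => h.2, fun h => ⟨hy, h⟩⟩
      rw [e2, ← ofReal_measureReal (hPt _), ← ofReal_measureReal (hPt _),
        ← ENNReal.ofReal_mul (by positivity)]
      refine ENNReal.ofReal_le_ofReal ?_
      have h1 := pow_mul_locVol_le (η := η) (x := c) (y := y) hPc hρ0.le hρ1 ((hD y).1 hy)
      have h2 := mul_le_mul_of_nonneg_left (hc y) (pow_nonneg hρ'.le n)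
      rw [locVol] at h1 h2
      simp only [locVol] at h1 h2
      linarith
    · have : P ∩ Metric.closedBall y η = ∅ := by
        rw [← Set.not_nonempty_iff_eq_empty, ← hD]
        exact hy
      simp [this]
  have hfin : ENNReal.ofReal (κ * (1 - ρ) ^ n) * (ENNReal.ofReal ((2 * η) ^ n) * volume P) ≤
      ENNReal.ofReal V * volume (P ∩ B) := by
    rw [← hI1, ← lintegral_const_mul' _ _ ENNReal.ofReal_ne_top]
    exact (lintegral_mono hpt).trans hI2
  have h := ENNReal.toReal_mono (ENNReal.mul_ne_top ENNReal.ofReal_ne_top (hPt _)) hfin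
  rw [ENNReal.toReal_mul, ENNReal.toReal_mul, ENNReal.toReal_mul, ENNReal.toReal_ofReal hV0,
    ENNReal.toReal_ofReal (by positivity), ENNReal.toReal_ofReal (by positivity)] at h
  rw [Measure.real, Measure.real]
  linarith

end overlap

section waist

open Pointwise

variable {n m : ℕ}

/-- The coordinatewise retraction of `ℝⁿ` onto the unit cube. -/
def clampCube (z : Fin n → ℝ) : Fin n → ℝ := fun i => max 0 (min 1 (z i))

theorem clampCube_mem (z : Fin n → ℝ) : clampCube z ∈ Set.Icc (0 : Fin n → ℝ) 1 :=
  ⟨fun _ => le_max_left _ _, fun _ => max_le zero_le_one (min_le_left _ _)⟩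

theorem continuous_clampCube : Continuous (clampCube (n := n)) := by
  unfold clampCube
  fun_prop

theorem norm_sub_clampCube_le {p z : Fin n → ℝ} (hp : p ∈ Set.Icc (0 : Fin n → ℝ) 1) {η : ℝ}
    (h : ‖p - z‖ ≤ η) : ‖z - clampCube z‖ ≤ η := by
  have hη := (norm_nonneg _).trans h
  rw [pi_norm_le_iff_of_nonneg hη] at h ⊢
  intro i
  have h1 := h i
  have h2 : 0 ≤ p i := hp.1 i
  have h3 : p i ≤ 1 := hp.2 i
  simp only [Pi.sub_apply, Real.norm_eq_abs, abs_le, clampCube] at h1 ⊢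
  rcases le_total 1 (z i) with h4 | h4
  · rw [min_eq_left h4, max_eq_right zero_le_one]
    constructor <;> linarith
  · rw [min_eq_right h4]
    rcases le_total 0 (z i) with h5 | h5
    · rw [max_eq_right h5]
      constructor <;> linarith
    · rw [max_eq_left h5]
      constructor <;> linarith

/-- A tree of convex regions whose centers are all mapped to one point. -/
theorem exists_regions_centers_fiber (hm : 0 < m) (hmn : m + 1 ≤ n)
    {f : (Fin n → ℝ) → Fin m → ℝ} (hf : ContinuousOn f (Set.Icc 0 1)) {η κ δ : ℝ} (hη : 0 < η)
    (hκ0 : 0 < κ) (hκ1 : κ < 1) (hδ : 0 < δ) :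
    ∃ (k : ℕ) (P : (Fin k → Bool) → Set (Fin n → ℝ)) (c : (Fin k → Bool) → Fin n → ℝ),
      (∀ w, IsCompact (P w)) ∧ (∀ w, Convex ℝ (P w)) ∧ (∀ w, P w ⊆ Set.Icc 0 1) ∧
      1 ≤ ∑ w, volume.real (P w) ∧
      (∀ (s : Finset (Fin k → Bool)) (B : Set (Fin n → ℝ)), IsCompact B →
        ∑ w ∈ s, volume.real (P w ∩ B) ≤ volume.real B) ∧
      (∀ w (S : Finset (Fin n)), S.card + m + 1 ≤ n →
        volume.real (P w + cubeFace S) ≤ δ) ∧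
      (∀ w y, κ * locVol (P w) η y ≤ locVol (P w) η (c w)) ∧
      (∀ w, ‖c w - clampCube (c w)‖ ≤ η) ∧
      ∀ w w', f (clampCube (c w)) = f (clampCube (c w')) := by
  classical
  obtain ⟨k, e, he, hthin⟩ := exists_thin_regions (n := n) (m := m) hmn hδ
  let X := {u : Fin k → Fin (m + 1) → ℝ // ∀ j, ‖u j‖ = 1}
  have hX0 : ∀ u : X, ∀ j < k, extendSeq u.1 j ≠ 0 := by
    intro u j hj
    rw [extendSeq_of_lt _ hj, ← norm_ne_zero_iff, u.2]
    exact one_ne_zero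
  have hcs : Continuous fun u : X => extendSeq u.1 :=
    continuous_extendSeq.comp continuous_subtype_val
  obtain ⟨c, hc⟩ := exists_continuous_center (fun u : X => region e (extendSeq u.1) k)
    (fun _ => isClosed_region) (fun _ => convex_region)
    (fun u => volume_region_ne_zero he (hX0 u)) (fun _ => volume_region_ne_top)
    (fun u => (tendsto_volume_symmDiff_region he (hX0 u)).comp hcs.continuousAt) hη hκ0 hκ1
  let g : (Fin k → Fin (m + 1) → ℝ) → Fin m → ℝ := fun u =>
    if h : ∀ j, ‖u j‖ = 1 then f (clampCube (c ⟨u, h⟩)) else 0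
  have hg : ContinuousOn g {u | ∀ j, ‖u j‖ = 1} := by
    rw [continuousOn_iff_continuous_domRestrict]
    have h1 : Continuous fun u : X => f (clampCube (c u)) :=
      hf.comp_continuous (continuous_clampCube.comp c.continuous) fun u => clampCube_mem _
    refine h1.congr fun u => ?_
    have hu : ∀ j, ‖u.1 j‖ = 1 := u.2
    change _ = g u.1
    simp only [g, dif_pos hu]
    rfl
  obtain ⟨x, hx, hx1, hxg⟩ := tree_borsukUlam hm g hg
  have hx0 : ∀ w j, x w j ≠ 0 := fun w j => by
    rw [← norm_ne_zero_iff, hx1]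
    exact one_ne_zero
  refine ⟨k, fun w => region e (extendSeq (x w)) k, fun w => c ⟨x w, hx1 w⟩,
    fun _ => isCompact_region, fun _ => convex_region, fun _ => region_subset_Icc,
    one_le_sum_volume_region hx, fun s B hB => sum_volume_region_inter_le he hx hx0 s
      hB.measurableSet hB.measure_lt_top.ne, fun w S hS => hthin _ (hX0 ⟨x w, hx1 w⟩) S hS,
    fun w => hc ⟨x w, hx1 w⟩, fun w => ?_, fun w w' => ?_⟩
  · obtain ⟨y, hy⟩ := exists_locVol_pos (η := η)
      (volume_region_ne_zero he (hX0 ⟨x w, hx1 w⟩)) hη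
    have hpos := (mul_pos hκ0 hy).trans_le (hc ⟨x w, hx1 w⟩ y)
    have hne : (region e (extendSeq (x w)) k ∩
        Metric.closedBall (c ⟨x w, hx1 w⟩) η).Nonempty := by
      rw [Set.nonempty_iff_ne_empty]
      intro h
      simp [locVol, h] at hpos
    obtain ⟨p, hp, hpc⟩ := hne
    rw [Metric.mem_closedBall, dist_eq_norm] at hpc
    exact norm_sub_clampCube_le (region_subset_Icc hp) hpc
  · have h := hxg w w'
    simp only [g, dif_pos (hx1 w), dif_pos (hx1 w')] at h
    exact h

theorem exists_fiber_cover_bound (hm : 0 < m) (hmn : m + 1 ≤ n)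
    {f : (Fin n → ℝ) → Fin m → ℝ} (hf : ContinuousOn f (Set.Icc 0 1)) {N : ℕ} (hN : 0 < N) :
    ∃ x ∈ Set.Icc (0 : Fin n → ℝ) 1, ∀ r : ℝ, 0 < r → r < 1 →
      ∀ (M : ℕ) (U : Fin M → Set (Fin n → ℝ)), (∀ i, ∀ a ∈ U i, ∀ b ∈ U i, ‖a - b‖ ≤ r) →
      (∀ a ∈ Set.Icc (0 : Fin n → ℝ) 1, f a = f x → ∃ i, a ∈ U i) →
      (1 - 1 / (N + 1)) * (1 - r) ^ n ≤
        2 ^ n * (1 / N + (1 + 1 / r) ^ m * (1 + 1 / N * (1 + 1 / r)) ^ n) *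
          (M * (3 * r + 4 * (1 / N)) ^ n) := by
  classical
  have hN' : (0 : ℝ) < N := by exact_mod_cast hN
  have hε : (0 : ℝ) < 1 / N := by positivity
  have hκ0 : (0 : ℝ) < 1 - 1 / (N + 1) := by
    rw [sub_pos, div_lt_one (by positivity)]
    linarith
  have hκ1 : (1 : ℝ) - 1 / (N + 1) < 1 := by
    have : (0 : ℝ) < 1 / (N + 1) := by positivity
    linarith
  obtain ⟨k, P, c, hP, hPc, hP1, hsum, hdis, hthin, hc, hclamp, hfib⟩ :=
    exists_regions_centers_fiber hm hmn hf (η := 1 / N / 2) (δ := (1 / N) ^ (n + 1))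
      (by positivity) hκ0 hκ1 (by positivity)
  refine ⟨clampCube (c fun _ => true), clampCube_mem _, ?_⟩
  intro r hr0 hr1 M U hU hcov
  set κ : ℝ := 1 - 1 / (N + 1) with hκ
  set K : ℝ := 2 ^ n * (1 / N + (1 + 1 / r) ^ m * (1 + 1 / N * (1 + 1 / r)) ^ n) with hK
  have hK0 : 0 ≤ K := by positivity
  let box : (Fin k → Bool) → Set (Fin n → ℝ) := fun w =>
    Set.Icc (fun i => (1 - r) * c w i - 2 * (1 / N / 2))
      fun i => (1 - r) * c w i + r + 2 * (1 / N / 2)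
  have hleaf : ∀ w, κ * (1 - r) ^ n * volume.real (P w) ≤ K * volume.real (P w ∩ box w) := by
    intro w
    have h1 := volume_le_of_center (hP w) (hP1 w) (hPc w) (η := 1 / N / 2) (ρ := r)
      (V := (1 / N) ^ n * K) (by positivity) hr0 hr1 hκ0.le (hc w) (fun z => by
        have h2 := volume_add_closedBall_le (hP w) (hPc w) hN (β := 1 + 1 / r)
          (by linarith [one_div_pos.2 hr0]) (hthin w) (by positivity) z
        rw [show (1 : ℝ) / N * (1 + 1 / r) / 2 = 1 / N / 2 / r + 1 / N / 2 by ring] at h2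
        refine h2.trans (le_of_eq ?_)
        rw [hK]
        ring)
    rw [show 2 * ((1 : ℝ) / N / 2) = 1 / N by ring] at h1
    have h3 : (0 : ℝ) < (1 / N) ^ n := by positivity
    simp only [box]
    rw [show 2 * ((1 : ℝ) / N / 2) = 1 / N by ring]
    refine le_of_mul_le_mul_left ?_ h3
    linarith
  have hin : ∀ w, ∃ i, clampCube (c w) ∈ U i := fun w => hcov _ (clampCube_mem _) (hfib w _)
  choose a ha using hin
  have hgroup : ∀ i : Fin M, ∑ w with a w = i, volume.real (P w ∩ box w) ≤
      (3 * r + 4 * (1 / N)) ^ n := by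
    intro i
    rcases (Finset.univ.filter fun w => a w = i).eq_empty_or_nonempty with h | ⟨w₀, hw₀⟩
    · rw [h, Finset.sum_empty]
      positivity
    have ha0 : a w₀ = i := (Finset.mem_filter.1 hw₀).2
    let B : Set (Fin n → ℝ) := Set.Icc (fun j => (1 - r) * c w₀ j - (r + 2 * (1 / N)))
      fun j => (1 - r) * c w₀ j + (2 * r + 2 * (1 / N))
    have hB : volume.real B = (3 * r + 4 * (1 / N)) ^ n := by
      simp only [B]
      rw [Measure.real, Real.volume_Icc_pi, ENNReal.toReal_prod]
      have : ∀ j : Fin n, (ENNReal.ofReal ((1 - r) * c w₀ j + (2 * r + 2 * (1 / N)) -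
          ((1 - r) * c w₀ j - (r + 2 * (1 / N))))).toReal = 3 * r + 4 * (1 / N) := fun j => by
        rw [ENNReal.toReal_ofReal]
        · ring
        · ring_nf
          positivity
      simp only [this, Finset.prod_const, Finset.card_univ, Fintype.card_fin]
    rw [← hB]
    refine le_trans (Finset.sum_le_sum fun w hw => ?_) (hdis _ B isCompact_Icc)
    refine measureReal_mono (Set.inter_subset_inter_right _ ?_)
      ((hP w).inter_right isClosed_Icc).measure_lt_top.ne
    have haw : a w = i := (Finset.mem_filter.1 hw).2
    have h1 := hU i _ (haw ▸ ha w) _ (ha0 ▸ ha w₀)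
    have h2 : ‖c w - c w₀‖ ≤ r + 1 / N := by
      have h3 := hclamp w
      have h4 := hclamp w₀
      calc ‖c w - c w₀‖ = ‖(c w - clampCube (c w)) + (clampCube (c w) - clampCube (c w₀)) -
            (c w₀ - clampCube (c w₀))‖ := by congr 1; abel
        _ ≤ ‖c w - clampCube (c w)‖ + ‖clampCube (c w) - clampCube (c w₀)‖ +
            ‖c w₀ - clampCube (c w₀)‖ :=
          (norm_sub_le _ _).trans (add_le_add_left (norm_add_le _ _) _)
        _ ≤ r + 1 / N := by linarith
    rw [pi_norm_le_iff_of_nonneg (by positivity)] at h2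
    apply Set.Icc_subset_Icc <;> intro j
    all_goals
      have h3 := h2 j
      rw [Pi.sub_apply, Real.norm_eq_abs, abs_le] at h3
      beta_reduce
      nlinarith [h3.1, h3.2, mul_pos hr0 (add_pos hr0 hε)]
  calc κ * (1 - r) ^ n ≤ κ * (1 - r) ^ n * ∑ w, volume.real (P w) := by
        refine le_mul_of_one_le_right ?_ hsum
        have : 0 < 1 - r := by linarith
        positivity
    _ ≤ K * ∑ w, volume.real (P w ∩ box w) := by
        rw [Finset.mul_sum, Finset.mul_sum]
        exact Finset.sum_le_sum fun w _ => hleaf w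
    _ = K * ∑ i, ∑ w with a w = i, volume.real (P w ∩ box w) := by
        rw [Finset.sum_fiberwise]
    _ ≤ K * ∑ i : Fin M, (3 * r + 4 * (1 / N)) ^ n := by
        gcongr with i
        exact hgroup i
    _ = _ := by simp

end waist

section covering

variable {n m : ℕ}

theorem isOpen_of_rOpen {U : Set (Fin n → ℝ)}
    (hU : ROpen (fun x y : Fin n → ℝ => ‖x - y‖) U) : IsOpen U := by
  rw [Metric.isOpen_iff]
  intro x hx
  obtain ⟨δ, hδ, h⟩ := hU x hx
  refine ⟨δ, hδ, fun y hy => h y ?_⟩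
  rw [Metric.mem_ball, dist_comm, dist_eq_norm] at hy
  exact hy

theorem rOpen_ball (x : Fin n → ℝ) (δ : ℝ) :
    ROpen (fun x y : Fin n → ℝ => ‖x - y‖) (Metric.ball x δ) := by
  intro y hy
  obtain ⟨ε, hε, h⟩ := Metric.isOpen_iff.1 Metric.isOpen_ball y hy
  refine ⟨ε, hε, fun z hz => h ?_⟩
  rw [Metric.mem_ball, dist_comm, dist_eq_norm]
  exact hz

theorem norm_sub_le_of_setEDiam_lt {U : Set (Fin n → ℝ)} {r : ℝ}
    (hU : setEDiam (fun x y : Fin n → ℝ => ‖x - y‖) U < ENNReal.ofReal r) {a b : Fin n → ℝ}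
    (ha : a ∈ U) (hb : b ∈ U) : ‖a - b‖ ≤ r := by
  have h : ENNReal.ofReal ‖a - b‖ ≤ setEDiam (fun x y : Fin n → ℝ => ‖x - y‖) U :=
    (le_iSup₂ (f := fun y (_ : y ∈ U) => ENNReal.ofReal ‖a - y‖) b hb).trans
      (le_iSup₂ (f := fun x (_ : x ∈ U) => ⨆ y ∈ U, ENNReal.ofReal ‖x - y‖) a ha)
  exact ((ENNReal.ofReal_lt_ofReal_iff_of_nonneg (norm_nonneg _)).1 (h.trans_lt hU)).le

theorem setEDiam_ball_lt (x : Fin n → ℝ) {r : ℝ} (hr : 0 < r) :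
    setEDiam (fun x y : Fin n → ℝ => ‖x - y‖) (Metric.ball x (r / 4)) < ENNReal.ofReal r := by
  refine lt_of_le_of_lt (b := ENNReal.ofReal (r / 2)) ?_
    ((ENNReal.ofReal_lt_ofReal_iff hr).2 (by linarith))
  refine iSup₂_le fun y hy => iSup₂_le fun z hz => ENNReal.ofReal_le_ofReal ?_
  beta_reduce
  rw [← dist_eq_norm]
  have h := dist_triangle_right y z x
  rw [Metric.mem_ball] at hy hz
  linarith

/-- The infimum defining the covering number of a subset of the cube is attained. -/
theorem exists_cover_covNum {E : Set (Fin n → ℝ)} (hE : E ⊆ Set.Icc 0 1) {r : ℝ} (hr : 0 < r) :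
    ∃ U : Fin (covNum (fun x y : Fin n → ℝ => ‖x - y‖) r E) → Set (Fin n → ℝ),
      (∀ i, IsOpen (U i)) ∧ (∀ i, ∀ a ∈ U i, ∀ b ∈ U i, ‖a - b‖ ≤ r) ∧ E ⊆ ⋃ i, U i := by
  have hne : {N : ℕ | ∃ U : Fin N → Set (Fin n → ℝ),
      (∀ i, ROpen (fun x y : Fin n → ℝ => ‖x - y‖) (U i)) ∧
      (∀ i, setEDiam (fun x y : Fin n → ℝ => ‖x - y‖) (U i) < ENNReal.ofReal r) ∧
      E ⊆ ⋃ i, U i}.Nonempty := by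
    obtain ⟨t, -, ht, hcov⟩ :=
      (isCompact_Icc (a := (0 : Fin n → ℝ)) (b := 1)).finite_cover_balls (e := r / 4) (by linarith)
    refine ⟨ht.toFinset.card, fun i => Metric.ball (ht.toFinset.equivFin.symm i : Fin n → ℝ) (r / 4),
      fun i => rOpen_ball _ _, fun i => setEDiam_ball_lt _ hr, fun z hz => ?_⟩
    obtain ⟨x, hx, hzx⟩ := Set.mem_iUnion₂.1 (hcov (hE hz))
    refine Set.mem_iUnion.2 ⟨ht.toFinset.equivFin ⟨x, ht.mem_toFinset.2 hx⟩, ?_⟩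
    rwa [Equiv.symm_apply_apply]
  obtain ⟨U, hU, hd, hc⟩ := Nat.sInf_mem hne
  exact ⟨U, fun i => isOpen_of_rOpen (hU i),
    fun i a ha b hb => norm_sub_le_of_setEDiam_lt (hd i) ha hb, hc⟩

theorem one_le_covNum {E : Set (Fin n → ℝ)} (hE : E ⊆ Set.Icc 0 1) (hne : E.Nonempty) {r : ℝ}
    (hr : 0 < r) : 1 ≤ covNum (fun x y : Fin n → ℝ => ‖x - y‖) r E := by
  obtain ⟨U, -, -, hc⟩ := exists_cover_covNum hE hr
  obtain ⟨z, hz⟩ := hne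
  obtain ⟨i, -⟩ := Set.mem_iUnion.1 (hc hz)
  exact Nat.one_le_iff_ne_zero.2 fun h => (h ▸ i).elim0

/-- Some fiber of a continuous map of the cube is hard to cover at every scale. -/
theorem exists_fiber_cover_bound_limit (hm : 0 < m) (hmn : m + 1 ≤ n)
    {f : (Fin n → ℝ) → Fin m → ℝ} (hf : ContinuousOn f (Set.Icc 0 1)) :
    ∃ q ∈ Set.Icc (0 : Fin n → ℝ) 1, ∀ r : ℝ, 0 < r → r < 1 →
      ∀ (M : ℕ) (U : Fin M → Set (Fin n → ℝ)), (∀ i, IsOpen (U i)) →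
      (∀ i, ∀ a ∈ U i, ∀ b ∈ U i, ‖a - b‖ ≤ r) →
      (∀ a ∈ Set.Icc (0 : Fin n → ℝ) 1, f a = f q → ∃ i, a ∈ U i) →
      (1 - r) ^ n ≤ 2 ^ n * (1 + 1 / r) ^ m * (M * (3 * r) ^ n) := by
  choose x hx hbound using fun ν : ℕ => exists_fiber_cover_bound hm hmn hf (Nat.succ_pos ν)
  obtain ⟨q, hq, φ, hφ, hlim⟩ := isCompact_Icc.tendsto_subseq hx
  refine ⟨q, hq, fun r hr0 hr1 M U hUo hUd hcov => ?_⟩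
  have hK : IsCompact (Set.Icc (0 : Fin n → ℝ) 1 \ ⋃ i, U i) :=
    IsCompact.diff isCompact_Icc (isOpen_iUnion hUo)
  have hfK : IsClosed (f '' (Set.Icc (0 : Fin n → ℝ) 1 \ ⋃ i, U i)) :=
    (hK.image_of_continuousOn (hf.mono Set.sdiff_subset)).isClosed
  have hfq : f q ∉ f '' (Set.Icc (0 : Fin n → ℝ) 1 \ ⋃ i, U i) := by
    rintro ⟨a, ⟨ha, haU⟩, haq⟩
    exact haU (Set.mem_iUnion.2 (hcov a ha haq))
  have hflim : Tendsto (fun ν => f (x (φ ν))) atTop (𝓝 (f q)) :=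
    (hf q hq).tendsto.comp (tendsto_nhdsWithin_iff.2 ⟨hlim, Eventually.of_forall fun ν => hx _⟩)
  have hev : ∀ᶠ ν in atTop, (1 - 1 / (((φ ν).succ : ℕ) + 1 : ℝ)) * (1 - r) ^ n ≤
      2 ^ n * (1 / ((φ ν).succ : ℕ) + (1 + 1 / r) ^ m *
        (1 + 1 / ((φ ν).succ : ℕ) * (1 + 1 / r)) ^ n) *
          (M * (3 * r + 4 * (1 / ((φ ν).succ : ℕ))) ^ n) := by
    filter_upwards [hflim.eventually (hfK.isOpen_compl.mem_nhds hfq)] with ν hν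
    refine hbound (φ ν) r hr0 hr1 M U hUd fun a ha hax => ?_
    by_contra hcon
    exact hν ⟨a, ⟨ha, fun h => hcon (Set.mem_iUnion.1 h)⟩, hax⟩
  have hε : Tendsto (fun ν => (1 : ℝ) / ((φ ν).succ : ℕ)) atTop (𝓝 0) := by
    have h := (tendsto_one_div_add_atTop_nhds_zero_nat (𝕜 := ℝ)).comp hφ.tendsto_atTop
    simpa [Function.comp_def] using h
  have hε' : Tendsto (fun ν => (1 : ℝ) / (((φ ν).succ : ℕ) + 1)) atTop (𝓝 0) := by
    refine squeeze_zero (fun ν => by positivity) (fun ν => ?_) hε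
    gcongr
    linarith
  have hL : Tendsto (fun ν => (1 - 1 / (((φ ν).succ : ℕ) + 1 : ℝ)) * (1 - r) ^ n) atTop
      (𝓝 ((1 - 0) * (1 - r) ^ n)) := (hε'.const_sub 1).mul_const _
  have hR := ((by fun_prop : Continuous fun ε : ℝ => 2 ^ n * (ε + (1 + 1 / r) ^ m *
    (1 + ε * (1 + 1 / r)) ^ n) * (M * (3 * r + 4 * ε) ^ n)).tendsto 0).comp hε
  have h := le_of_tendsto_of_tendsto hL hR hev
  simpa using h

end covering

/-- waist inequality for covering numbers: for `1 ≤ m ≤ n` and any continuous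
`f : [0,1]^n → ℝ^m` there is `t ∈ ℝ^m` with
`#(f⁻¹(t), ‖·‖_∞, r) ≥ 8^{-n} (1/r)^{n−m}` for all `0 < r < 1/2`. -/
theorem stmt_9 (n m : ℕ) (hm : 1 ≤ m) (hmn : m ≤ n)
    (f : (Fin n → ℝ) → (Fin m → ℝ)) (hf : ContinuousOn f (Set.Icc 0 1)) :
    ∃ t : Fin m → ℝ, ∀ r : ℝ, 0 < r → r < 1 / 2 →
      (1 / 8 ^ n : ℝ) * (1 / r) ^ (n - m) ≤
        (covNum (fun x y : Fin n → ℝ => ‖x - y‖) r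
          {x : Fin n → ℝ | x ∈ Set.Icc (0 : Fin n → ℝ) 1 ∧ f x = t} : ℝ) := by
  have hsub : ∀ t, {x : Fin n → ℝ | x ∈ Set.Icc (0 : Fin n → ℝ) 1 ∧ f x = t} ⊆ Set.Icc 0 1 :=
    fun t x hx => hx.1
  have hone : ∀ q ∈ Set.Icc (0 : Fin n → ℝ) 1, ∀ r : ℝ, 0 < r →
      (1 : ℝ) ≤ covNum (fun x y : Fin n → ℝ => ‖x - y‖) r
        {x : Fin n → ℝ | x ∈ Set.Icc (0 : Fin n → ℝ) 1 ∧ f x = f q} := fun q hq r hr => by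
    exact_mod_cast one_le_covNum (hsub _) ⟨q, hq, rfl⟩ hr
  rcases hmn.eq_or_lt with rfl | hlt
  · refine ⟨f 0, fun r hr _ => le_trans ?_ (hone 0 ⟨le_rfl, zero_le_one⟩ r hr)⟩
    rw [Nat.sub_self, pow_zero, mul_one, div_le_one (by positivity)]
    exact one_le_pow₀ (by norm_num)
  obtain ⟨q, hq, hbound⟩ := exists_fiber_cover_bound_limit hm hlt hf
  refine ⟨f q, fun r hr _ => ?_⟩
  rcases le_or_gt (1 / 8) r with h8 | h8
  · refine le_trans ?_ (hone q hq r hr)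
    have h1 : (1 / r) ^ (n - m) ≤ 8 ^ n := by
      calc (1 / r) ^ (n - m) ≤ 8 ^ (n - m) := by
            gcongr
            rw [div_le_iff₀ hr]
            linarith
        _ ≤ 8 ^ n := pow_le_pow_right₀ (by norm_num) (Nat.sub_le _ _)
    rw [one_div, ← div_eq_inv_mul, div_le_one (by positivity)]
    exact h1
  · obtain ⟨U, hUo, hUd, hUc⟩ := exists_cover_covNum (hsub (f q)) hr
    have h := hbound r hr (by linarith) _ U hUo hUd fun a ha haq =>
      Set.mem_iUnion.1 (hUc ⟨ha, haq⟩)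
    set M := covNum (fun x y : Fin n → ℝ => ‖x - y‖) r
      {x : Fin n → ℝ | x ∈ Set.Icc (0 : Fin n → ℝ) 1 ∧ f x = f q}
    have h1 : (3 / 4 * (1 + r)) ^ n ≤ (1 - r) ^ n := by
      gcongr
      linarith
    have h2 : (2 : ℝ) ^ n * (1 + 1 / r) ^ m * (M * (3 * r) ^ n) ≤
        6 ^ n * (1 + r) ^ n * r ^ (n - m) * M := by
      have h3 : (1 + 1 / r) ^ m * r ^ n = (1 + r) ^ m * r ^ (n - m) := by
        rw [show 1 + 1 / r = (1 + r) / r by field_simp; ring, div_pow, div_mul_eq_mul_div,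
          div_eq_iff (by positivity), mul_assoc, ← pow_add, Nat.sub_add_cancel hmn]
      have h4 : (1 + r) ^ m ≤ (1 + r) ^ n := pow_le_pow_right₀ (by linarith) hmn
      calc (2 : ℝ) ^ n * (1 + 1 / r) ^ m * (M * (3 * r) ^ n)
          = (2 * 3) ^ n * ((1 + 1 / r) ^ m * r ^ n) * M := by
            rw [mul_pow, mul_pow]
            ring
        _ = 6 ^ n * ((1 + r) ^ m * r ^ (n - m)) * M := by
            rw [h3]
            norm_num
        _ ≤ 6 ^ n * ((1 + r) ^ n * r ^ (n - m)) * M := by gcongr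
        _ = _ := by ring
    have h5 : (6 : ℝ) ^ n * (1 + r) ^ n * (1 / 8 ^ n) ≤
        6 ^ n * (1 + r) ^ n * (r ^ (n - m) * M) := by
      calc (6 : ℝ) ^ n * (1 + r) ^ n * (1 / 8 ^ n) = (3 / 4 * (1 + r)) ^ n := by
            rw [mul_one_div, ← mul_pow, ← div_pow]
            congr 1
            ring
        _ ≤ _ := by linarith
    have h6 := le_of_mul_le_mul_left h5 (by positivity)
    rw [one_div_pow, mul_one_div, div_le_iff₀ (by positivity)]
    linarith
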